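/- arXiv:1309.3530 — 8 statements merged into one kernel-verified Lean document; each statement's English description precedes it below -/
import Mathlib

section
/- Let q be an odd prime power and let a, b ∈ F_q. The polynomial f(x) = a·x + b·x^q + x^(2q−1) ∈ F_q[x] is a permutation polynomial of F_{q²} if and only if one of the following holds: (i) a(a−1) is a nonzero square in F_q and b² = a² + 3a; (ii) a = 1 and b² − 4 is a nonzero square in F_q; (iii) a = 3, b = 0, and q ≡ −1 (mod 6); (iv) a = b = 0 and q ≡ 1 or 3 (mod 6). -/
namespace HouTrinomial

variable {K : Type*} [Field K]

/-- The discriminant in `z` of `T z³ + (bT - a) z² + (aT - b) z - 1`. -/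
def disc (a b T : K) : K :=
  (b * T - a) ^ 2 * (a * T - b) ^ 2 - 4 * T * (a * T - b) ^ 3 + 4 * (b * T - a) ^ 3
    - 27 * T ^ 2 - 18 * T * (b * T - a) * (a * T - b)

/-- `z` is a root of the cubic expressing `(a z² + b z + 1) / (z³ + b z² + a z) = T`. -/
def IsCubicRoot (a b T z : K) : Prop :=
  T * z ^ 3 + (b * T - a) * z ^ 2 + (a * T - b) * z - 1 = 0

/-- Membership in the group `μ_{q+1}`, for `σ` the `q`-power Frobenius. -/
def OnCircle (σ : K →+* K) (z : K) : Prop := z ≠ 0 ∧ σ z = z⁻¹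

/-- The cubic has a square normalized discriminant at every point of the circle, and
only triple roots where the discriminant vanishes. -/
def SquareDisc (σ : K →+* K) (a b : K) : Prop :=
  ∀ T, OnCircle σ T → ∃ s, σ s = s ∧ disc a b T = (T * s) ^ 2 ∧
    (s = 0 → (b * T - a) ^ 2 = 3 * T * (a * T - b))

theorem disc_of_two_roots {σ : K →+* K} {a b T z₁ z₂ : K}
    (hT : OnCircle σ T) (h₁ : OnCircle σ z₁) (h₂ : OnCircle σ z₂)
    (r₁ : IsCubicRoot a b T z₁) (r₂ : IsCubicRoot a b T z₂) (hne : z₁ ≠ z₂) :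
    ∃ w, σ w = -w ∧ disc a b T = (T * w) ^ 2 ∧
      (w = 0 → (b * T - a) ^ 2 ≠ 3 * T * (a * T - b)) := by
  obtain ⟨hT0, hT⟩ := hT
  obtain ⟨h10, h1⟩ := h₁
  obtain ⟨h20, h2⟩ := h₂
  unfold IsCubicRoot at r₁ r₂
  unfold disc
  generalize b * T - a = P at *
  generalize a * T - b = Q at *
  have hd : z₁ - z₂ ≠ 0 := sub_ne_zero.2 hne
  obtain ⟨z₃, hz₃⟩ : ∃ z₃, T * z₁ * z₂ * z₃ = 1 := ⟨(T * z₁ * z₂)⁻¹, by field_simp⟩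
  have h30 : z₃ ≠ 0 := by rintro rfl; simp at hz₃
  have h3 : σ z₃ = z₃⁻¹ := by
    have := congrArg σ hz₃
    simp only [map_mul, map_one, hT, h1, h2] at this
    field_simp at this ⊢
    rw [this]; linear_combination hz₃
  have e1 : z₁ * z₂ * (T * (z₁ + z₂) + P) + 1 = 0 := by
    apply mul_left_cancel₀ hd
    linear_combination z₂ * r₁ - z₁ * r₂
  have hP : P = -T * (z₁ + z₂ + z₃) := by
    have : z₁ * z₂ ≠ 0 := mul_ne_zero h10 h20
    apply mul_left_cancel₀ this
    linear_combination e1 + hz₃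
  have hQ : Q = T * (z₁ * z₂ + z₃ * (z₁ + z₂)) := by
    apply mul_left_cancel₀ hd
    rw [hP] at r₁ r₂
    linear_combination r₁ - r₂
  refine ⟨T * ((z₁ - z₂) * (z₂ - z₃) * (z₁ - z₃)), ?_, ?_, ?_⟩
  · simp only [map_mul, map_sub, hT, h1, h2, h3]
    field_simp
    linear_combination ((z₁ - z₂) * (z₂ - z₃) * (z₁ - z₃)) * (T * z₁ * z₂ * z₃ + 1) * hz₃
  · rw [hP, hQ]
    have hk : (T * z₁ * z₂ * z₃) ^ 2 = 1 := by rw [hz₃]; ring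
    linear_combination (27 * T ^ 2) * hk + (4 * T ^ 3 * (z₁ + z₂ + z₃) ^ 3
      - 18 * T ^ 3 * (z₁ + z₂ + z₃) * (z₁ * z₂ + z₃ * (z₁ + z₂))) * hz₃
  · intro hw
    have hd2 : (z₁ - z₂) ^ 2 ≠ 0 := pow_ne_zero 2 hd
    rw [hP, hQ]
    intro h
    have : T ^ 2 * (z₁ - z₂) ^ 2 ≠ 0 := mul_ne_zero (pow_ne_zero 2 hT0) hd2
    have h' : (z₂ - z₃) * (z₁ - z₃) = 0 := by
      simpa [hT0, hd] using hw
    apply this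
    linear_combination h - T ^ 2 * h'

theorem squareDisc_of_unique {σ : K →+* K} {a b : K} (h2 : (2 : K) ≠ 0)
    (ha : σ a = a) (hb : σ b = b)
    (hsq : ∀ x, σ x = x → ∃ w, w ^ 2 = x)
    (hu : ∀ T, OnCircle σ T → ∃! z, OnCircle σ z ∧ IsCubicRoot a b T z) :
    SquareDisc σ a b := by
  intro T hT
  obtain ⟨z, ⟨⟨hz0, hz⟩, r⟩, huniq⟩ := hu T hT
  obtain ⟨hT0, hT⟩ := hT
  unfold IsCubicRoot at r huniq
  have hσP : T * σ (b * T - a) = -(a * T - b) := by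
    simp only [map_sub, map_mul, ha, hb, hT]; field_simp; ring
  have hσQ : T * σ (a * T - b) = -(b * T - a) := by
    simp only [map_sub, map_mul, ha, hb, hT]; field_simp; ring
  have hdT : T ^ 4 * σ (disc a b T) = disc a b T := by
    have hσP : σ (b * T - a) = -(a * T - b) / T := by rw [← hσP]; field_simp
    have hσQ : σ (a * T - b) = -(b * T - a) / T := by rw [← hσQ]; field_simp
    unfold disc
    generalize b * T - a = P at *
    generalize a * T - b = Q at *
    simp only [map_sub, map_add, map_mul, map_pow, map_ofNat, hσP, hσQ, hT]
    field_simp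
    ring
  obtain ⟨w, hw⟩ := hsq (disc a b T / T ^ 2) (by
    rw [map_div₀, map_pow, hT]
    field_simp
    linear_combination hdT)
  have hdisc : disc a b T = (T * w) ^ 2 := by
    rw [mul_pow, hw]; field_simp
  have hσw : σ w = w ∨ σ w = -w := by
    apply sq_eq_sq_iff_eq_or_eq_neg.1
    rw [← map_pow, hw, map_div₀, map_pow, hT]
    field_simp
    linear_combination hdT
  unfold disc at hdisc ⊢
  clear hdT
  generalize b * T - a = P at *
  generalize a * T - b = Q at *
  have hQ : Q = z⁻¹ - T * z ^ 2 - P * z := by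
    field_simp
    linear_combination r
  set p := T * z + P with hp
  set N := T * z ^ 2 + p * z + z⁻¹ with hN
  have hσp : σ p = p * z / T := by
    have : σ P = -Q / T := by rw [← hσP]; field_simp
    rw [hp, map_add, map_mul, hT, hz, this, hQ]
    field_simp
    ring
  have hσN : σ N = N / (T * z) := by
    rw [hN, map_add, map_add, map_mul, map_mul, map_pow, map_inv₀, hσp, hT, hz]
    field_simp
    ring
  have hfac : (T * w) ^ 2 = N ^ 2 * (p ^ 2 - 4 * T / z) := by
    rw [← hdisc, hN, hp, hQ]
    field_simp
    ring
  have key : ∀ τ, τ ^ 2 = p ^ 2 - 4 * T / z → σ τ = -τ * z / T → τ = p + 2 * T * z := by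
    intro τ hτ hστ
    have hprod : (-p + τ) * (-p - τ) * z = 4 * T := by
      have : (-p + τ) * (-p - τ) = p ^ 2 - τ ^ 2 := by ring
      rw [this, hτ]; field_simp; ring
    have hx0 : -p + τ ≠ 0 := by
      intro h0
      rw [h0] at hprod
      have : (2 : K) * 2 * T = 0 := by linear_combination -hprod
      simp [h2, hT0] at this
    have := huniq ((-p + τ) / (2 * T)) ⟨⟨div_ne_zero hx0 (mul_ne_zero h2 hT0), ?_⟩, ?_⟩
    · field_simp at this
      linear_combination this
    · rw [map_div₀, map_add, map_neg, map_mul, map_ofNat, hσp, hστ, hT]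
      field_simp
      linear_combination hprod
    · have hτ' : z * τ ^ 2 = z * p ^ 2 - 4 * T := by rw [hτ]; field_simp
      have hq : T * ((-p + τ) / (2 * T)) ^ 2 + p * ((-p + τ) / (2 * T)) + z⁻¹ = 0 := by
        field_simp
        linear_combination hτ'
      rw [hQ]
      have hP' : P = p - T * z := by rw [hp]; ring
      rw [hP']
      generalize (-p + τ) / (2 * T) = x at hq ⊢
      have : z * z⁻¹ = 1 := mul_inv_cancel₀ hz0
      linear_combination (x - z) * hq + this
  by_cases hw0 : w = 0
  · refine ⟨0, map_zero σ, by rw [hdisc, hw0], fun _ => ?_⟩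
    rw [hw0, mul_zero, zero_pow two_ne_zero] at hfac
    have hz3 : p = -2 * T * z ∧ T * z ^ 3 = 1 := by
      rcases mul_eq_zero.1 hfac.symm with h | h
      · have hN0 : N = 0 := by simpa using h
        have := huniq (1 / (T * z ^ 2)) ⟨⟨by simp [hT0, hz0], ?_⟩, ?_⟩
        · have h3 : T * z ^ 3 = 1 := by field_simp at this; rw [this]
          refine ⟨?_, h3⟩
          have : p * z = -(T * z ^ 2) - z⁻¹ := by linear_combination hN0
          apply mul_right_cancel₀ hz0
          rw [this]
          field_simp
          linear_combination h3
        · simp only [map_div₀, map_one, map_mul, map_pow, hT, hz]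
          field_simp
        · have hP' : P = p - T * z := by rw [hp]; ring
          have : p = -(T * z) - z⁻¹ * z⁻¹ := by
            apply mul_right_cancel₀ hz0
            field_simp
            rw [hN] at hN0
            field_simp at hN0
            linear_combination hN0
          rw [hQ, hP', this]
          field_simp
          ring
      · have h0 := key 0 (by rw [h]; ring) (by simp)
        have hp' : p = -2 * T * z := by linear_combination -h0
        refine ⟨hp', ?_⟩
        rw [hp'] at h
        field_simp at h
        have : (2 : K) * 2 * T * (T * z ^ 3 - 1) = 0 := by linear_combination h
        simpa [h2, hT0, sub_eq_zero] using this
    obtain ⟨hp3, hz3⟩ := hz3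
    have hP' : P = -3 * T * z := by linear_combination hp3 - hp
    have : z⁻¹ = T * z ^ 2 := by field_simp; linear_combination -hz3
    rw [hQ, hP', this]
    ring
  rcases hσw with hσw | hσw
  · exact ⟨w, hσw, hdisc, fun h => absurd h hw0⟩
  · exfalso
    have hN0 : N ≠ 0 := by
      intro h
      rw [h] at hfac
      simp [hT0, hw0] at hfac
    have hτ : (T * w / N) ^ 2 = p ^ 2 - 4 * T / z := by
      rw [div_pow, hfac]
      field_simp
    have hσ : σ (T * w / N) = -(T * w / N) * z / T := by
      rw [map_div₀, map_mul, hσN, hσw, hT]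
      field_simp
    have k₁ := key _ hτ hσ
    have k₂ := key (-(T * w / N)) (by rw [neg_sq, hτ]) (by rw [map_neg, hσ]; ring)
    have : 2 * (T * w / N) = 0 := by linear_combination k₁ - k₂
    simp [h2, hT0, hw0, hN0] at this


/-- The trinomial `a x + b x^q + x^(2q-1)`, written in terms of the Frobenius `σ`. -/
def trinomial (σ : K →+* K) (a b x : K) : K := a * x + b * σ x + σ x ^ 2 / x

theorem trinomial_of_eq {σ : K →+* K} (a b : K) {x z : K} (h : σ x = z * x) :
    trinomial σ a b x = x * (a + b * z + z ^ 2) := by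
  by_cases hx : x = 0
  · simp [trinomial, hx]
  · rw [trinomial, h]; field_simp

theorem map_trinomial {σ : K →+* K} {a b x z : K} (ha : σ a = a) (hb : σ b = b)
    (hσ : ∀ x, σ (σ x) = x) (hz : z ≠ 0) (h : σ x = z * x) :
    z * σ (trinomial σ a b x) = x * (a * z ^ 2 + b * z + 1) := by
  by_cases hx : x = 0
  · simp [trinomial, hx]
  · rw [trinomial, map_add, map_add, map_mul, map_mul, map_div₀, map_pow, hσ, ha, hb, h]
    field_simp

theorem trinomial_mul {σ : K →+* K} (a b : K) {c : K} (x : K) (hc : σ c = c) :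
    trinomial σ a b (c * x) = c * trinomial σ a b x := by
  by_cases hc0 : c = 0
  · simp [trinomial, hc0]
  by_cases hx : x = 0
  · simp [trinomial, hx]
  · simp only [trinomial, map_mul, hc]; field_simp

theorem onCircle_div {σ : K →+* K} (hσ : ∀ x, σ (σ x) = x) {x : K} (hx : x ≠ 0) :
    OnCircle σ (σ x / x) := by
  refine ⟨div_ne_zero ((map_ne_zero σ).2 hx) hx, ?_⟩
  rw [map_div₀, hσ, inv_div]

theorem existsUnique_root_of_bijective {σ : K →+* K} {a b : K} (ha : σ a = a) (hb : σ b = b)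
    (hσ : ∀ x, σ (σ x) = x) (h90 : ∀ T, OnCircle σ T → ∃ y, y ≠ 0 ∧ σ y = T * y)
    (hf : Function.Bijective (trinomial σ a b)) (T : K) (hT : OnCircle σ T) :
    ∃! z, OnCircle σ z ∧ IsCubicRoot a b T z := by
  have hf0 : trinomial σ a b 0 = 0 := by simp [trinomial]
  apply existsUnique_of_exists_of_unique
  · obtain ⟨y, hy0, hy⟩ := h90 T hT
    obtain ⟨x, hx⟩ := hf.2 y
    have hx0 : x ≠ 0 := by rintro rfl; exact hy0 (hx ▸ hf0)
    have hz := onCircle_div hσ hx0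
    have hx1 : σ x = σ x / x * x := by field_simp
    refine ⟨_, hz, ?_⟩
    have h1 := trinomial_of_eq a b hx1
    have h2 := map_trinomial ha hb hσ hz.1 hx1
    generalize σ x / x = z at *
    rw [hx] at h1 h2
    rw [hy, h1] at h2
    apply mul_left_cancel₀ hx0
    linear_combination h2
  · rintro z₁ z₂ ⟨h₁, r₁⟩ ⟨h₂, r₂⟩
    have aux : ∀ z, OnCircle σ z → IsCubicRoot a b T z →
        ∃ x, x ≠ 0 ∧ σ x = z * x ∧ trinomial σ a b x ≠ 0 ∧
          σ (trinomial σ a b x) = T * trinomial σ a b x := by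
      intro z hz r
      obtain ⟨x, hx0, hx⟩ := h90 z hz
      refine ⟨x, hx0, hx, fun h => hx0 (hf.1 (h.trans hf0.symm)), ?_⟩
      apply mul_left_cancel₀ hz.1
      rw [map_trinomial ha hb hσ hz.1 hx, trinomial_of_eq a b hx]
      unfold IsCubicRoot at r
      linear_combination -x * r
    obtain ⟨x, hx0, hx, hy0, hy⟩ := aux z₁ h₁ r₁
    obtain ⟨x', hx0', hx', hy0', hy'⟩ := aux z₂ h₂ r₂
    have hc : σ (trinomial σ a b x / trinomial σ a b x') =
        trinomial σ a b x / trinomial σ a b x' := by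
      rw [map_div₀, hy, hy', mul_div_mul_left _ _ hT.1]
    have h := trinomial_mul a b x' hc
    rw [div_mul_cancel₀ _ hy0'] at h
    have hxx := hf.1 h
    clear hy
    generalize trinomial σ a b x / trinomial σ a b x' = c at hc hxx
    have h4 : z₂ * x = z₁ * x := by
      rw [← hx, ← hxx, map_mul, hc, hx']
      ring
    exact (mul_right_cancel₀ hx0 h4).symm

theorem injective_of_unique_root {σ : K →+* K} {a b ζ : K} (h2 : (2 : K) ≠ 0)
    (ha : σ a = a) (hb : σ b = b) (hσ : ∀ x, σ (σ x) = x)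
    (hζ : OnCircle σ ζ) (hζ2 : ζ ^ 2 ≠ 1)
    (hu : ∀ T z₁ z₂, OnCircle σ T → OnCircle σ z₁ → OnCircle σ z₂ →
      IsCubicRoot a b T z₁ → IsCubicRoot a b T z₂ → z₁ = z₂) :
    Function.Injective (trinomial σ a b) := by
  have hf0 : trinomial σ a b 0 = 0 := by simp [trinomial]
  have hker : ∀ x, trinomial σ a b x = 0 → x = 0 := by
    intro x hx
    by_contra hx0
    have hz := onCircle_div hσ hx0
    have hx1 : σ x = σ x / x * x := by field_simp
    have h1 := trinomial_of_eq a b hx1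
    have h2' := map_trinomial ha hb hσ hz.1 hx1
    generalize σ x / x = z at *
    rw [hx] at h1 h2'
    have e1 : a + b * z + z ^ 2 = 0 := by simpa [hx0] using h1.symm
    have e2 : a * z ^ 2 + b * z + 1 = 0 := by simpa [hx0] using h2'.symm
    obtain ⟨z', hz', hne⟩ : ∃ z', OnCircle σ z' ∧ a + b * z' + z' ^ 2 ≠ 0 := by
      by_contra! hall
      have h3 := hall 1 ⟨one_ne_zero, by simp⟩
      have h4 := hall (-1) ⟨by simp, by simp [inv_neg]⟩
      have h5 := hall ζ hζ
      have hb0 : b = 0 := by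
        apply mul_left_cancel₀ h2
        linear_combination h3 - h4
      subst hb0
      apply hζ2
      linear_combination h5 - h3
    have hσh : σ (a + b * z' + z' ^ 2) * z' ^ 2 = a * z' ^ 2 + b * z' + 1 := by
      have := hz'.1
      simp only [map_add, map_mul, map_pow, ha, hb, hz'.2]
      field_simp
    have hT : OnCircle σ (z' * (σ (a + b * z' + z' ^ 2) / (a + b * z' + z' ^ 2))) := by
      have := onCircle_div hσ hne
      refine ⟨mul_ne_zero hz'.1 this.1, ?_⟩
      rw [map_mul, this.2, hz'.2, mul_inv]
    have := hu _ z z' hT hz hz' ?_ ?_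
    · exact hne (this ▸ e1)
    · unfold IsCubicRoot
      generalize z' * _ = T
      linear_combination T * z * e1 - e2
    · unfold IsCubicRoot
      have : (z' * (σ (a + b * z' + z' ^ 2) / (a + b * z' + z' ^ 2))) * (a + b * z' + z' ^ 2) =
        z' * σ (a + b * z' + z' ^ 2) := by rw [mul_assoc, div_mul_cancel₀ _ hne]
      linear_combination z' * this + hσh
  intro x y hxy
  by_cases hx : trinomial σ a b x = 0
  · rw [hker x hx, hker y (hxy ▸ hx)]
  have hx0 : x ≠ 0 := by rintro rfl; exact hx hf0
  have hy0 : y ≠ 0 := by rintro rfl; exact hx (hxy.trans hf0)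
  have hT := onCircle_div hσ hx
  have aux : ∀ w, w ≠ 0 → trinomial σ a b w = trinomial σ a b x →
      IsCubicRoot a b (σ (trinomial σ a b x) / trinomial σ a b x) (σ w / w) := by
    intro w hw0 hw
    have hz := onCircle_div hσ hw0
    have hx1 : σ w = σ w / w * w := by field_simp
    have h1 := trinomial_of_eq a b hx1
    have h2 := map_trinomial ha hb hσ hz.1 hx1
    rw [← hw] at hx ⊢
    generalize σ w / w = z at *
    generalize σ (trinomial σ a b w) = v at *
    rw [h1] at hx ⊢
    have : v / (w * (a + b * z + z ^ 2)) * (w * (a + b * z + z ^ 2)) = v :=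
      div_mul_cancel₀ _ hx
    unfold IsCubicRoot
    apply mul_left_cancel₀ hw0
    linear_combination z * this + h2
  have hz := hu _ _ _ hT (onCircle_div hσ hx0) (onCircle_div hσ hy0) (aux x hx0 rfl)
    (aux y hy0 hxy.symm)
  have hc : σ (x / y) = x / y := by
    rw [map_div₀]
    have := (map_ne_zero σ).2 hy0
    field_simp at hz ⊢
    linear_combination hz
  have h := trinomial_mul a b y hc
  rw [div_mul_cancel₀ _ hy0, hxy] at h
  have hy : trinomial σ a b y ≠ 0 := hxy ▸ hx
  have : x / y = 1 := by
    apply mul_right_cancel₀ hy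
    rw [← h, one_mul]
  exact (div_eq_one_iff_eq hy0).1 this

theorem unique_root_of_squareDisc {σ : K →+* K} {a b : K} (h2 : (2 : K) ≠ 0)
    (h : SquareDisc σ a b) (T z₁ z₂ : K) (hT : OnCircle σ T) (h₁ : OnCircle σ z₁)
    (h₂ : OnCircle σ z₂) (r₁ : IsCubicRoot a b T z₁) (r₂ : IsCubicRoot a b T z₂) : z₁ = z₂ := by
  by_contra hne
  obtain ⟨w, hσw, hw, hw0⟩ := disc_of_two_roots hT h₁ h₂ r₁ r₂ hne
  obtain ⟨s, hσs, hs, hs0⟩ := h T hT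
  rw [hs] at hw
  have hsw : s = w ∨ s = -w := by
    rcases sq_eq_sq_iff_eq_or_eq_neg.1 hw with h | h
    · exact Or.inl (mul_left_cancel₀ hT.1 h)
    · exact Or.inr (mul_left_cancel₀ hT.1 (by rw [h]; ring))
  have hs' : s = 0 := by
    apply mul_left_cancel₀ h2
    rcases hsw with rfl | rfl
    · linear_combination hσw - hσs
    · rw [map_neg, hσw] at hσs
      linear_combination -hσs
  have hw' : w = 0 := by
    rcases hsw with h | h
    · rw [← h, hs']
    · rw [← neg_eq_zero, ← h, hs']
  exact hw0 hw' (hs0 hs')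

theorem trinomial_bijective_iff [Finite K] {σ : K →+* K} {a b ζ : K} (h2 : (2 : K) ≠ 0)
    (ha : σ a = a) (hb : σ b = b) (hσ : ∀ x, σ (σ x) = x)
    (h90 : ∀ T, OnCircle σ T → ∃ y, y ≠ 0 ∧ σ y = T * y)
    (hsq : ∀ x, σ x = x → ∃ w, w ^ 2 = x) (hζ : OnCircle σ ζ) (hζ2 : ζ ^ 2 ≠ 1) :
    Function.Bijective (trinomial σ a b) ↔ SquareDisc σ a b :=
  ⟨fun hf => squareDisc_of_unique h2 ha hb hsq
    (existsUnique_root_of_bijective ha hb hσ h90 hf),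
  fun h => Finite.injective_iff_bijective.1
    (injective_of_unique_root h2 ha hb hσ hζ hζ2 (unique_root_of_squareDisc h2 h))⟩

/-- The classification over the quadratic extension: fixed points of `σ` stand for elements
of the base field, and the congruences on `q` become conditions on a square root of `-3`. -/
def Classification (σ : K →+* K) (a b : K) : Prop :=
  ((∃ v, σ v = v ∧ v ≠ 0 ∧ a * (a - 1) = v ^ 2) ∧ b ^ 2 = a ^ 2 + 3 * a) ∨
  (a = 1 ∧ ∃ v, σ v = v ∧ v ≠ 0 ∧ b ^ 2 - 4 = v ^ 2) ∨
  (a = 3 ∧ b = 0 ∧ ∃ w, σ w = -w ∧ w ≠ 0 ∧ w ^ 2 = -3) ∨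
  (a = 0 ∧ b = 0 ∧ ∃ w, σ w = w ∧ w ^ 2 = -3)

theorem sq_mul_disc {a b : K} (hab : b ^ 2 = a ^ 2 + 3 * a) (T : K) :
    a ^ 2 * disc a b T = a * (a - 1) * (a ^ 2 * (T ^ 2 + 1) - (2 * a - 3) * b * T) ^ 2 := by
  unfold disc
  linear_combination (a ^ 4 * (T ^ 4 + 1) + a ^ 2 * b * (4 - 2 * a) * (T ^ 3 + T)
    + (a ^ 2 * b ^ 2 + a ^ 4 - 5 * a ^ 3 - 3 * a ^ 2 + 9 * a) * T ^ 2) * hab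

theorem squareDisc_of_classification {σ : K →+* K} {a b : K} (h2 : (2 : K) ≠ 0)
    (ha : σ a = a) (hb : σ b = b) (h : Classification σ a b) : SquareDisc σ a b := by
  rintro T ⟨hT0, hT⟩
  rcases h with ⟨⟨v, hσv, hv0, hv⟩, hab⟩ | ⟨rfl, v, hσv, hv0, hv⟩ | ⟨rfl, rfl, w, hσw, hw0, hw⟩ |
    ⟨rfl, rfl, w, hσw, hw⟩
  · have ha0 : a ≠ 0 := by
      rintro rfl
      exact hv0 (by simpa using hv.symm)
    refine ⟨v * (a ^ 2 * (T ^ 2 + 1) - (2 * a - 3) * b * T) / (a * T), ?_, ?_, ?_⟩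
    · simp only [map_div₀, map_mul, map_sub, map_add, map_pow, map_one, map_ofNat, ha, hb, hT, hσv]
      field_simp
      ring
    · have : a ^ 2 * disc a b T = v ^ 2 * (a ^ 2 * (T ^ 2 + 1) - (2 * a - 3) * b * T) ^ 2 := by
        rw [← hv, sq_mul_disc hab]
      field_simp
      linear_combination this
    · intro hs
      have h : a ^ 2 * (T ^ 2 + 1) - (2 * a - 3) * b * T = 0 := by
        simpa [hv0, ha0, hT0] using hs
      linear_combination h + T ^ 2 * hab
  · refine ⟨v * (T ^ 2 + b * T + 1) / T, ?_, ?_, ?_⟩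
    · simp only [map_div₀, map_mul, map_add, map_pow, map_one, hb, hT, hσv]
      field_simp
      ring
    · have : disc 1 b T = v ^ 2 * (T ^ 2 + b * T + 1) ^ 2 := by
        rw [← hv]
        unfold disc
        ring
      field_simp
      linear_combination this
    · intro hs
      have h : T ^ 2 + b * T + 1 = 0 := by simpa [hv0, hT0] using hs
      have h3 : (v * T) ^ 2 = (T ^ 2 - 1) ^ 2 := by
        rw [mul_pow, ← hv]
        linear_combination (b * T - T ^ 2 - 1) * h
      have key : ∀ u, σ u = u → u ≠ 0 → u * T ≠ T ^ 2 - 1 := by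
        intro u hσu hu0 hu
        have hu' : u = T - T⁻¹ := by
          field_simp
          linear_combination hu
        have h4 := hσu
        rw [hu', map_sub, map_inv₀, hT, inv_inv, ← neg_sub, ← hu'] at h4
        apply hu0
        apply mul_left_cancel₀ h2
        linear_combination -h4
      exfalso
      rcases sq_eq_sq_iff_eq_or_eq_neg.1 h3 with h3 | h3
      · exact key v hσv hv0 h3
      · exact key (-v) (by rw [map_neg, hσv]) (neg_ne_zero.2 hv0) (by linear_combination -h3)
  · refine ⟨6 * w * (T ^ 2 - 1) / T, ?_, ?_, ?_⟩
    · simp only [map_div₀, map_mul, map_sub, map_pow, map_one, map_ofNat, hT, hσw]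
      field_simp
      ring
    · unfold disc
      field_simp
      linear_combination -36 * (T ^ 2 - 1) ^ 2 * hw
    · intro hs
      have h3 : (3 : K) ≠ 0 := by
        intro h3
        apply hw0
        rw [h3] at hw
        simpa using hw
      have h6 : (6 : K) ≠ 0 := by
        have : (6 : K) = 2 * 3 := by norm_num
        rw [this]
        exact mul_ne_zero h2 h3
      have h : T ^ 2 - 1 = 0 := by simpa [h6, hw0, hT0] using hs
      linear_combination -9 * h
  · refine ⟨3 * w, by rw [map_mul, hσw, map_ofNat], ?_, fun _ => by ring⟩
    unfold disc
    linear_combination -9 * T ^ 2 * hw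

theorem classification_of_a_eq_one {σ : K →+* K} {b : K} (h2 : (2 : K) ≠ 0) (hb : σ b = b)
    (h : SquareDisc σ 1 b) : Classification σ 1 b := by
  obtain ⟨s, hσs, hs, hs0⟩ := h 1 ⟨one_ne_zero, by simp⟩
  obtain ⟨t, hσt, ht, ht0⟩ := h (-1) ⟨by simp, by simp [inv_neg]⟩
  have hs' : (b ^ 2 - 4) * (b + 2) ^ 2 = s ^ 2 := by
    unfold disc at hs
    linear_combination hs
  have ht' : (b ^ 2 - 4) * (b - 2) ^ 2 = t ^ 2 := by
    unfold disc at ht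
    linear_combination ht
  have hb4 : b ^ 2 - 4 ≠ 0 := by
    intro h4
    rw [h4, zero_mul] at hs' ht'
    have e1 := hs0 (by simpa using hs'.symm)
    have e2 := ht0 (by simpa using ht'.symm)
    have : (2 : K) * 2 = 0 := by linear_combination e1 + e2 - 2 * h4
    simp [h2] at this
  have hb2 : b + 2 ≠ 0 := by
    intro h
    apply hb4
    linear_combination (b - 2) * h
  have hv : b ^ 2 - 4 = (s / (b + 2)) ^ 2 := by
    field_simp
    exact hs'
  refine Or.inr (Or.inl ⟨rfl, s / (b + 2), ?_, ?_, hv⟩)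
  · rw [map_div₀, map_add, hσs, hb, map_ofNat]
  · intro h0
    rw [h0] at hv
    exact hb4 (by simpa using hv)

theorem classification_of_zero {σ : K →+* K} (h : SquareDisc σ 0 0) : Classification σ 0 0 := by
  refine Or.inr (Or.inr (Or.inr ⟨rfl, rfl, ?_⟩))
  obtain ⟨s, hσs, hs, hs0⟩ := h 1 ⟨one_ne_zero, by simp⟩
  have hs' : s ^ 2 = -27 := by
    unfold disc at hs
    linear_combination -hs
  by_cases h3 : (3 : K) = 0
  · exact ⟨0, map_zero σ, by simp [h3]⟩
  · refine ⟨s / 3, by rw [map_div₀, hσs, map_ofNat], ?_⟩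
    field_simp
    linear_combination hs'

theorem classification_of_sq_eq {σ : K →+* K} {a b : K} (h2 : (2 : K) ≠ 0)
    (ha : σ a = a) (hb : σ b = b)
    (h : SquareDisc σ a b) (hab : b ^ 2 = a ^ 2 + 3 * a) : Classification σ a b := by
  by_cases ha0 : a = 0
  · subst ha0
    have : b = 0 := by simpa using hab
    subst this
    exact classification_of_zero h
  by_cases ha1 : a = 1
  · subst ha1
    exact classification_of_a_eq_one h2 hb h
  have haa : a * (a - 1) ≠ 0 := mul_ne_zero ha0 (sub_ne_zero.2 ha1)
  have key : ∀ T : K, T ^ 2 = 1 → OnCircle σ T → 2 * a ^ 2 - (2 * a - 3) * b * T ≠ 0 →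
      Classification σ a b := by
    intro T hT1 hT hne
    obtain ⟨s, hσs, hs, -⟩ := h T hT
    have hσT : σ T = T := by
      rw [hT.2]
      have := hT.1
      field_simp
      exact hT1.symm
    have hv : a * (a - 1) = (a * s / (2 * a ^ 2 - (2 * a - 3) * b * T)) ^ 2 := by
      have := sq_mul_disc hab T
      rw [div_pow, eq_div_iff (pow_ne_zero 2 hne)]
      rw [hs, hT1, mul_pow, hT1] at this
      linear_combination -this
    refine Or.inl ⟨⟨_, ?_, ?_, hv⟩, hab⟩
    · simp only [map_div₀, map_mul, map_sub, map_pow, map_ofNat, ha, hb, hσs, hσT]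
    · intro h0
      rw [h0] at hv
      exact haa (by simpa using hv)
  by_cases h1 : 2 * a ^ 2 - (2 * a - 3) * b * 1 = 0
  · apply key (-1) (by ring) ⟨by simp, by simp [inv_neg]⟩
    intro h'
    have : 2 * 2 * a ^ 2 = 0 := by linear_combination h1 + h'
    simp [h2, ha0] at this
  · exact key 1 (by ring) ⟨by simp, by simp⟩ h1

theorem classification_of_three {σ : K →+* K} {ζ : K} (h2 : (2 : K) ≠ 0)
    (hζ : OnCircle σ ζ) (hζ2 : ζ ^ 2 ≠ 1)
    (h : SquareDisc σ 3 0) : Classification σ 3 0 := by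
  by_cases h3 : (3 : K) = 0
  · rw [h3] at h ⊢
    exact classification_of_zero h
  obtain ⟨s, hσs, hs, -⟩ := h ζ hζ
  obtain ⟨hζ0, hζ⟩ := hζ
  have hne : ζ ^ 2 - 1 ≠ 0 := sub_ne_zero.2 hζ2
  have h6 : (6 : K) ≠ 0 := by
    have : (6 : K) = 2 * 3 := by norm_num
    rw [this]
    exact mul_ne_zero h2 h3
  have hw : (ζ * s / (6 * (ζ ^ 2 - 1))) ^ 2 = -3 := by
    rw [div_pow, ← hs, div_eq_iff (pow_ne_zero 2 (mul_ne_zero h6 hne))]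
    unfold disc
    ring
  refine Or.inr (Or.inr (Or.inl ⟨rfl, rfl, _, ?_, ?_, hw⟩))
  · have hne' : 1 - ζ ^ 2 ≠ 0 := by rw [← neg_sub]; exact neg_ne_zero.2 hne
    simp only [map_div₀, map_mul, map_sub, map_pow, map_one, map_ofNat, hσs, hζ]
    have : (ζ⁻¹ ^ 2 - 1) = (1 - ζ ^ 2) / ζ ^ 2 := by field_simp
    rw [this]
    field_simp
    ring
  · intro h0
    rw [h0] at hw
    exact h3 (by simpa using hw)

/-- The coefficient of `T⁴` and of `1` in the discriminant. -/
def coeffA (a b : K) : K := a ^ 2 * b ^ 2 - 4 * a ^ 3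

/-- The coefficient of `T³` and of `T` in the discriminant. -/
def coeffB (a b : K) : K :=
  -2 * a * b * (a ^ 2 + b ^ 2) + 12 * a ^ 2 * b + 4 * b ^ 3 - 18 * a * b

/-- The coefficient of `T²` in the discriminant. -/
def coeffC (a b : K) : K :=
  (a ^ 2 + b ^ 2) ^ 2 + 2 * a ^ 2 * b ^ 2 - 24 * a * b ^ 2 - 27 + 18 * (a ^ 2 + b ^ 2)

theorem disc_eq (a b T : K) : disc a b T =
    coeffA a b * T ^ 4 + coeffB a b * T ^ 3 + coeffC a b * T ^ 2 + coeffB a b * T + coeffA a b := by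
  unfold disc coeffA coeffB coeffC
  ring

theorem classification_of_coeff {σ : K →+* K} {a b : K} (h2 : (2 : K) ≠ 0)
    (ha : σ a = a) (hb : σ b = b) (h : SquareDisc σ a b)
    (hc : coeffB a b ^ 2 = 4 * coeffA a b * (coeffC a b - 2 * coeffA a b)) :
    Classification σ a b := by
  have hfac : 2 ^ 4 * (1 - a) * (b ^ 2 - a ^ 2 - 3 * a) ^ 3 = 0 := by
    unfold coeffA coeffB coeffC at hc
    linear_combination hc
  rcases mul_eq_zero.1 hfac with h1 | h1
  · have : a = 1 := by
      have : 1 - a = 0 := by simpa [h2] using h1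
      linear_combination -this
    subst this
    exact classification_of_a_eq_one h2 hb h
  · have := pow_eq_zero_iff (three_ne_zero) |>.1 h1
    exact classification_of_sq_eq h2 ha hb h (by linear_combination this)

theorem zero_of_disc {σ : K →+* K} {a b T : K} (h : SquareDisc σ a b)
    (hT : OnCircle σ T) (h0 : disc a b T = 0) :
    (b * T - a) ^ 2 = 3 * T * (a * T - b) := by
  obtain ⟨s, -, hs, hs0⟩ := h T hT
  apply hs0
  rw [h0] at hs
  simpa [hT.1] using hs.symm

theorem eq_of_disc_one {σ : K →+* K} {a b : K} (h : SquareDisc σ a b)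
    (h0 : disc a b 1 = 0) : b = a - 3 := by
  have h1 := zero_of_disc h ⟨one_ne_zero, by simp⟩ h0
  have h2 : (b - a) * (b - a + 3) = 0 := by linear_combination h1
  rcases mul_eq_zero.1 h2 with h2 | h2
  · have hb : b = a := by linear_combination h2
    subst hb
    have : (3 : K) ^ 3 = 0 := by
      unfold disc at h0
      linear_combination -h0
    have h3 : (3 : K) = 0 := by simpa using this
    rw [h3, sub_zero]
  · linear_combination h2

theorem squareDisc_neg {σ : K →+* K} {a b : K} (h : SquareDisc σ a b) : SquareDisc σ a (-b) := by
  rintro T ⟨hT0, hT⟩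
  obtain ⟨s, hσs, hs, hs0⟩ := h (-T) ⟨neg_ne_zero.2 hT0, by rw [map_neg, hT, inv_neg]⟩
  refine ⟨s, hσs, ?_, fun h => ?_⟩
  · unfold disc at hs ⊢
    linear_combination hs
  · linear_combination hs0 h

theorem classification_neg {σ : K →+* K} {a b : K} (h : Classification σ a (-b)) :
    Classification σ a b := by
  simpa only [Classification, neg_sq, neg_eq_zero] using h

theorem sq_eq_of_disc {σ : K →+* K} {a b T : K} (ha : σ a = a) (hb : σ b = b)
    (h : SquareDisc σ a b) (hT : OnCircle σ T) (h0 : disc a b T = 0) (hT2 : T ^ 2 ≠ 1) :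
    b ^ 2 = a ^ 2 + 3 * a := by
  have h1 := zero_of_disc h hT h0
  obtain ⟨hT0, hT⟩ := hT
  have h3 := congrArg σ h1
  simp only [map_mul, map_sub, map_pow, map_ofNat, ha, hb, hT] at h3
  field_simp at h3
  apply mul_right_cancel₀ (sub_ne_zero.2 hT2)
  linear_combination h1 - h3

open Polynomial in
theorem X_pow_sub_one_dvd {n : ℕ} {ζ : K} (hζ : IsPrimitiveRoot ζ n) (hn : 0 < n) {P : K[X]}
    (h : ∀ T : K, T ^ n = 1 → P.eval T = 0) : X ^ n - 1 ∣ P := by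
  rw [X_pow_sub_one_eq_prod hn hζ]
  refine Finset.prod_dvd_of_coprime ?_ ?_
  · intro x _ y _ hxy
    exact isCoprime_X_sub_C_of_isUnit_sub (sub_ne_zero.2 hxy).isUnit
  · intro T hT
    exact dvd_iff_isRoot.2 (h T ((mem_nthRootsFinset hn 1).1 hT))

open Polynomial in
theorem monic_X_pow_sub_one {n : ℕ} (hn : 0 < n) : (X ^ n - 1 : K[X]).Monic := by
  simpa using monic_X_pow_sub_C (1 : K) hn.ne'

open Polynomial in
theorem natDegree_X_pow_sub_one_mul {n : ℕ} (hn : 0 < n) {P : K[X]} (hP : P ≠ 0) :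
    ((X ^ n - 1) * P).natDegree = n + P.natDegree := by
  rw [(monic_X_pow_sub_one hn).natDegree_mul' hP]
  congr 1
  simpa using natDegree_X_pow_sub_C (R := K) (n := n) (r := 1)

open Polynomial in
theorem natDegree_le_of_X_pow_sub_one_mul {n k : ℕ} (hn : 0 < n) {P : K[X]}
    (h : ((X ^ n - 1) * P).natDegree ≤ n + k) : P.natDegree ≤ k := by
  by_cases hP : P = 0
  · simp [hP]
  · rw [natDegree_X_pow_sub_one_mul hn hP] at h
    omega

open Polynomial in
theorem eq_zero_of_X_pow_sub_one_dvd {n : ℕ} (hn : 0 < n) {P : K[X]}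
    (h : X ^ n - 1 ∣ P) (hP : P.natDegree < n) : P = 0 := by
  obtain ⟨Q, rfl⟩ := h
  by_cases hQ : Q = 0
  · simp [hQ]
  · rw [natDegree_X_pow_sub_one_mul hn hQ] at hP
    omega

open Polynomial in
theorem coeff_eq_zero_of_sextic {c₀ c₁ c₂ c₃ c₄ c₅ c₆ : K}
    (h : C c₆ * X ^ 6 + C c₅ * X ^ 5 + C c₄ * X ^ 4 + C c₃ * X ^ 3 + C c₂ * X ^ 2 + C c₁ * X
      + C c₀ = 0) :
    c₀ = 0 ∧ c₁ = 0 ∧ c₂ = 0 ∧ c₃ = 0 ∧ c₄ = 0 ∧ c₅ = 0 ∧ c₆ = 0 := by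
  have key := fun i => congrArg (fun p => coeff p i) h
  refine ⟨?_, ?_, ?_, ?_, ?_, ?_, ?_⟩
  · simpa [coeff_X, coeff_C] using key 0
  · simpa [coeff_X, coeff_C] using key 1
  · simpa [coeff_X, coeff_C] using key 2
  · simpa [coeff_X, coeff_C] using key 3
  · simpa [coeff_X, coeff_C] using key 4
  · simpa [coeff_X, coeff_C] using key 5
  · simpa [coeff_X, coeff_C] using key 6

open Polynomial in
/-- A palindromic quadratic satisfying `T D^m = -1` on the circle minus `1` vanishes at `1`. -/
theorem quadratic_of_pow_eq {m : ℕ} {ζ α κ : K} (h2 : (2 : K) ≠ 0)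
    (hq : ((2 * m + 1 : ℕ) : K) = 0) (hζ : IsPrimitiveRoot ζ (2 * m + 2))
    (h : ∀ T : K, T ^ (2 * m + 2) = 1 → T ≠ 1 → T * (α * T ^ 2 + κ * T + α) ^ m = -1) :
    2 * α + κ = 0 := by
  have hm : m ≠ 0 := by rintro rfl; simp at hq
  obtain ⟨k, rfl⟩ := Nat.exists_eq_succ_of_ne_zero hm
  set m := k.succ with hmk
  set D : K[X] := C α * X ^ 2 + C κ * X + C α with hD
  have hDdeg : D.natDegree ≤ 2 := natDegree_quadratic_le
  obtain ⟨Q, hQ⟩ := X_pow_sub_one_dvd hζ (by omega) (P := (X - 1) * (X * D ^ m + 1)) (by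
    intro T hT
    by_cases hT1 : T = 1
    · simp [hT1]
    · have := h T hT hT1
      simp only [hD, eval_mul, eval_sub, eval_add, eval_pow, eval_X, eval_C, eval_one, this]
      ring)
  have hdeg : ((X - 1) * (X * D ^ m + 1)).natDegree ≤ 2 * m + 2 + 0 := by
    have h1 : (X - 1 : K[X]).natDegree ≤ 1 := by compute_degree
    have h3 : (D ^ m).natDegree ≤ m * 2 := natDegree_pow_le_of_le m hDdeg
    have h4 : (X * D ^ m + 1).natDegree ≤ 1 + m * 2 := by
      refine natDegree_add_le_of_degree_le (natDegree_mul_le_of_le natDegree_X_le h3) ?_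
      simp
    refine (natDegree_mul_le_of_le h1 h4).trans (by omega)
  rw [hQ] at hdeg
  have hQ0 := natDegree_le_of_X_pow_sub_one_mul (by omega) hdeg
  obtain ⟨c, rfl⟩ : ∃ c, Q = C c := ⟨_, eq_C_of_natDegree_le_zero hQ0⟩
  have hc : c = 1 := by
    have := congrArg (eval 0) hQ
    simp at this
    exact this.symm
  rw [hc, map_one, mul_one] at hQ
  have e1 : (X - 1) * D ^ m = X ^ (2 * m + 1) - 1 := by
    apply mul_left_cancel₀ (X_ne_zero (R := K))
    linear_combination hQ
  have hD0 : D ≠ 0 := by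
    intro h0
    rw [h0, zero_pow hm, mul_zero] at e1
    have := congrArg (eval 0) e1
    simp at this
  have e2 := congrArg derivative e1
  simp only [derivative_mul, derivative_sub, derivative_X, derivative_one, derivative_pow,
    hq, map_zero, zero_mul, sub_zero, one_mul, mul_one, map_natCast] at e2
  have hqm : (2 : K[X]) * (m : K[X]) + 1 = 0 := by
    have := map_natCast (C : K →+* K[X]) (2 * m + 1)
    rw [hq, map_zero] at this
    push_cast at this
    exact this.symm
  have e3 : D ^ k * (2 * D - (X - 1) * derivative D) = 0 := by
    have hpow : D ^ m = D ^ k * D := pow_succ D k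
    rw [hpow] at e2
    have hk : m - 1 = k := by omega
    rw [hk] at e2
    linear_combination 2 * e2 - (X - 1) * D ^ k * derivative D * hqm
  have e4 := (mul_eq_zero.1 e3).resolve_left (pow_ne_zero k hD0)
  have e5 := congrArg (eval 1) e4
  simp [hD] at e5
  rcases e5 with e5 | e5
  · exact absurd e5 h2
  · linear_combination e5

open Polynomial in
theorem quartic_of_pow_eq_large {m : ℕ} {ζ α β γ : K} (h2 : (2 : K) ≠ 0) (hm : 3 ≤ m)
    (hq : ((2 * m + 1 : ℕ) : K) = 0) (hζ : IsPrimitiveRoot ζ (2 * m + 2))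
    (h : ∀ T : K, T ^ (2 * m + 2) = 1 →
      T ^ 2 * (α * T ^ 4 + β * T ^ 3 + γ * T ^ 2 + β * T + α) ^ m = 1) :
    β ^ 2 = 4 * α * (γ - 2 * α) := by
  have hn : 0 < 2 * m + 2 := by omega
  have h1 : 2 * α + 2 * β + γ ≠ 0 := by
    intro h0
    have h1 := h 1 (one_pow _)
    have : α * 1 ^ 4 + β * 1 ^ 3 + γ * 1 ^ 2 + β * 1 + α = 0 := by linear_combination h0
    rw [this, zero_pow (by omega)] at h1
    simp at h1
  set D : K[X] := C α * X ^ 4 + C β * X ^ 3 + C γ * X ^ 2 + C β * X + C α with hD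
  have hDdeg : D.natDegree ≤ 4 := by rw [hD]; compute_degree
  have hqm : (2 : K[X]) * (m : K[X]) + 1 = 0 := by
    have := map_natCast (C : K →+* K[X]) (2 * m + 1)
    rw [hq, map_zero] at this
    push_cast at this
    exact this.symm
  set Y : K[X] := X ^ (2 * m + 2) - 1 with hY
  have hYd : derivative Y = X ^ (2 * m + 1) := by
    have : ((2 * m + 2 : ℕ) : K[X]) = 1 := by
      push_cast
      linear_combination hqm
    rw [hY, derivative_sub, derivative_X_pow, derivative_one, map_natCast, this]
    simp
  have hXY : X * X ^ (2 * m + 1) = Y + 1 := by rw [hY]; ring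
  obtain ⟨Q, hQ⟩ := X_pow_sub_one_dvd hζ hn (P := X ^ 2 * D ^ m - 1) (by
    intro T hT
    have := h T hT
    simp only [hD, eval_mul, eval_sub, eval_add, eval_pow, eval_X, eval_C, eval_one, this,
      sub_self])
  have hQdeg : Q.natDegree ≤ 2 * m := by
    apply natDegree_le_of_X_pow_sub_one_mul hn
    rw [← hQ]
    have h3 : (D ^ m).natDegree ≤ m * 4 := natDegree_pow_le_of_le m hDdeg
    have h4 : (X ^ 2 * D ^ m).natDegree ≤ 2 + m * 4 :=
      natDegree_mul_le_of_le (natDegree_X_pow_le 2) h3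
    refine natDegree_sub_le_of_le (m := 2 * m + 2 + 2 * m) (n := 2 * m + 2 + 2 * m)
      (h4.trans (by omega)) (by simp) |>.trans (by simp)
  set d := derivative D with hd
  have hddeg : d.natDegree ≤ 3 := (natDegree_derivative_le D).trans (by omega)
  obtain ⟨R, hR⟩ : ∃ R, R = 2 * X * D * derivative Q - 2 * D * Q + X * d * Q := ⟨_, rfl⟩
  have hder := congrArg derivative hQ
  obtain ⟨k, hk⟩ : ∃ k, m = k + 1 := ⟨m - 1, by omega⟩
  have hpow : D ^ m = D ^ k * D := by rw [hk, pow_succ]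
  rw [← hY] at hQ hder
  have e1 : Y * R = 4 * D - X * d - 2 * D * Q := by
    simp only [derivative_mul, derivative_sub, derivative_one, derivative_pow, derivative_X,
      hYd, ← hd, map_natCast] at hder
    have hk1 : m - 1 = k := by omega
    rw [hk1, hpow] at hder
    rw [hpow] at hQ
    simp at hder
    rw [hR]
    linear_combination (-2 * X * D) * hder + (4 * D - X * d) * hQ + 2 * D * Q * hXY
      + X ^ 3 * D ^ k * D * d * hqm
  have hRdeg : R.natDegree ≤ 2 := by
    apply natDegree_le_of_X_pow_sub_one_mul hn
    rw [← hY, e1]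
    refine natDegree_sub_le_of_le (m := 2 * m + 2 + 2) (n := 2 * m + 2 + 2)
      (natDegree_sub_le_of_le (m := 2 * m + 2 + 2) (n := 2 * m + 2 + 2) ?_ ?_ |>.trans (by simp))
      ?_ |>.trans (by simp)
    · refine (natDegree_mul_le_of_le (m := 0) ?_ hDdeg).trans (by omega)
      exact (natDegree_ofNat 4).le
    · exact (natDegree_mul_le_of_le natDegree_X_le hddeg).trans (by omega)
    · refine (natDegree_mul_le_of_le (natDegree_mul_le_of_le (m := 0) ?_ hDdeg) hQdeg).trans
        (by omega)
      exact (natDegree_ofNat 2).le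
  obtain ⟨W, hW⟩ : ∃ W, W = X ^ 2 * d ^ 2 - 2 * X ^ 2 * D * derivative d + 4 * X * D * d
    - 8 * D ^ 2 := ⟨_, rfl⟩
  have e2 : Y * (2 * D * X * derivative R - X * d * R) = W - 4 * D * R := by
    have he := congrArg derivative e1
    simp only [derivative_mul, derivative_sub, derivative_X, hYd, ← hd, derivative_ofNat] at he
    rw [hW]
    linear_combination 2 * D * X * he - 2 * D * R * hXY + (2 * D) * hR - (2 * D + X * d) * e1
  have hWex : W = C (β ^ 2 - 4 * α * γ) * X ^ 6 + C (-12 * α * β) * X ^ 5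
      + C (-24 * α ^ 2 - 6 * β ^ 2) * X ^ 4 + C (-16 * α * β - 4 * β * γ) * X ^ 3
      + C (-12 * α * γ - 3 * β ^ 2) * X ^ 2 + C (-12 * α * β) * X + C (-8 * α ^ 2) := by
    rw [hW, hd, hD]
    simp only [derivative_add, derivative_mul, derivative_C, derivative_X_pow, derivative_X,
      map_sub, map_mul, map_pow, map_neg, map_ofNat, map_natCast, derivative_natCast]
    simp
    ring
  have e3 : W - 4 * D * R = 0 := by
    apply eq_zero_of_X_pow_sub_one_dvd hn
    · exact ⟨_, e2.symm⟩
    · have hWdeg : W.natDegree ≤ 6 := by rw [hWex]; compute_degree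
      have : (W - 4 * D * R).natDegree ≤ 6 := by
        refine natDegree_sub_le_of_le hWdeg
          (natDegree_mul_le_of_le (natDegree_mul_le_of_le (m := 0) ?_ hDdeg) hRdeg)
        exact (natDegree_ofNat 4).le
      omega
  have hRex := eq_quadratic_of_degree_le_two (natDegree_le_iff_degree_le.1 hRdeg)
  generalize R.coeff 2 = r₂ at hRex
  generalize R.coeff 1 = r₁ at hRex
  generalize R.coeff 0 = r₀ at hRex
  rw [hWex, hRex, hD] at e3
  obtain ⟨c0, c1, -, -, c4, c5, c6⟩ := coeff_eq_zero_of_sextic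
    (c₆ := β ^ 2 - 4 * α * γ - 4 * α * r₂)
    (c₅ := -12 * α * β - 4 * (β * r₂ + α * r₁))
    (c₄ := -24 * α ^ 2 - 6 * β ^ 2 - 4 * (γ * r₂ + β * r₁ + α * r₀))
    (c₃ := -16 * α * β - 4 * β * γ - 4 * (β * r₂ + γ * r₁ + β * r₀))
    (c₂ := -12 * α * γ - 3 * β ^ 2 - 4 * (α * r₂ + β * r₁ + γ * r₀))
    (c₁ := -12 * α * β - 4 * (α * r₁ + β * r₀)) (c₀ := -8 * α ^ 2 - 4 * α * r₀) (by
      rw [← e3]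
      simp only [map_sub, map_mul, map_pow, map_neg, map_ofNat, map_add]
      ring)
  by_cases hα : α = 0
  · subst hα
    linear_combination c6
  have h4 : (4 : K) ≠ 0 := by
    have : (4 : K) = 2 * 2 := by norm_num
    rw [this]
    exact mul_ne_zero h2 h2
  have h4α : 4 * α ≠ 0 := mul_ne_zero h4 hα
  have hr0 : r₀ = -2 * α := by
    apply mul_left_cancel₀ h4α
    linear_combination -c0
  have hr1 : r₁ = -β := by
    apply mul_left_cancel₀ h4α
    rw [hr0] at c1
    linear_combination -c1
  rw [hr1] at c5
  have h5 : 4 * (β * (r₂ + 2 * α)) = 0 := by linear_combination -c5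
  rcases mul_eq_zero.1 ((mul_eq_zero.1 h5).resolve_left h4) with hβ | hr2
  · subst hβ
    have hr2 : r₂ = -γ := by
      apply mul_left_cancel₀ h4α
      linear_combination -c6
    rw [hr0, hr2] at c4
    have h6 : 4 * ((γ - 2 * α) * (γ + 2 * α)) = 0 := by linear_combination c4
    rcases mul_eq_zero.1 ((mul_eq_zero.1 h6).resolve_left h4) with h7 | h7
    · rw [h7]; ring
    · exact absurd (by linear_combination h7) h1
  · linear_combination c6 + 4 * α * hr2

open Polynomial in
theorem coeff_eq_zero_of_quintic {n : ℕ} {ζ c₀ c₁ c₂ c₃ c₄ c₅ : K} (hζ : IsPrimitiveRoot ζ n)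
    (hn : 0 < n)
    (hdeg : (C c₅ * X ^ 5 + C c₄ * X ^ 4 + C c₃ * X ^ 3 + C c₂ * X ^ 2 + C c₁ * X
      + C c₀).natDegree < n)
    (h : ∀ T : K, T ^ n = 1 →
      c₅ * T ^ 5 + c₄ * T ^ 4 + c₃ * T ^ 3 + c₂ * T ^ 2 + c₁ * T + c₀ = 0) :
    c₀ = 0 ∧ c₁ = 0 ∧ c₂ = 0 ∧ c₃ = 0 ∧ c₄ = 0 ∧ c₅ = 0 := by
  have h0 := eq_zero_of_X_pow_sub_one_dvd hn (X_pow_sub_one_dvd hζ hn (fun T hT => by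
    simpa using h T hT)) hdeg
  obtain ⟨d0, d1, d2, d3, d4, d5, -⟩ := coeff_eq_zero_of_sextic (c₀ := c₀) (c₁ := c₁) (c₂ := c₂)
    (c₃ := c₃) (c₄ := c₄) (c₅ := c₅) (c₆ := (0 : K)) (by
    rw [map_zero, zero_mul, zero_add]; exact h0)
  exact ⟨d0, d1, d2, d3, d4, d5⟩

open Polynomial in
theorem quartic_of_pow_eq {m : ℕ} {ζ α β γ : K} (h2 : (2 : K) ≠ 0)
    (hq : ((2 * m + 1 : ℕ) : K) = 0) (hζ : IsPrimitiveRoot ζ (2 * m + 2))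
    (h : ∀ T : K, T ^ (2 * m + 2) = 1 →
      T ^ 2 * (α * T ^ 4 + β * T ^ 3 + γ * T ^ 2 + β * T + α) ^ m = 1) :
    β ^ 2 = 4 * α * (γ - 2 * α) := by
  by_cases hm : 3 ≤ m
  · exact quartic_of_pow_eq_large h2 hm hq hζ h
  interval_cases m
  · simp at hq
  · obtain ⟨-, hβ, hα, -⟩ := coeff_eq_zero_of_quintic (n := 4) (ζ := ζ)
      (c₅ := 0) (c₄ := 0) (c₃ := β) (c₂ := 2 * α) (c₁ := β)
      (c₀ := γ - 1) hζ (by omega)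
      (by
        rw [map_zero, zero_mul, zero_mul, zero_add, zero_add]
        exact Nat.lt_succ_of_le natDegree_cubic_le) (fun T hT => by
        have h1 := h T hT
        have hT' : T ^ 4 = 1 := hT
        linear_combination h1 - (α * T ^ 2 + β * T + γ) * hT')
    have hα' : α = 0 := by simpa [h2] using hα
    rw [hβ, hα']
    ring
  · obtain ⟨-, -, hc2, hc3, -⟩ := coeff_eq_zero_of_quintic (n := 6) (ζ := ζ)
      (c₅ := 2 * α * β + 2 * β * γ)
      (c₄ := β ^ 2 + 2 * α * γ + α ^ 2) (c₃ := 4 * α * β) (c₂ := β ^ 2 + 2 * α * γ + α ^ 2)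
      (c₁ := 2 * α * β + 2 * β * γ) (c₀ := 2 * α ^ 2 + 2 * β ^ 2 + γ ^ 2 - 1) hζ (by omega)
      (by
        refine Nat.lt_succ_of_le ?_
        compute_degree) (fun T hT => by
        have h1 := h T hT
        have hT' : T ^ 6 = 1 := hT
        linear_combination h1 - (α ^ 2 * T ^ 4 + 2 * α * β * T ^ 3 + (β ^ 2 + 2 * α * γ) * T ^ 2
          + (2 * α * β + 2 * β * γ) * T + 2 * α ^ 2 + 2 * β ^ 2 + γ ^ 2) * hT')
    have h5 : (5 : K) = 0 := by exact_mod_cast hq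
    have hαβ : α = 0 ∨ β = 0 := by
      have : 2 * (2 * (α * β)) = 0 := by linear_combination hc3
      simpa [h2] using this
    rcases hαβ with rfl | rfl
    · linear_combination hc2
    · linear_combination -2 * hc2 + 2 * α ^ 2 * h5

theorem onCircle_iff_pow {σ : K →+* K} {m : ℕ} (hσ : ∀ x, σ x = x ^ (2 * m + 1)) (T : K) :
    OnCircle σ T ↔ T ^ (2 * m + 2) = 1 := by
  have hpow : T ^ (2 * m + 2) = T ^ (2 * m + 1) * T := pow_succ T (2 * m + 1)
  constructor
  · rintro ⟨h0, h⟩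
    rw [hpow, ← hσ, h, inv_mul_cancel₀ h0]
  · intro h
    have h0 : T ≠ 0 := by rintro rfl; simp at h
    refine ⟨h0, ?_⟩
    rw [hσ]
    exact eq_inv_of_mul_eq_one_left (hpow ▸ h)

theorem sq_mul_disc_pow {σ : K →+* K} {m : ℕ} {a b T : K} (hσ : ∀ x, σ x = x ^ (2 * m + 1))
    (h : SquareDisc σ a b) (hT : T ^ (2 * m + 2) = 1) (hd : disc a b T ≠ 0) :
    T ^ 2 * disc a b T ^ m = 1 := by
  obtain ⟨s, hs, hs2, -⟩ := h T ((onCircle_iff_pow hσ T).2 hT)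
  have hs0 : s ≠ 0 := by rintro rfl; simp [hs2] at hd
  have hs1 : s ^ (2 * m) = 1 := by
    apply mul_right_cancel₀ hs0
    rw [← pow_succ, ← hσ, hs, one_mul]
  rw [hs2, ← pow_mul, mul_pow, hs1]
  linear_combination hT

theorem classification_of_disc_ne_one {σ : K →+* K} {a b T : K} (h2 : (2 : K) ≠ 0)
    (ha : σ a = a) (hb : σ b = b) (h : SquareDisc σ a b) (hT : OnCircle σ T) (hT1 : T ^ 2 ≠ 1)
    (h0 : disc a b T = 0) : Classification σ a b :=
  classification_of_sq_eq h2 ha hb h (sq_eq_of_disc ha hb h hT h0 hT1)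

theorem classification_of_disc_one {σ : K →+* K} {m : ℕ} {a b ζ : K} (h2 : (2 : K) ≠ 0)
    (hq : ((2 * m + 1 : ℕ) : K) = 0) (hσ : ∀ x, σ x = x ^ (2 * m + 1))
    (hζ : IsPrimitiveRoot ζ (2 * m + 2)) (ha : σ a = a) (hb : σ b = b) (h : SquareDisc σ a b)
    (h0 : disc a b 1 = 0) : Classification σ a b := by
  have hm : m ≠ 0 := by rintro rfl; simp at hq
  have hζ2 : ζ ^ 2 ≠ 1 := hζ.pow_ne_one_of_pos_of_lt (by omega) (by omega)
  have hb1 := eq_of_disc_one h h0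
  by_cases hz : ∃ T, OnCircle σ T ∧ T ≠ 1 ∧ disc a b T = 0
  · obtain ⟨T, hT, hT1, hTd⟩ := hz
    by_cases hT2 : T ^ 2 = 1
    · have hTn : T = -1 := (mul_self_eq_one_iff.1 ((sq T) ▸ hT2)).resolve_left hT1
      rw [hTn] at hTd
      have hb2 := eq_of_disc_one (squareDisc_neg h) (by
        rw [← hTd]
        unfold disc
        ring)
      have hb0 : b = 0 := by
        apply mul_left_cancel₀ h2
        linear_combination hb1 - hb2
      have ha3 : a = 3 := by linear_combination hb0 - hb1
      subst hb0 ha3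
      exact classification_of_three h2 ((onCircle_iff_pow hσ ζ).2 hζ.pow_eq_one) hζ2 h
    · exact classification_of_disc_ne_one h2 ha hb h hT hT2 hTd
  push Not at hz
  rw [disc_eq] at h0
  have key := quadratic_of_pow_eq (α := coeffA a b) (κ := coeffB a b + 2 * coeffA a b) h2 hq hζ (by
    intro T hT hT1
    have hTc := (onCircle_iff_pow hσ T).2 hT
    have h1 := sq_mul_disc_pow hσ h hT (hz T hTc hT1)
    have hfac : disc a b T = (T - 1) ^ 2 *
        (coeffA a b * T ^ 2 + (coeffB a b + 2 * coeffA a b) * T + coeffA a b) := by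
      rw [disc_eq]
      linear_combination T ^ 2 * h0
    rw [hfac, mul_pow, ← pow_mul] at h1
    have h3 : T * (T - 1) ^ (2 * m) = -1 := by
      apply mul_right_cancel₀ (sub_ne_zero.2 hT1)
      have h4 := hσ (T - 1)
      rw [map_sub, map_one, hTc.2, pow_succ] at h4
      rw [mul_assoc, ← h4, mul_sub, mul_inv_cancel₀ hTc.1]
      ring
    linear_combination -h1 + T *
      (coeffA a b * T ^ 2 + (coeffB a b + 2 * coeffA a b) * T + coeffA a b) ^ m * h3)
  apply classification_of_coeff h2 ha hb h
  have hβ : coeffB a b = -4 * coeffA a b := by linear_combination key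
  have hγ : coeffC a b = 6 * coeffA a b := by linear_combination h0 - 2 * hβ
  rw [hβ, hγ]
  ring

theorem classification_of_squareDisc {σ : K →+* K} {m : ℕ} {a b ζ : K} (h2 : (2 : K) ≠ 0)
    (hq : ((2 * m + 1 : ℕ) : K) = 0) (hσ : ∀ x, σ x = x ^ (2 * m + 1))
    (hζ : IsPrimitiveRoot ζ (2 * m + 2)) (ha : σ a = a) (hb : σ b = b) (h : SquareDisc σ a b) :
    Classification σ a b := by
  by_cases hz : ∃ T, OnCircle σ T ∧ disc a b T = 0
  · obtain ⟨T, hT, hTd⟩ := hz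
    by_cases hT2 : T ^ 2 = 1
    · rcases mul_self_eq_one_iff.1 ((sq T) ▸ hT2) with rfl | rfl
      · exact classification_of_disc_one h2 hq hσ hζ ha hb h hTd
      · refine classification_neg (classification_of_disc_one h2 hq hσ hζ ha ?_
          (squareDisc_neg h) ?_)
        · rw [map_neg, hb]
        · rw [← hTd]
          unfold disc
          ring
    · exact classification_of_disc_ne_one h2 ha hb h hT hT2 hTd
  push Not at hz
  refine classification_of_coeff h2 ha hb h (quartic_of_pow_eq h2 hq hζ fun T hT => ?_)
  rw [← disc_eq]
  exact sq_mul_disc_pow hσ h hT (hz T ((onCircle_iff_pow hσ T).2 hT))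

end HouTrinomial

namespace HouTrinomial

section FiniteField

variable {K : Type*} [Field K] [Fintype K]

theorem exists_sq_of_pow_eq {q : ℕ} (hq : Odd q) (hK : Fintype.card K = q ^ 2) (h2 : (2 : K) ≠ 0)
    {x : K} (hx : x ^ q = x) : ∃ w, w ^ 2 = x := by
  obtain ⟨m, rfl⟩ := hq
  by_cases hx0 : x = 0
  · exact ⟨0, by simp [hx0]⟩
  have hchar : ringChar K ≠ 2 := by
    intro h
    apply h2
    have := ringChar.Nat.cast_ringChar (R := K)
    rw [h] at this
    exact_mod_cast this
  obtain ⟨w, hw⟩ := (FiniteField.isSquare_iff hchar hx0).2 (by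
    have h1 : x ^ (2 * m) = 1 := by
      apply mul_right_cancel₀ hx0
      rw [← pow_succ, hx, one_mul]
    have h3 : Fintype.card K / 2 = 2 * m * (m + 1) := by
      rw [hK, show (2 * m + 1) ^ 2 = 2 * (2 * m * (m + 1)) + 1 by ring]
      omega
    rw [h3, pow_mul, h1, one_pow])
  exact ⟨w, by rw [hw, sq]⟩

theorem exists_primitive_circle {q : ℕ} (hq1 : 1 < q) (hK : Fintype.card K = q ^ 2) :
    ∃ ζ : K, IsPrimitiveRoot ζ (q + 1) ∧
      ∀ T : K, T ^ (q + 1) = 1 → ∃ y, y ≠ 0 ∧ y ^ q = T * y := by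
  obtain ⟨g, hg⟩ := IsCyclic.exists_generator (α := Kˣ)
  have hord : orderOf g = (q - 1) * (q + 1) := by
    rw [orderOf_eq_card_of_forall_mem_zpowers hg, Nat.card_units, Nat.card_eq_fintype_card, hK]
    obtain ⟨k, rfl⟩ := Nat.exists_eq_add_of_le hq1.le
    simp only [Nat.add_sub_cancel_left]
    rw [Nat.sub_eq_iff_eq_add (by nlinarith)]
    ring
  have hprim : IsPrimitiveRoot (g : K) ((q - 1) * (q + 1)) :=
    IsPrimitiveRoot.coe_units_iff.2 (hord ▸ IsPrimitiveRoot.orderOf g)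
  have hpos : 0 < (q - 1) * (q + 1) := Nat.mul_pos (by omega) (by omega)
  have hζ := hprim.pow hpos rfl
  refine ⟨_, hζ, fun T hT => ?_⟩
  have : NeZero (q + 1) := ⟨by omega⟩
  obtain ⟨k, -, hk⟩ := hζ.eq_pow_of_pow_eq_one hT
  refine ⟨(g : K) ^ k, pow_ne_zero _ g.ne_zero, ?_⟩
  have hq' : q = q - 1 + 1 := by omega
  rw [← hk]
  conv_lhs => rw [hq', pow_succ]
  rw [← pow_mul, ← pow_mul, mul_comm]
  ring

end FiniteField

open Polynomial in
theorem exists_algebraMap_eq_of_pow_eq {F K : Type*} [Field F] [Field K] [Algebra F K] [Fintype F]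
    {x : K} (hx : x ^ Fintype.card F = x) : ∃ v : F, algebraMap F K v = x := by
  have hprod := prod_multiset_X_sub_C_of_monic_of_roots_card_eq
    (p := (X ^ Fintype.card F - X : F[X]))
    (monic_X_pow_sub (by rw [degree_X]; exact_mod_cast Fintype.one_lt_card)) (by
      rw [FiniteField.roots_X_pow_card_sub_X,
        FiniteField.X_pow_card_sub_X_natDegree_eq F Fintype.one_lt_card]
      rfl)
  rw [FiniteField.roots_X_pow_card_sub_X] at hprod
  have h : aeval x (X ^ Fintype.card F - X : F[X]) = 0 := by simp [hx]
  rw [← hprod, map_multiset_prod, Multiset.prod_eq_zero_iff] at h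
  simp only [Multiset.map_map, Multiset.mem_map] at h
  obtain ⟨v, -, hv⟩ := h
  exact ⟨v, (sub_eq_zero.1 (by simpa using hv)).symm⟩

/-- The action of the `q`-power map on a square root of `-3`. -/
theorem sqrt_neg_three_pow {K : Type*} [Field K] {q : ℕ} (h2 : (2 : K) ≠ 0)
    {σ : K →+* K} (hσ : ∀ x, σ x = x ^ q) {w : K} (hw : w ^ 2 = -3) :
    (q % 3 = 1 → σ w = w) ∧ (q % 3 = 2 → σ w = -w) := by
  obtain ⟨z, hz⟩ : ∃ z, z = (w - 1) / 2 := ⟨_, rfl⟩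
  have hwz : w = 2 * z + 1 := by
    rw [hz]
    field_simp
    ring
  have h4 : (2 * 2 : K) ≠ 0 := mul_ne_zero h2 h2
  have hz1 : z ^ 2 + z + 1 = 0 := by
    apply mul_left_cancel₀ h4
    rw [hwz] at hw
    linear_combination hw
  have hz3 : z ^ 3 = 1 := by linear_combination (z - 1) * hz1
  have hzq : σ z = z ^ (q % 3) := by
    rw [hσ]
    conv_lhs => rw [← Nat.div_add_mod q 3, pow_add, pow_mul, hz3, one_pow, one_mul]
  have hsw : σ w = 2 * σ z + 1 := by rw [hwz, map_add, map_mul, map_ofNat, map_one]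
  refine ⟨fun h => ?_, fun h => ?_⟩
  · rw [hsw, hzq, h, hwz, pow_one]
  · rw [hsw, hzq, h, hwz]
    linear_combination 2 * hz1

theorem three_eq_zero_iff {F K : Type*} [Field F] [Field K] [Algebra F K] [Fintype F] :
    (3 : K) = 0 ↔ Fintype.card F % 3 = 0 := by
  obtain ⟨p, _, n, hp, hcard⟩ := FiniteField.card' F
  have : CharP K p := charP_of_injective_algebraMap' F p
  have h3 : (3 : K) = 0 ↔ p ∣ 3 := by
    rw [← CharP.cast_eq_zero_iff K p]
    norm_num
  rw [h3, hcard, ← Nat.dvd_iff_mod_eq_zero, Nat.prime_dvd_prime_iff_eq hp Nat.prime_three]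
  constructor
  · rintro rfl
    exact dvd_pow_self _ n.ne_zero
  · intro h
    exact ((Nat.prime_dvd_prime_iff_eq Nat.prime_three hp).1
      (Nat.prime_three.dvd_of_dvd_pow h)).symm

theorem classification_algebraMap_iff {F K : Type*} [Field F] [Field K] [Algebra F K]
    [Fintype F] [Fintype K] {q : ℕ} {σ : K →+* K} (hq : Odd q) (hF : Fintype.card F = q)
    (hK : Fintype.card K = q ^ 2) (h2 : (2 : K) ≠ 0) (hσ : ∀ x, σ x = x ^ q)
    (hfix : ∀ v : F, σ (algebraMap F K v) = algebraMap F K v) (a b : F) :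
    Classification σ (algebraMap F K a) (algebraMap F K b) ↔
      (((∃ v : F, v ≠ 0 ∧ a * (a - 1) = v ^ 2) ∧ b ^ 2 = a ^ 2 + 3 * a) ∨
       (a = 1 ∧ ∃ v : F, v ≠ 0 ∧ b ^ 2 - 4 = v ^ 2) ∨
       (a = 3 ∧ b = 0 ∧ q % 6 = 5) ∨
       (a = 0 ∧ b = 0 ∧ (q % 6 = 1 ∨ q % 6 = 3))) := by
  have hinj := (algebraMap F K).injective
  have hodd := Nat.odd_iff.1 hq
  have hsquare (u : F) : (∃ v : K, σ v = v ∧ v ≠ 0 ∧ algebraMap F K u = v ^ 2) ↔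
      ∃ v : F, v ≠ 0 ∧ u = v ^ 2 := by
    constructor
    · rintro ⟨v, hv, hv0, hu⟩
      obtain ⟨v, rfl⟩ := exists_algebraMap_eq_of_pow_eq (F := F) (x := v) (by rw [hF, ← hσ, hv])
      exact ⟨v, by simpa using hv0, hinj (by rw [hu, map_pow])⟩
    · rintro ⟨v, hv0, rfl⟩
      exact ⟨algebraMap F K v, hfix v, by simpa using hv0, map_pow _ _ _⟩
  obtain ⟨w, hw⟩ := exists_sq_of_pow_eq hq hK h2 (x := (-3 : K)) (by
    rw [← hσ, map_neg, map_ofNat])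
  have h3 : (3 : K) = 0 ↔ q % 3 = 0 := hF ▸ three_eq_zero_iff
  have hw0 {w : K} (hw : w ^ 2 = -3) : w = 0 ↔ q % 3 = 0 := by
    rw [← h3, ← neg_eq_zero, ← pow_eq_zero_iff two_ne_zero, neg_sq, hw, neg_eq_zero]
  have hne {w : K} (hw0 : w ≠ 0) (h : w = -w) : False := by
    have : 2 * w = 0 := by linear_combination h
    simp [h2, hw0] at this
  have hminus : (∃ w, σ w = -w ∧ w ≠ 0 ∧ w ^ 2 = (-3 : K)) ↔ q % 6 = 5 := by
    constructor
    · rintro ⟨w, hσw, hwne, hw⟩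
      have h0 := mt (hw0 hw).2 hwne
      have h1 : q % 3 ≠ 1 := fun h1 =>
        hne hwne (((sqrt_neg_three_pow h2 hσ hw).1 h1).symm.trans hσw)
      omega
    · intro h
      exact ⟨w, (sqrt_neg_three_pow h2 hσ hw).2 (by omega), mt (hw0 hw).1 (by omega), hw⟩
  have hplus : (∃ w, σ w = w ∧ w ^ 2 = (-3 : K)) ↔ q % 6 = 1 ∨ q % 6 = 3 := by
    constructor
    · rintro ⟨w, hσw, hw⟩
      have h1 : q % 3 ≠ 2 := fun h1 => by
        have hwne : w ≠ 0 := mt (hw0 hw).1 (by omega)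
        exact hne hwne (hσw.symm.trans ((sqrt_neg_three_pow h2 hσ hw).2 h1))
      omega
    · intro h
      refine ⟨w, ?_, hw⟩
      rcases h with h | h
      · exact (sqrt_neg_three_pow h2 hσ hw).1 (by omega)
      · rw [(hw0 hw).2 (by omega), map_zero]
  unfold Classification
  rw [hminus, hplus, ← hsquare, ← hsquare, ← hinj.eq_iff (a := b ^ 2), ← hinj.eq_iff (a := a),
    ← hinj.eq_iff (a := a) (b := 3), ← hinj.eq_iff (a := b), ← hinj.eq_iff (a := a) (b := 0)]
  simp only [map_mul, map_sub, map_add, map_pow, map_one, map_ofNat, map_zero]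

theorem pow_two_mul_sub_one {K : Type*} [Field K] {q : ℕ} (hq : 1 < q) (x : K) :
    x ^ (2 * q - 1) = (x ^ q) ^ 2 / x := by
  by_cases hx : x = 0
  · rw [hx, div_zero, zero_pow (by omega)]
  · rw [eq_div_iff hx, ← pow_succ, ← pow_mul]
    congr 1
    omega

end HouTrinomial

/-- **Theorem A** (Hou). Let `q` be an odd prime power, `F = F_q`, `K = F_{q²}`, and
`a, b ∈ F_q`. The polynomial `f(x) = a·x + b·x^q + x^(2q−1)` is a permutation
polynomial of `F_{q²}` iff one of conditions (i)–(iv) holds. -/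
theorem trinomial_pp_odd_char
    (q : ℕ) (hq : Odd q)
    (F K : Type*) [Field F] [Field K] [Algebra F K]
    [Fintype F] [Fintype K]
    (hF : Fintype.card F = q) (hK : Fintype.card K = q ^ 2)
    (a b : F) :
    Function.Bijective (fun x : K =>
        algebraMap F K a * x + algebraMap F K b * x ^ q + x ^ (2 * q - 1)) ↔
      (((∃ v : F, v ≠ 0 ∧ a * (a - 1) = v ^ 2) ∧ b ^ 2 = a ^ 2 + 3 * a) ∨
       (a = 1 ∧ ∃ v : F, v ≠ 0 ∧ b ^ 2 - 4 = v ^ 2) ∨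
       (a = 3 ∧ b = 0 ∧ q % 6 = 5) ∨
       (a = 0 ∧ b = 0 ∧ (q % 6 = 1 ∨ q % 6 = 3))) := by
  have hq0 : ((q : ℕ) : K) = 0 := by
    rw [← hF, ← map_natCast (algebraMap F K), FiniteField.cast_card_eq_zero, map_zero]
  have hq1 : 1 < q := hF ▸ Fintype.one_lt_card
  let σ : K →+* K := FiniteField.frobeniusAlgHom F K
  have hσ (x : K) : σ x = x ^ q := by
    rw [← hF]
    rfl
  have hfix (v : F) : σ (algebraMap F K v) = algebraMap F K v :=
    (FiniteField.frobeniusAlgHom F K).commutes v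
  have hσσ (x : K) : σ (σ x) = x := by
    rw [hσ, hσ, ← pow_mul, ← sq, ← hK, FiniteField.pow_card]
  obtain ⟨m, hm⟩ := id hq
  have h2 : (2 : K) ≠ 0 := by
    intro h
    rw [hm] at hq0
    push_cast at hq0
    simp [h] at hq0
  obtain ⟨ζ, hζ, h90⟩ := HouTrinomial.exists_primitive_circle (K := K) hq1 hK
  have hcircle (T : K) : HouTrinomial.OnCircle σ T ↔ T ^ (q + 1) = 1 := by
    have := HouTrinomial.onCircle_iff_pow (σ := σ) (m := m) (fun x => by rw [hσ, hm]) T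
    rwa [show 2 * m + 2 = q + 1 by omega] at this
  have hfun : (fun x : K => algebraMap F K a * x + algebraMap F K b * x ^ q + x ^ (2 * q - 1)) =
      HouTrinomial.trinomial σ (algebraMap F K a) (algebraMap F K b) := by
    funext x
    rw [HouTrinomial.pow_two_mul_sub_one hq1, HouTrinomial.trinomial, hσ]
  rw [hfun, HouTrinomial.trinomial_bijective_iff h2 (hfix a) (hfix b) hσσ
    (fun T hT => by simpa only [hσ] using h90 T ((hcircle T).1 hT))
    (fun x hx => HouTrinomial.exists_sq_of_pow_eq hq hK h2 (by rw [← hσ, hx]))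
    ((hcircle ζ).2 hζ.pow_eq_one) (hζ.pow_ne_one_of_pos_of_lt (by omega) (by omega)),
    ← HouTrinomial.classification_algebraMap_iff hq hF hK h2 hσ hfix]
  subst hm
  exact ⟨HouTrinomial.classification_of_squareDisc h2 hq0 hσ hζ (hfix a) (hfix b),
    HouTrinomial.squareDisc_of_classification h2 (hfix a) (hfix b)⟩
end

section
/- Let q be an even prime power (q = 2^m) and let a, b ∈ F_q. The polynomial f(x) = a·x + b·x^q + x^(2q−1) ∈ F_q[x] is a permutation polynomial of F_{q²} if and only if one of the following holds: (i) q > 2, a ≠ 1, Tr_{F_q/F_2}(1/(a+1)) = 0, and b² = a² + a; (ii) q > 2, a = 1, b ≠ 0, and Tr_{F_q/F_2}(1/b) = 0. (In case (i) the condition implicitly includes a ≠ 1 so that 1/(a+1) is defined; note a = b = 0 with Tr(1) = 0, i.e. q = 2^(2k), is included in (i).) -/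
section Trace

variable {L : Type*} [Field L] [Fintype L] [Algebra (ZMod 2) L]

theorem zmod_two_trace_sq (x : L) :
    Algebra.trace (ZMod 2) L (x ^ 2) = Algebra.trace (ZMod 2) L x := by
  have h := Algebra.trace_eq_of_algEquiv
    (FiniteField.frobeniusAlgEquivOfAlgebraic (ZMod 2) L) x
  simpa [ZMod.card] using h

theorem zmod_two_trace_eq_zero_iff (c : L) :
    Algebra.trace (ZMod 2) L c = 0 ↔ ∃ z : L, z ^ 2 + z = c := by
  have : CharP L 2 := charP_of_injective_algebraMap' (ZMod 2) 2
  let φ : L →ₗ[ZMod 2] L :=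
    (FiniteField.frobeniusAlgHom (ZMod 2) L).toLinearMap + LinearMap.id
  have hφ (z : L) : φ z = z ^ 2 + z := by simp [φ, ZMod.card]
  have hle : LinearMap.range φ ≤ LinearMap.ker (Algebra.trace (ZMod 2) L) := by
    rintro _ ⟨z, rfl⟩
    rw [LinearMap.mem_ker, hφ, map_add, zmod_two_trace_sq, CharTwo.add_self_eq_zero]
  have hker : LinearMap.ker φ ≤ Submodule.span (ZMod 2) {1} := by
    intro z hz
    rw [LinearMap.mem_ker, hφ] at hz
    have hz' : z * (z + 1) = 0 := by linear_combination hz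
    rcases mul_eq_zero.1 hz' with h | h
    · simp [h]
    · rw [CharTwo.add_eq_zero.1 h]
      exact Submodule.mem_span_singleton_self 1
  have h₁ : Module.finrank (ZMod 2) (LinearMap.ker φ) ≤ 1 :=
    (Submodule.finrank_mono hker).trans (finrank_span_le_card _ |>.trans (by simp))
  have h₂ := φ.finrank_range_add_finrank_ker
  have h₃ := (Algebra.trace (ZMod 2) L).finrank_range_add_finrank_ker
  rw [LinearMap.range_eq_top.2 (Algebra.trace_surjective (ZMod 2) L), finrank_top,
    Module.finrank_self] at h₃
  have heq := Submodule.eq_of_le_of_finrank_le hle (by omega)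
  rw [← LinearMap.mem_ker, ← heq]
  simp [hφ]

/-- The trace of a sum `x + y ^ 2` only depends on `x + y`. -/
theorem zmod_two_trace_add_sq (x y : L) :
    Algebra.trace (ZMod 2) L (x + y ^ 2) = Algebra.trace (ZMod 2) L (x + y) := by
  rw [map_add, map_add, zmod_two_trace_sq]

end Trace

section Identities

variable {K : Type*} [Field K]

theorem pow_pow_of_card_eq_sq [Fintype K] {q : ℕ} (hK : Fintype.card K = q ^ 2) (x : K) :
    (x ^ q) ^ q = x := by
  rw [← pow_mul, ← sq, ← hK, FiniteField.pow_card]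

theorem trinomial_apply {a b x y : K} {q : ℕ} (hq : q ≠ 0) (hx : x ≠ 0) (hxy : x ^ q = y * x) :
    a * x + b * x ^ q + x ^ (2 * q - 1) = x * (y ^ 2 + b * y + a) := by
  have h : x ^ (2 * q - 1) * x = (x ^ q) ^ 2 := by
    rw [← pow_succ, ← pow_mul]; congr 1; omega
  rw [hxy] at h ⊢
  have h' : x ^ (2 * q - 1) = y ^ 2 * x :=
    mul_right_cancel₀ hx (by linear_combination h)
  linear_combination h'

/-- The difference quotient of `y ↦ y * h(y) ^ q / h(y)` on the norm one group, where
`h(y) = y ^ 2 + B * y + A`. -/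
theorem mul_norm_one_quotient_add [CharP K 2] {A B x y u v : K}
    (hu : u * x ^ 2 = A * x ^ 2 + B * x + 1) (hv : v * y ^ 2 = A * y ^ 2 + B * y + 1) :
    x * y * (x * u * (y ^ 2 + B * y + A) + y * v * (x ^ 2 + B * x + A)) =
      (x + y) * ((A * x ^ 2 + B * x + 1) * y ^ 2 +
        (B * x ^ 2 + (A ^ 2 + B ^ 2 + 1) * x + B) * y + (x ^ 2 + B * x + A)) := by
  have h2 : (2 : K) = 0 := CharTwo.two_eq_zero
  grind

/-- For `x` in the norm one group with `x + x⁻¹ = σ`, the two points `x` and `h(x)` are related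
by `h(x) ^ q = h(x)` exactly when `A * σ ^ 2 = B * σ`, where `h(x) = x ^ 2 + B * x + A`. -/
theorem mul_sq_eq_iff_of_add_inv [CharP K 2] {A B x σ : K} (hx : x ≠ 0)
    (hσ : x ^ 2 + σ * x + 1 = 0) :
    (A * x ^ 2 + B * x + 1) * x ^ 2 = x ^ 2 + B * x + A ↔ A * σ ^ 2 = B * σ := by
  have h2 : (2 : K) = 0 := CharTwo.two_eq_zero
  have h : x ^ 2 * (A * σ ^ 2 - B * σ) =
      (A * x ^ 2 + B * x + 1) * x ^ 2 - (x ^ 2 + B * x + A) := by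
    linear_combination (A * (σ * x - x ^ 2 - 1) - B * x) * hσ + (A * x ^ 2 + A + B * x) * h2
  rw [← sub_eq_zero, ← h, mul_eq_zero, or_iff_right (pow_ne_zero 2 hx), sub_eq_zero]

end Identities

section Quadratic

variable {F K : Type*} [Field F] [Field K] [Algebra F K] [Fintype F]

theorem exists_algebraMap_eq_of_pow_card_eq {x : K} (hx : x ^ Fintype.card F = x) :
    ∃ a : F, algebraMap F K a = x := by
  classical
  let p : Polynomial K := Polynomial.X ^ Fintype.card F - Polynomial.X
  have hp : p ≠ 0 := FiniteField.X_pow_card_sub_X_ne_zero K Fintype.one_lt_card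
  have hsub : Finset.univ.image (algebraMap F K) ⊆ p.roots.toFinset := by
    intro y hy
    obtain ⟨a, -, rfl⟩ := Finset.mem_image.1 hy
    simp [p, hp, ← map_pow, FiniteField.pow_card]
  have hcard : p.roots.toFinset.card ≤ (Finset.univ.image (algebraMap F K)).card := by
    rw [Finset.card_image_of_injective _ (algebraMap F K).injective, Finset.card_univ,
      ← FiniteField.X_pow_card_sub_X_natDegree_eq K (p := Fintype.card F) Fintype.one_lt_card]
    exact (Multiset.toFinset_card_le _).trans (p.card_roots')
  have hx' : x ∈ p.roots.toFinset := by simp [p, hp, hx]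
  rw [← Finset.eq_of_subset_of_card_le hsub hcard] at hx'
  simpa using hx'

theorem add_pow_card_base (x y : K) :
    (x + y) ^ Fintype.card F = x ^ Fintype.card F + y ^ Fintype.card F :=
  map_add (FiniteField.frobeniusAlgHom F K) x y

theorem algebraMap_pow_card (a : F) :
    algebraMap F K a ^ Fintype.card F = algebraMap F K a := by
  rw [← map_pow, FiniteField.pow_card]

variable [Fintype K] [CharP F 2]

theorem exists_pow_card_eq_mul {y : K} (hy : y ^ (Fintype.card F + 1) = 1) :
    ∃ x : K, x ≠ 0 ∧ x ^ Fintype.card F = y * x := by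
  have : CharP K 2 := charP_of_injective_algebraMap' F 2
  obtain ⟨w, hw⟩ := (PerfectRing.bijective_frobenius (R := K) (p := 2)).2 y
  change w ^ 2 = y at hw
  have hw0 : w ≠ 0 := by rintro rfl; simp [← hw] at hy
  have hw1 : w ^ (Fintype.card F + 1) = 1 := by
    rw [← hw, ← pow_mul, mul_comm, pow_mul] at hy
    exact CharTwo.sq_injective (by simpa using hy)
  refine ⟨w⁻¹, inv_ne_zero hw0, ?_⟩
  rw [pow_succ] at hw1
  rw [inv_pow, ← hw]
  field_simp
  linear_combination -hw1

theorem exists_norm_one_root_of_norm_one (hK : Fintype.card K = Fintype.card F ^ 2) {x : K}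
    (hx : x ^ (Fintype.card F + 1) = 1) : ∃ σ : F, x ^ 2 + algebraMap F K σ * x + 1 = 0 := by
  have : CharP K 2 := charP_of_injective_algebraMap' F 2
  have h2 : (2 : K) = 0 := CharTwo.two_eq_zero
  obtain ⟨σ, hσ⟩ : ∃ σ : F, algebraMap F K σ = x + x ^ Fintype.card F := by
    refine exists_algebraMap_eq_of_pow_card_eq ?_
    rw [add_pow_card_base, pow_pow_of_card_eq_sq hK, add_comm]
  refine ⟨σ, ?_⟩
  rw [pow_succ] at hx
  rw [hσ]
  linear_combination hx + (x ^ 2 + 1) * h2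

theorem trinomial_bijective_iff_norm_one (hK : Fintype.card K = Fintype.card F ^ 2) (a b : F) :
    Function.Bijective (fun x : K => algebraMap F K a * x + algebraMap F K b * x ^ Fintype.card F +
        x ^ (2 * Fintype.card F - 1)) ↔
      (∀ y : K, y ^ (Fintype.card F + 1) = 1 →
        y ^ 2 + algebraMap F K b * y + algebraMap F K a ≠ 0) ∧
      ∀ x y : K, x ^ (Fintype.card F + 1) = 1 → y ^ (Fintype.card F + 1) = 1 →
        (algebraMap F K a * x ^ 2 + algebraMap F K b * x + 1) * y ^ 2 +
          (algebraMap F K b * x ^ 2 + algebraMap F K (a ^ 2 + b ^ 2 + 1) * x +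
            algebraMap F K b) * y + (x ^ 2 + algebraMap F K b * x + algebraMap F K a) = 0 →
        x = y := by
  have : CharP K 2 := charP_of_injective_algebraMap' F 2
  have h2 : (2 : K) = 0 := CharTwo.two_eq_zero
  have hq : Fintype.card F ≠ 0 := Fintype.card_ne_zero
  have hf0 : ∀ x : K, x = 0 → algebraMap F K a * x + algebraMap F K b * x ^ Fintype.card F +
        x ^ (2 * Fintype.card F - 1) = 0 := by
    rintro x rfl
    have : 2 * Fintype.card F - 1 ≠ 0 := by omega
    simp [hq, this]
  have haq := algebraMap_pow_card (K := K) a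
  have hbq := algebraMap_pow_card (K := K) b
  have hconj : ∀ y : K, y ^ (Fintype.card F + 1) = 1 →
      (y ^ 2 + algebraMap F K b * y + algebraMap F K a) ^ Fintype.card F * y ^ 2 =
        algebraMap F K a * y ^ 2 + algebraMap F K b * y + 1 := by
    intro y hy
    rw [pow_succ] at hy
    rw [add_pow_card_base, add_pow_card_base, mul_pow, haq, hbq, ← pow_mul, mul_comm 2, pow_mul]
    linear_combination (y ^ Fintype.card F * y + 1 + algebraMap F K b * y) * hy
  rw [← Finite.injective_iff_bijective]
  simp only [map_add, map_pow, map_one]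
  generalize algebraMap F K a = A at *
  generalize algebraMap F K b = B at *
  constructor
  · intro hf
    have hne : ∀ y : K, y ^ (Fintype.card F + 1) = 1 → y ^ 2 + B * y + A ≠ 0 := by
      intro y hy h0
      obtain ⟨x, hx, hxy⟩ := exists_pow_card_eq_mul hy
      exact hx (hf (by
        beta_reduce
        rw [trinomial_apply hq hx hxy, h0, hf0 0 rfl, mul_zero]))
    refine ⟨hne, fun x y hx hy hQ => ?_⟩
    have hhx := hne x hx
    have hhy := hne y hy
    have hcx := hconj x hx
    have hcy := hconj y hy
    have hx0 : x ≠ 0 := by rintro rfl; simp at hx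
    have hy0 : y ≠ 0 := by rintro rfl; simp at hy
    obtain ⟨X, hX, hXx⟩ := exists_pow_card_eq_mul hx
    obtain ⟨Y, hY, hYy⟩ := exists_pow_card_eq_mul hy
    set r := X * (x ^ 2 + B * x + A) / (Y * (y ^ 2 + B * y + A)) with hr
    have hr0 : r ≠ 0 := div_ne_zero (mul_ne_zero hX hhx) (mul_ne_zero hY hhy)
    have hrq : r ^ Fintype.card F = r := by
      rw [hr, div_pow, mul_pow, mul_pow, hXx, hYy, div_eq_div_iff
        (mul_ne_zero (mul_ne_zero hy0 hY) (pow_ne_zero _ hhy)) (mul_ne_zero hY hhy)]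
      have h := mul_norm_one_quotient_add hcx hcy
      rw [hQ, mul_zero] at h
      have h' := CharTwo.add_eq_zero.1
        ((mul_eq_zero.1 h).resolve_left (mul_ne_zero hx0 hy0))
      linear_combination X * Y * h'
    have hXY : X = r * Y := by
      have hYr : (r * Y) ^ Fintype.card F = y * (r * Y) := by
        rw [mul_pow, hrq, hYy]; ring
      refine hf ?_
      beta_reduce
      rw [trinomial_apply hq hX hXx, trinomial_apply hq (mul_ne_zero hr0 hY) hYr]
      have h := div_mul_cancel₀ (X * (x ^ 2 + B * x + A)) (mul_ne_zero hY hhy)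
      linear_combination -h
    have : x * X = y * X := by
      rw [← hXx, hXY, mul_pow, hrq, hYy]; ring
    exact mul_right_cancel₀ hX this
  · rintro ⟨hne, hinj⟩
    have hμ : ∀ x : K, x ≠ 0 → ∃ y : K, y ^ (Fintype.card F + 1) = 1 ∧
        x ^ Fintype.card F = y * x := by
      intro x hx
      refine ⟨x ^ Fintype.card F / x, ?_, by field_simp⟩
      rw [pow_succ, div_pow, pow_pow_of_card_eq_sq hK]
      field_simp
    have hzero : ∀ x : K, A * x + B * x ^ Fintype.card F + x ^ (2 * Fintype.card F - 1) = 0 →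
        x = 0 := by
      intro x hfx
      by_contra hx
      obtain ⟨y, hy, hxy⟩ := hμ x hx
      rw [trinomial_apply hq hx hxy] at hfx
      exact mul_ne_zero hx (hne y hy) hfx
    intro X Y hXY
    dsimp only at hXY
    by_cases hX : X = 0
    · rw [hf0 X hX] at hXY
      rw [hX, hzero Y hXY.symm]
    by_cases hY : Y = 0
    · rw [hf0 Y hY] at hXY
      rw [hY, hzero X hXY]
    obtain ⟨x, hx, hXx⟩ := hμ X hX
    obtain ⟨y, hy, hYy⟩ := hμ Y hY
    rw [trinomial_apply hq hX hXx, trinomial_apply hq hY hYy] at hXY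
    have hXYq := congrArg (· ^ Fintype.card F) hXY
    simp only [mul_pow, hXx, hYy] at hXYq
    have hx0 : x ≠ 0 := by rintro rfl; simp at hx
    have hy0 : y ≠ 0 := by rintro rfl; simp at hy
    have hxy : x = y := by
      by_contra hne'
      have h := mul_norm_one_quotient_add (hconj x hx) (hconj y hy)
      have h' : x * (x ^ 2 + B * x + A) ^ Fintype.card F * (y ^ 2 + B * y + A) =
          y * (y ^ 2 + B * y + A) ^ Fintype.card F * (x ^ 2 + B * x + A) := by
        refine mul_left_cancel₀ (mul_ne_zero hX hY) ?_
        linear_combination Y * (y ^ 2 + B * y + A) * hXYq -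
          y * Y * (y ^ 2 + B * y + A) ^ Fintype.card F * hXY
      rw [h', CharTwo.add_self_eq_zero, mul_zero] at h
      refine hne' (hinj x y hx hy ((mul_eq_zero.1 h.symm).resolve_left ?_))
      exact fun h₀ => hne' (CharTwo.add_eq_zero.1 h₀)
    subst hxy
    exact mul_right_cancel₀ (hne x hx) hXY

variable [Algebra (ZMod 2) F]

theorem exists_sq_add_self_eq_algebraMap (hK : Fintype.card K = Fintype.card F ^ 2) (c : F) :
    ∃ z : K, z ^ 2 + z = algebraMap F K c := by
  have : CharP K 2 := charP_of_injective_algebraMap' F 2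
  let : Algebra (ZMod 2) K := ZMod.algebra K 2
  have : IsScalarTower (ZMod 2) F K := .of_algebraMap_eq' (Subsingleton.elim _ _)
  have hrank : Module.finrank F K = 2 := by
    have h := Module.card_eq_pow_finrank (K := F) (V := K)
    exact (Nat.pow_right_injective Fintype.one_lt_card (hK.symm.trans h)).symm
  rw [← zmod_two_trace_eq_zero_iff, ← Algebra.trace_trace (S := F), Algebra.trace_algebraMap,
    hrank, two_nsmul, CharTwo.add_self_eq_zero, map_zero]

theorem exists_norm_one_root_iff (hK : Fintype.card K = Fintype.card F ^ 2) {C : K}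
    (hC : C ≠ 0) {β N : F} (hβ : β ≠ 0) (hN : algebraMap F K N = C ^ (Fintype.card F + 1)) :
    (∃ y : K, y ^ (Fintype.card F + 1) = 1 ∧
        C ^ Fintype.card F * y ^ 2 + algebraMap F K β * y + C = 0) ↔
      Algebra.trace (ZMod 2) F (N / β ^ 2) ≠ 0 := by
  have : CharP K 2 := charP_of_injective_algebraMap' F 2
  have h2 : (2 : K) = 0 := CharTwo.two_eq_zero
  have hβ' : algebraMap F K β ≠ 0 := by simpa using hβ
  have hCC := pow_pow_of_card_eq_sq hK C
  have hCq : C ^ Fintype.card F ≠ 0 := pow_ne_zero _ hC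
  have hβq := algebraMap_pow_card (K := K) β
  rw [Ne, zmod_two_trace_eq_zero_iff]
  constructor
  · rintro ⟨y, hy, hroot⟩ ⟨z, hz⟩
    have hy0 : y ≠ 0 := by rintro rfl; simp at hy
    have hz' := congrArg (algebraMap F K) hz
    rw [map_add, map_pow, map_div₀, map_pow, hN] at hz'
    obtain ⟨w, hw⟩ : ∃ w : F, algebraMap F K w =
        C ^ Fintype.card F * y / algebraMap F K β := by
      have hprod : (C ^ Fintype.card F * y / algebraMap F K β + algebraMap F K z) *
          (C ^ Fintype.card F * y / algebraMap F K β + algebraMap F K (z + 1)) = 0 := by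
        rw [map_add, map_one]
        rw [pow_succ] at hz'
        field_simp at hz' ⊢
        grind
      rcases mul_eq_zero.1 hprod with h | h
      · exact ⟨_, (CharTwo.add_eq_zero.1 h).symm⟩
      · exact ⟨_, (CharTwo.add_eq_zero.1 h).symm⟩
    have hwq := algebraMap_pow_card (K := K) w
    rw [hw, div_pow, mul_pow, hCC, hβq] at hwq
    rw [pow_succ] at hy
    field_simp at hwq
    have : algebraMap F K β * y = 0 := by
      linear_combination hroot + y * hwq - C * hy - C * h2
    simp_all
  · intro h
    obtain ⟨z, hz⟩ := exists_sq_add_self_eq_algebraMap hK (N / β ^ 2)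
    have hzq : z ^ Fintype.card F = z + 1 := by
      have hz₁ : (z ^ 2 + z) ^ Fintype.card F = z ^ 2 + z := by
        rw [hz, algebraMap_pow_card]
      rw [add_pow_card_base, ← pow_mul, mul_comm, pow_mul] at hz₁
      have hprod : (z ^ Fintype.card F + z) * (z ^ Fintype.card F + (z + 1)) = 0 := by
        grind
      rcases mul_eq_zero.1 hprod with h' | h'
      · obtain ⟨w, rfl⟩ := exists_algebraMap_eq_of_pow_card_eq (CharTwo.add_eq_zero.1 h')
        refine absurd ⟨w, (algebraMap F K).injective ?_⟩ h
        simpa using hz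
      · exact CharTwo.add_eq_zero.1 h'
    rw [map_div₀, map_pow, hN, pow_succ] at hz
    refine ⟨algebraMap F K β * z / C ^ Fintype.card F, ?_, ?_⟩
    · rw [pow_succ, div_pow, mul_pow, hCC, hβq, hzq]
      field_simp at hz ⊢
      linear_combination hz
    · field_simp at hz ⊢
      grind

theorem exists_norm_one_add_inv_eq_iff (hK : Fintype.card K = Fintype.card F ^ 2) (σ : F) :
    (∃ x : K, x ^ (Fintype.card F + 1) = 1 ∧ x ^ 2 + algebraMap F K σ * x + 1 = 0) ↔
      (σ ≠ 0 → Algebra.trace (ZMod 2) F (1 / σ) ≠ 0) := by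
  have : CharP K 2 := charP_of_injective_algebraMap' F 2
  by_cases hσ : σ = 0
  · simp only [hσ, ne_eq, not_true_eq_false, false_imp_iff, iff_true]
    exact ⟨1, one_pow _, by simp [CharTwo.add_self_eq_zero]⟩
  · have h := exists_norm_one_root_iff (C := (1 : K)) (N := 1) hK one_ne_zero hσ (by simp)
    simp only [one_pow, one_mul] at h
    rw [h, ← zmod_two_trace_sq (1 / σ), div_pow, one_pow]
    simp [hσ]

theorem trinomial_bijective_iff_trace (hK : Fintype.card K = Fintype.card F ^ 2) (a b : F) :
    Function.Bijective (fun x : K => algebraMap F K a * x + algebraMap F K b * x ^ Fintype.card F +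
        x ^ (2 * Fintype.card F - 1)) ↔
      a ^ 2 + b ^ 2 + 1 ≠ 0 ∧
      ¬ (a = 1 ∧ (b ≠ 0 → Algebra.trace (ZMod 2) F (1 / b) ≠ 0)) ∧
      ∀ σ : F, (σ ≠ 0 → Algebra.trace (ZMod 2) F (1 / σ) ≠ 0) →
        Algebra.trace (ZMod 2) F ((a * σ ^ 2 + b * (a + 1) * σ + (a ^ 2 + b ^ 2 + 1)) /
          (b * σ + (a ^ 2 + b ^ 2 + 1)) ^ 2) = 0 ∧
        (b * σ + (a ^ 2 + b ^ 2 + 1) = 0 → a * σ ^ 2 = b * σ) := by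
  have : CharP K 2 := charP_of_injective_algebraMap' F 2
  have h2 : (2 : K) = 0 := CharTwo.two_eq_zero
  have hinj := (algebraMap F K).injective
  rw [trinomial_bijective_iff_norm_one hK]
  set A := algebraMap F K a with hA
  set B := algebraMap F K b with hB
  have hAq : A ^ Fintype.card F = A := algebraMap_pow_card a
  have hBq : B ^ Fintype.card F = B := algebraMap_pow_card b
  -- the coefficient `C = h(x) / x`, its conjugate and its norm
  have hcoef : ∀ (x : K) (σ : F), x ^ (Fintype.card F + 1) = 1 →
      x ^ 2 + algebraMap F K σ * x + 1 = 0 →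
      x ≠ 0 ∧ ((x ^ 2 + B * x + A) / x) ^ Fintype.card F = (A * x ^ 2 + B * x + 1) / x ∧
      algebraMap F K (a * σ ^ 2 + b * (a + 1) * σ + (a ^ 2 + b ^ 2 + 1)) =
        ((x ^ 2 + B * x + A) / x) ^ (Fintype.card F + 1) ∧
      ∀ y, (A * x ^ 2 + B * x + 1) * y ^ 2 +
          (B * x ^ 2 + algebraMap F K (a ^ 2 + b ^ 2 + 1) * x + B) * y + (x ^ 2 + B * x + A) =
        x * (((x ^ 2 + B * x + A) / x) ^ Fintype.card F * y ^ 2 +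
          algebraMap F K (b * σ + (a ^ 2 + b ^ 2 + 1)) * y + (x ^ 2 + B * x + A) / x) := by
    intro x σ hx hσ
    have hx0 : x ≠ 0 := by rintro rfl; simp at hx
    have hconj : ((x ^ 2 + B * x + A) / x) ^ Fintype.card F = (A * x ^ 2 + B * x + 1) / x := by
      rw [pow_succ] at hx
      rw [div_pow, add_pow_card_base, add_pow_card_base, mul_pow, hAq, hBq, ← pow_mul, mul_comm 2,
        pow_mul, eq_div_of_mul_eq hx0 hx]
      field_simp
      ring
    refine ⟨hx0, hconj, ?_, fun y => ?_⟩
    · rw [pow_succ _ (Fintype.card F), hconj]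
      simp only [map_add, map_mul, map_pow, map_one, ← hA, ← hB]
      generalize algebraMap F K σ = s at hσ ⊢
      field_simp
      linear_combination (A * (s * x - x ^ 2 - 1) + B * (A + 1) * x) * hσ +
        (A * x ^ 2 - B * (A + 1) * (x ^ 2 + 1) * x) * h2
    · rw [hconj]
      simp only [map_add, map_mul, map_pow, map_one, ← hA, ← hB]
      field_simp
      linear_combination -B * y * hσ + B * y * (x ^ 2 + 1) * h2
  constructor
  · rintro ⟨hne, huniq⟩
    refine ⟨fun hc => hne 1 (one_pow _) ?_, ?_, fun σ hσ => ?_⟩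
    · refine CharTwo.sq_injective ?_
      have := congrArg (algebraMap F K) hc
      simp only [map_add, map_pow, map_one, map_zero, ← hA, ← hB] at this
      linear_combination this + (A * B + A + B) * h2
    · rintro ⟨rfl, hb⟩
      obtain ⟨y, hy, h⟩ := (exists_norm_one_add_inv_eq_iff hK b).2 hb
      exact hne y hy (by rw [hA, map_one]; exact h)
    · obtain ⟨x, hx, hxσ⟩ := (exists_norm_one_add_inv_eq_iff (K := K) hK σ).2 hσ
      obtain ⟨hx0, hconj, hN, hQ⟩ := hcoef x σ hx hxσ
      have hC : (x ^ 2 + B * x + A) / x ≠ 0 := div_ne_zero (hne x hx) hx0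
      have hCq := pow_ne_zero (Fintype.card F) hC
      have hroot := fun y hy h => huniq x y hx hy ((hQ y).trans (mul_eq_zero_of_right x h))
      have hCC := pow_pow_of_card_eq_sq hK ((x ^ 2 + B * x + A) / x)
      by_cases hβ : b * σ + (a ^ 2 + b ^ 2 + 1) = 0
      · refine ⟨by simp [hβ], fun _ => ?_⟩
        rw [hβ, map_zero] at hroot
        obtain ⟨y, hy⟩ := (PerfectRing.bijective_frobenius (R := K) (p := 2)).2
          ((x ^ 2 + B * x + A) / x / ((x ^ 2 + B * x + A) / x) ^ Fintype.card F)
        change y ^ 2 = _ at hy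
        have hy1 : y ^ (Fintype.card F + 1) = 1 := by
          refine CharTwo.sq_injective ?_
          beta_reduce
          rw [← pow_mul, mul_comm, pow_mul, hy, pow_succ, div_pow, hCC, one_pow]
          generalize (x ^ 2 + B * x + A) / x = C at *
          field_simp
        have hxy := hroot y hy1 (by
          rw [hy, mul_div_cancel₀ _ hCq, zero_mul, add_zero, CharTwo.add_self_eq_zero])
        rw [← hxy, hconj] at hy
        apply hinj
        simp only [map_mul, map_pow, ← hA, ← hB]
        have hN0 : A * x ^ 2 + B * x + 1 ≠ 0 := by
          intro h; rw [hconj, h] at hCq; simp at hCq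
        refine (mul_sq_eq_iff_of_add_inv hx0 hxσ).1 ?_
        rw [div_div_div_cancel_right₀ hx0, eq_div_iff hN0] at hy
        rw [mul_comm, hy]
      · refine ⟨?_, fun h => absurd h hβ⟩
        by_contra htr
        obtain ⟨y, hy, hy0⟩ := (exists_norm_one_root_iff hK hC hβ hN).2 htr
        have hyn : y ≠ 0 := by rintro rfl; simp at hy
        have hβ' : algebraMap F K (b * σ + (a ^ 2 + b ^ 2 + 1)) ≠ 0 :=
          (map_ne_zero _).2 hβ
        generalize algebraMap F K (b * σ + (a ^ 2 + b ^ 2 + 1)) = β at *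
        generalize (x ^ 2 + B * x + A) / x = C at *
        have hxy := hroot y hy hy0
        have hxy' := hroot (C / (C ^ Fintype.card F * y)) (by
          rw [pow_succ] at hy
          rw [pow_succ, div_pow, mul_pow, hCC]
          field_simp
          linear_combination -hy) (by
          field_simp
          linear_combination C * hy0)
        rw [hxy] at hxy'
        field_simp at hxy'
        have : β * y = 0 := by linear_combination hy0 - hxy' - C * h2
        exact mul_ne_zero hβ' hyn this
  · rintro ⟨hc, hab, h⟩
    have hne : ∀ y : K, y ^ (Fintype.card F + 1) = 1 → y ^ 2 + B * y + A ≠ 0 := by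
      intro y hy h0
      obtain ⟨σ, hσ⟩ := exists_norm_one_root_of_norm_one hK hy
      obtain ⟨hy0, hconj, -, -⟩ := hcoef y σ hy hσ
      rw [h0, zero_div, zero_pow Fintype.card_ne_zero, eq_comm, div_eq_zero_iff] at hconj
      have hsum : (A + 1) * (y + 1) ^ 2 = 0 := by
        linear_combination h0 + hconj.resolve_right hy0 + ((A + 1) * y - B * y) * h2
      rcases mul_eq_zero.1 hsum with ha | hy'
      · have ha' : A = 1 := CharTwo.add_eq_zero.1 ha
        refine hab ⟨hinj (by rw [← hA, ha', map_one]), ?_⟩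
        exact (exists_norm_one_add_inv_eq_iff hK b).1 ⟨y, hy, by rw [← ha']; exact h0⟩
      · have hy'' : y = 1 := CharTwo.add_eq_zero.1 (pow_eq_zero_iff two_ne_zero |>.1 hy')
        refine hc (hinj ?_)
        simp only [map_add, map_pow, map_one, map_zero, ← hA, ← hB]
        rw [hy''] at h0
        linear_combination (1 + A + B) * h0 - (A + B + A * B) * h2
    refine ⟨hne, fun x y hx hy hxy => ?_⟩
    obtain ⟨σ, hσ⟩ := exists_norm_one_root_of_norm_one hK hx
    obtain ⟨hx0, hconj, hN, hQ⟩ := hcoef x σ hx hσ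
    have hC : (x ^ 2 + B * x + A) / x ≠ 0 := div_ne_zero (hne x hx) hx0
    rw [hQ y] at hxy
    have hroot := (mul_eq_zero.1 hxy).resolve_left hx0
    obtain ⟨htr, hβ⟩ := h σ ((exists_norm_one_add_inv_eq_iff hK σ).1 ⟨x, hx, hσ⟩)
    by_cases hβ0 : b * σ + (a ^ 2 + b ^ 2 + 1) = 0
    · have h₁ := congrArg (algebraMap F K) (hβ hβ0)
      simp only [map_mul, map_pow, ← hA, ← hB] at h₁
      rw [hβ0, map_zero, zero_mul, add_zero, hconj] at hroot
      have hN0 : A * x ^ 2 + B * x + 1 ≠ 0 := by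
        intro h
        rw [h, zero_div] at hconj
        exact pow_ne_zero _ hC hconj
      refine CharTwo.sq_injective (mul_left_cancel₀ hN0 ?_)
      rw [(mul_sq_eq_iff_of_add_inv hx0 hσ).2 h₁]
      field_simp at hroot
      linear_combination (x ^ 2 + B * x + A) * h2 - hroot
    · exact absurd htr ((exists_norm_one_root_iff hK hC hβ0 hN).1 ⟨y, hy, hroot⟩)

end Quadratic

section Parameters

variable {F : Type*} [Field F] [Fintype F] [Algebra (ZMod 2) F]

theorem two_pow_sub_one_dvd_iff {m i l : ℕ} (hm : 2 < m) (hi : i < m) (hl : l < m) :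
    2 ^ m - 1 ∣ 2 ^ m + 2 ^ i - 2 ^ l ↔ i = 0 ∧ l = 1 := by
  have hi' : 2 ^ i * 2 ≤ 2 ^ m := by rw [← pow_succ]; exact Nat.pow_le_pow_right two_pos hi
  have hl' : 2 ^ l * 2 ≤ 2 ^ m := by rw [← pow_succ]; exact Nat.pow_le_pow_right two_pos hl
  have hm' : 2 ^ 3 ≤ 2 ^ m := Nat.pow_le_pow_right two_pos hm
  have hi0 := Nat.two_pow_pos i
  have hl0 := Nat.two_pow_pos l
  constructor
  · rintro ⟨t, ht⟩
    have ht1 : t = 1 := by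
      have h₁ : t < 2 := by
        by_contra! h
        have := Nat.mul_le_mul_left (2 ^ m - 1) h
        omega
      have h₀ : t ≠ 0 := by rintro rfl; omega
      omega
    subst ht1
    have hil : 2 ^ l = 2 ^ i + 1 := by omega
    rcases i with - | i <;> rcases l with - | l
    · simp at hil
    · refine ⟨rfl, ?_⟩
      have : 2 ^ l = 2 ^ 0 := by omega
      rw [Nat.pow_right_injective le_rfl this]
    · simp at hil
    · omega
  · rintro ⟨rfl, rfl⟩
    exact ⟨1, by omega⟩

/-- In a field of more than four elements of characteristic two, the vanishing of
`Tr (κ + δ / v)` cannot be forced by `Tr v = 1` unless `δ = 0`. -/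
theorem eq_zero_of_trace_eq_zero_or_trace_div_eq_zero (hF : 4 < Fintype.card F) {κ δ : F}
    (h : ∀ v : F, v ≠ 0 → Algebra.trace (ZMod 2) F v = 0 ∨
      Algebra.trace (ZMod 2) F (κ + δ / v) = 0) : δ = 0 := by
  classical
  set m := Module.finrank (ZMod 2) F
  have hcard : Fintype.card F = 2 ^ m := by
    rw [Module.card_eq_pow_finrank (K := ZMod 2), ZMod.card]
  have hm2 : 2 < m := by
    by_contra! h
    have := Nat.pow_le_pow_right two_pos h
    omega
  have htr (x : F) : algebraMap (ZMod 2) F (Algebra.trace (ZMod 2) F x) =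
      ∑ i ∈ Finset.range m, x ^ 2 ^ i := by
    simpa using FiniteField.algebraMap_trace_eq_sum_pow (ZMod 2) F x
  set k := algebraMap (ZMod 2) F (Algebra.trace (ZMod 2) F κ)
  have hterm (v : Fˣ) : ∑ i ∈ Finset.range m, (k * (v : F) ^ (1 + 2 ^ i) +
      ∑ l ∈ Finset.range m, δ ^ 2 ^ l * (v : F) ^ (2 ^ m + 2 ^ i - 2 ^ l)) = 0 := by
    have hv : (v : F) * (∑ i ∈ Finset.range m, (v : F) ^ 2 ^ i) *
        (k + ∑ l ∈ Finset.range m, (δ / v) ^ 2 ^ l) = 0 := by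
      rw [← htr, ← htr, ← map_add, ← map_add]
      rcases h v v.ne_zero with h | h <;> simp [h]
    rw [← hv, Finset.mul_sum, Finset.sum_mul]
    refine Finset.sum_congr rfl fun i hi => ?_
    rw [mul_add, Finset.mul_sum]
    congr 1
    · ring
    · refine Finset.sum_congr rfl fun l hl => ?_
      have hl' : 2 ^ l ≤ 2 ^ m :=
        Nat.pow_le_pow_right two_pos (Finset.mem_range.1 hl).le
      have hvc := FiniteField.pow_card (v : F)
      rw [hcard] at hvc
      have hvl : (v : F) ^ 2 ^ l ≠ 0 := pow_ne_zero _ v.ne_zero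
      rw [pow_sub₀ _ v.ne_zero (hl'.trans (Nat.le_add_right _ _)), pow_add, hvc, div_pow]
      field_simp
  have hsum := Finset.sum_congr rfl fun v (_ : v ∈ (Finset.univ : Finset Fˣ)) => hterm v
  rw [Finset.sum_const_zero, Finset.sum_comm] at hsum
  have hinner : ∀ i ∈ Finset.range m, ∑ v : Fˣ, (k * (v : F) ^ (1 + 2 ^ i) +
      ∑ l ∈ Finset.range m, δ ^ 2 ^ l * (v : F) ^ (2 ^ m + 2 ^ i - 2 ^ l)) =
      if i = 0 then -δ ^ 2 else 0 := by
    intro i hi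
    have hi := Finset.mem_range.1 hi
    rw [Finset.sum_add_distrib, Finset.sum_comm, ← Finset.mul_sum, FiniteField.sum_pow_units,
      hcard, if_neg, mul_zero, zero_add]
    · simp only [← Finset.mul_sum, FiniteField.sum_pow_units, hcard]
      rw [Finset.sum_eq_single 1]
      · simp only [two_pow_sub_one_dvd_iff hm2 hi (show 1 < m by omega)]
        simp
      · intro l hl hl1
        rw [if_neg, mul_zero]
        rw [two_pow_sub_one_dvd_iff hm2 hi (Finset.mem_range.1 hl)]
        exact fun h => hl1 h.2
      · intro h
        exact absurd (Finset.mem_range.2 (by omega)) h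
    · intro hdvd
      have hi' : 2 ^ i * 2 ≤ 2 ^ m := by rw [← pow_succ]; exact Nat.pow_le_pow_right two_pos hi
      have := Nat.le_of_dvd (by positivity) hdvd
      omega
  rw [Finset.sum_congr rfl hinner, Finset.sum_ite_eq', if_pos (Finset.mem_range.2 (by omega))]
    at hsum
  simpa using hsum

theorem sq_eq_self_of_trace_eq_zero (hF : Fintype.card F = 4) {x : F}
    (hx : Algebra.trace (ZMod 2) F x = 0) : x ^ 2 = x := by
  have : CharP F 2 := charP_of_injective_algebraMap' (ZMod 2) 2
  obtain ⟨z, rfl⟩ := (zmod_two_trace_eq_zero_iff x).1 hx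
  have hz := FiniteField.pow_card z
  rw [hF] at hz
  rw [CharTwo.add_sq, ← pow_mul, hz, add_comm]

variable [CharP F 2]

theorem trace_condition_of_parameters {a b : F}
    (h : (a ≠ 1 ∧ Algebra.trace (ZMod 2) F (1 / (a + 1)) = 0 ∧ b ^ 2 = a ^ 2 + a) ∨
      (a = 1 ∧ b ≠ 0 ∧ Algebra.trace (ZMod 2) F (1 / b) = 0)) :
    a ^ 2 + b ^ 2 + 1 ≠ 0 ∧
      ¬ (a = 1 ∧ (b ≠ 0 → Algebra.trace (ZMod 2) F (1 / b) ≠ 0)) ∧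
      ∀ σ : F, (σ ≠ 0 → Algebra.trace (ZMod 2) F (1 / σ) ≠ 0) →
        Algebra.trace (ZMod 2) F ((a * σ ^ 2 + b * (a + 1) * σ + (a ^ 2 + b ^ 2 + 1)) /
          (b * σ + (a ^ 2 + b ^ 2 + 1)) ^ 2) = 0 ∧
        (b * σ + (a ^ 2 + b ^ 2 + 1) = 0 → a * σ ^ 2 = b * σ) := by
  have h2 : (2 : F) = 0 := CharTwo.two_eq_zero
  rcases h with ⟨ha, htr, hb⟩ | ⟨rfl, hb, htr⟩
  · have ha1 : a + 1 ≠ 0 := fun h => ha (CharTwo.add_eq_zero.1 h)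
    have hc : a ^ 2 + b ^ 2 + 1 = a + 1 := by linear_combination hb + a ^ 2 * h2
    rw [hc]
    refine ⟨ha1, fun h => ha h.1, fun σ _ => ⟨?_, fun hβ => ?_⟩⟩
    · by_cases hβ : b * σ + (a + 1) = 0
      · simp [hβ]
      · have hR : (a * σ ^ 2 + b * (a + 1) * σ + (a + 1)) / (b * σ + (a + 1)) ^ 2 =
            1 / (a + 1) + (a + 1) / (b * σ + (a + 1)) + ((a + 1) / (b * σ + (a + 1))) ^ 2 := by
          have hn : (a * σ ^ 2 + b * (a + 1) * σ + (a + 1)) * (a + 1) =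
              (b * σ + (a + 1)) ^ 2 + (a + 1) ^ 2 * (b * σ + (a + 1)) + (a + 1) ^ 3 := by
            linear_combination -σ ^ 2 * hb - (b * σ * (a + 1) + (a + 1) ^ 3) * h2
          generalize a * σ ^ 2 + b * (a + 1) * σ + (a + 1) = n at *
          generalize b * σ + (a + 1) = β at *
          field_simp
          linear_combination hn
        rw [hR, zmod_two_trace_add_sq, add_assoc, CharTwo.add_self_eq_zero, add_zero, htr]
    · refine mul_left_cancel₀ ha1 ?_
      linear_combination -σ ^ 2 * hb + b * σ * hβ - b * σ * (a + 1) * h2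
  · have hc : (1 : F) ^ 2 + b ^ 2 + 1 = b ^ 2 := by linear_combination h2
    rw [hc]
    refine ⟨pow_ne_zero 2 hb, fun h => h.2 hb htr, fun σ hσ => ?_⟩
    have hσb : σ + b ≠ 0 := by
      intro h
      rw [CharTwo.add_eq_zero.1 h] at hσ
      exact hσ hb htr
    have hβ : b * σ + b ^ 2 = b * (σ + b) := by ring
    refine ⟨?_, fun h => absurd (hβ.symm.trans h) (mul_ne_zero hb hσb)⟩
    have hR : (1 * σ ^ 2 + b * (1 + 1) * σ + b ^ 2) / (b * σ + b ^ 2) ^ 2 = (1 / b) ^ 2 := by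
      rw [hβ]
      field_simp
      ring
    rw [hR, zmod_two_trace_sq, htr]

theorem parameters_of_trace_condition {a b : F} (hc : a ^ 2 + b ^ 2 + 1 ≠ 0)
    (hab : ¬ (a = 1 ∧ (b ≠ 0 → Algebra.trace (ZMod 2) F (1 / b) ≠ 0)))
    (h : ∀ σ : F, (σ ≠ 0 → Algebra.trace (ZMod 2) F (1 / σ) ≠ 0) →
        Algebra.trace (ZMod 2) F ((a * σ ^ 2 + b * (a + 1) * σ + (a ^ 2 + b ^ 2 + 1)) /
          (b * σ + (a ^ 2 + b ^ 2 + 1)) ^ 2) = 0 ∧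
        (b * σ + (a ^ 2 + b ^ 2 + 1) = 0 → a * σ ^ 2 = b * σ)) :
    2 < Fintype.card F ∧
      ((a ≠ 1 ∧ Algebra.trace (ZMod 2) F (1 / (a + 1)) = 0 ∧ b ^ 2 = a ^ 2 + a) ∨
        (a = 1 ∧ b ≠ 0 ∧ Algebra.trace (ZMod 2) F (1 / b) = 0)) := by
  have h2 : (2 : F) = 0 := CharTwo.two_eq_zero
  have hcard : Fintype.card F = 2 ^ Module.finrank (ZMod 2) F := by
    rw [Module.card_eq_pow_finrank (K := ZMod 2), ZMod.card]
  have htrc : Algebra.trace (ZMod 2) F (1 / (a ^ 2 + b ^ 2 + 1)) = 0 := by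
    have h₀ := (h 0 (absurd rfl)).1
    rwa [mul_zero, mul_zero, zero_pow two_ne_zero, mul_zero, zero_add, zero_add, sq (_ + 1),
      div_mul_cancel_left₀ hc, ← one_div] at h₀
  have hcard2 : 2 < Fintype.card F := by
    refine lt_of_le_of_ne Fintype.one_lt_card fun hF => ?_
    obtain ⟨z, hz⟩ := (zmod_two_trace_eq_zero_iff _).1 htrc
    have hzq := FiniteField.pow_card z
    rw [← hF] at hzq
    rw [show z ^ 2 = z from hzq, CharTwo.add_self_eq_zero] at hz
    exact one_div_ne_zero hc hz.symm
  refine ⟨hcard2, ?_⟩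
  by_cases ha : a = 1
  · right
    by_cases hb : b = 0
    · exact absurd ⟨ha, absurd hb⟩ hab
    · exact ⟨ha, hb, by_contra fun htr => hab ⟨ha, fun _ => htr⟩⟩
  by_cases hb : b ^ 2 = a ^ 2 + a
  · have hc' : a ^ 2 + b ^ 2 + 1 = a + 1 := by linear_combination hb + a ^ 2 * h2
    exact .inl ⟨ha, hc' ▸ htrc, hb⟩
  exfalso
  have hac : b ^ 2 ≠ a * (a ^ 2 + b ^ 2 + 1) := by
    intro h
    have h' : (a + 1) * (b ^ 2 + (a ^ 2 + a)) = 0 := by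
      linear_combination h + (a * (a ^ 2 + b ^ 2 + 1) + a ^ 2) * h2
    rcases mul_eq_zero.1 h' with h' | h'
    · exact ha (CharTwo.add_eq_zero.1 h')
    · exact hb (CharTwo.add_eq_zero.1 h')
  have hβ : ∀ σ : F, (σ ≠ 0 → Algebra.trace (ZMod 2) F (1 / σ) ≠ 0) →
      b * σ + (a ^ 2 + b ^ 2 + 1) ≠ 0 := by
    intro σ hσ h₀
    have hσ' := (h σ hσ).2 h₀
    have hσ0 : σ ≠ 0 := by rintro rfl; exact hc (by simpa using h₀)
    have hσb : a * σ = b := mul_right_cancel₀ hσ0 (by linear_combination hσ')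
    exact hac (by linear_combination (-a) * h₀ - b * hσb + a * b * σ * h2)
  obtain ⟨d, hd⟩ := (PerfectRing.bijective_frobenius (R := F) (p := 2)).2 a
  change d ^ 2 = a at hd
  rcases lt_or_ge 4 (Fintype.card F) with hF | hF
  · by_cases hb0 : b = 0
    · subst hb0
      have hδ : d / (a ^ 2 + 0 ^ 2 + 1) = 0 := by
        refine eq_zero_of_trace_eq_zero_or_trace_div_eq_zero hF (κ := 0) fun v hv => ?_
        refine or_iff_not_imp_left.2 fun htr => ?_
        have h' := (h (1 / v) (fun _ => by rwa [one_div_one_div])).1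
        have hR : (a * (1 / v) ^ 2 + 0 * (a + 1) * (1 / v) + (a ^ 2 + 0 ^ 2 + 1)) /
            (0 * (1 / v) + (a ^ 2 + 0 ^ 2 + 1)) ^ 2 =
            1 / (a ^ 2 + 0 ^ 2 + 1) + (d / (a ^ 2 + 0 ^ 2 + 1) / v) ^ 2 := by
          simp only [zero_mul, zero_add, add_zero, ← hd]
          rw [← hd] at hc
          field_simp
          ring
        rwa [hR, map_add, htrc, zero_add, zmod_two_trace_sq, ← zero_add (_ / v)] at h'
      rw [div_eq_zero_iff, or_iff_left hc] at hδ
      rw [hδ] at hd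
      exact hb (by rw [← hd]; simp)
    · have hc2 : a ^ 2 + b ^ 2 + 1 = (a + b + 1) ^ 2 := by
        linear_combination -(a + b + a * b) * h2
      have hbd : (a + 1) * (b + d * (a + b + 1)) ≠ 0 := by
        refine mul_ne_zero (fun h => ha (CharTwo.add_eq_zero.1 h)) fun h => hac ?_
        linear_combination (b + d * (a + b + 1)) * CharTwo.add_eq_zero.1 h +
          (a + b + 1) ^ 2 * hd - a * hc2
      have hsplit (σ : F) (hβ₀ : b * σ + (a ^ 2 + b ^ 2 + 1) ≠ 0) :
          (a * σ ^ 2 + b * (a + 1) * σ + (a ^ 2 + b ^ 2 + 1)) /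
            (b * σ + (a ^ 2 + b ^ 2 + 1)) ^ 2 =
          a / b ^ 2 + (a + 1) / (b * σ + (a ^ 2 + b ^ 2 + 1)) +
            (d * (a + b + 1) * (a + 1) / b / (b * σ + (a ^ 2 + b ^ 2 + 1))) ^ 2 := by
        have hn : (a * σ ^ 2 + b * (a + 1) * σ + (a ^ 2 + b ^ 2 + 1)) * b ^ 2 =
            a * (b * σ + (a ^ 2 + b ^ 2 + 1)) ^ 2 +
              (a + 1) * b ^ 2 * (b * σ + (a ^ 2 + b ^ 2 + 1)) +
              d ^ 2 * (a + b + 1) ^ 2 * (a + 1) ^ 2 := by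
          rw [hd, ← hc2]
          linear_combination -(a * b * σ * (a ^ 2 + b ^ 2 + 1) +
            a * (a ^ 2 + b ^ 2 + 1) * (a ^ 2 + b ^ 2 + 1 + a)) * h2
        generalize a * σ ^ 2 + b * (a + 1) * σ + (a ^ 2 + b ^ 2 + 1) = n at *
        generalize b * σ + (a ^ 2 + b ^ 2 + 1) = β at *
        field_simp
        linear_combination hn
      have htrb : Algebra.trace (ZMod 2) F (b / (a ^ 2 + b ^ 2 + 1)) = 0 := by
        by_contra htr
        refine hβ ((a ^ 2 + b ^ 2 + 1) / b) (fun _ => by rwa [one_div_div]) ?_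
        rw [mul_div_cancel₀ _ hb0, CharTwo.add_self_eq_zero]
      have hδ : ((a + 1) * (b + d * (a + b + 1)) / b) * b / (a ^ 2 + b ^ 2 + 1) ^ 2 = 0 := by
        refine eq_zero_of_trace_eq_zero_or_trace_div_eq_zero hF
          (κ := a / b ^ 2 + ((a + 1) * (b + d * (a + b + 1)) / b) / (a ^ 2 + b ^ 2 + 1))
          fun v hv => ?_
        refine or_iff_not_imp_left.2 fun htr => ?_
        have hu : Algebra.trace (ZMod 2) F (v + b / (a ^ 2 + b ^ 2 + 1)) ≠ 0 := by
          rwa [map_add, htrb, add_zero]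
        have hu0 : v + b / (a ^ 2 + b ^ 2 + 1) ≠ 0 := by
          intro h; rw [h, map_zero] at hu; exact hu rfl
        have h' := (h (1 / (v + b / (a ^ 2 + b ^ 2 + 1)))
          (fun _ => by rwa [one_div_one_div])).1
        have hβ₀ := hβ (1 / (v + b / (a ^ 2 + b ^ 2 + 1))) (fun _ => by rwa [one_div_one_div])
        have hβ₁ : b * (1 / (v + b / (a ^ 2 + b ^ 2 + 1))) + (a ^ 2 + b ^ 2 + 1) =
            (a ^ 2 + b ^ 2 + 1) * v / (v + b / (a ^ 2 + b ^ 2 + 1)) := by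
          rw [eq_div_iff hu0, add_mul, mul_assoc, one_div_mul_cancel hu0, mul_add,
            mul_div_cancel₀ _ hc]
          linear_combination b * h2
        rw [hsplit _ hβ₀, zmod_two_trace_add_sq, hβ₁] at h'
        convert h' using 2
        generalize a ^ 2 + b ^ 2 + 1 = c at *
        have hw : c * v + b ≠ 0 := by
          intro h
          apply hu0
          field_simp
          linear_combination h
        generalize a + b + 1 = g
        field_simp
        ring
      rw [div_mul_cancel₀ _ hb0, div_eq_zero_iff] at hδ
      exact hδ.elim hbd (pow_ne_zero 2 hc)
  · have hF4 : Fintype.card F = 4 := by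
      rw [hcard] at hcard2 hF ⊢
      generalize Module.finrank (ZMod 2) F = m at *
      have : m < 3 := (Nat.pow_lt_pow_iff_right one_lt_two).1 (by omega)
      interval_cases m <;> simp_all
    have hinv : ∀ x : F, x ≠ 0 → Algebra.trace (ZMod 2) F (1 / x) = 0 → x = 1 := by
      intro x hx htr
      have := sq_eq_self_of_trace_eq_zero hF4 htr
      field_simp at this
      exact this.symm
    have hc1 := hinv _ hc htrc
    have hba : b = a := CharTwo.sq_injective (by linear_combination hc1 - a ^ 2 * h2)
    subst hba
    have hb0 : b ≠ 0 := by rintro rfl; simp at hb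
    have hb4 := FiniteField.pow_card b
    rw [hF4] at hb4
    have hbb : b ^ 2 + b + 1 = 0 := by
      refine mul_left_cancel₀ (mul_ne_zero hb0 (sub_ne_zero.2 ha)) ?_
      linear_combination hb4
    have h' := (h b fun _ htr => ha (hinv b hb0 htr)).1
    have hR : (b * b ^ 2 + b * (b + 1) * b + (b ^ 2 + b ^ 2 + 1)) /
        (b * b + (b ^ 2 + b ^ 2 + 1)) ^ 2 = 1 / b := by
      have hβ' : b * b + (b ^ 2 + b ^ 2 + 1) = b := by
        linear_combination hbb + (b ^ 2 - b) * h2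
      rw [hβ', div_eq_div_iff (pow_ne_zero 2 hb0) hb0]
      linear_combination b * hbb + (b ^ 4 + b ^ 3 - b ^ 2) * h2
    rw [hR] at h'
    exact ha (hinv b hb0 h')

end Parameters

/-- **Theorem B** (Hou). Let `q = 2^m` be an even prime power, `F = F_q`, `K = F_{q²}`,
and `a, b ∈ F_q`. The polynomial `f(x) = a·x + b·x^q + x^(2q−1)` is a permutation
polynomial of `F_{q²}` iff (i) `q > 2`, `a ≠ 1`, `Tr_{F_q/F_2}(1/(a+1)) = 0` and
`b² = a² + a`, or (ii) `q > 2`, `a = 1`, `b ≠ 0` and `Tr_{F_q/F_2}(1/b) = 0`.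
(The algebra structure of `F` over `ZMod 2` is unique since every ring homomorphism
from `ZMod 2` is unique.) -/
theorem trinomial_pp_even_char
    (q : ℕ)
    (F K : Type*) [Field F] [Field K] [Algebra F K]
    [Fintype F] [Fintype K] [CharP F 2] [Algebra (ZMod 2) F]
    (hF : Fintype.card F = q) (hK : Fintype.card K = q ^ 2)
    (a b : F) :
    Function.Bijective (fun x : K =>
        algebraMap F K a * x + algebraMap F K b * x ^ q + x ^ (2 * q - 1)) ↔
      ((2 < q ∧ a ≠ 1 ∧ Algebra.trace (ZMod 2) F (1 / (a + 1)) = 0 ∧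
          b ^ 2 = a ^ 2 + a) ∨
       (2 < q ∧ a = 1 ∧ b ≠ 0 ∧ Algebra.trace (ZMod 2) F (1 / b) = 0)) := by
  subst hF
  rw [trinomial_bijective_iff_trace hK]
  constructor
  · rintro ⟨hc, hab, h⟩
    obtain ⟨hq, h' | h'⟩ := parameters_of_trace_condition hc hab h
    · exact .inl ⟨hq, h'⟩
    · exact .inr ⟨hq, h'⟩
  · rintro (⟨-, h⟩ | ⟨-, h⟩)
    · exact trace_condition_of_parameters (.inl h)
    · exact trace_condition_of_parameters (.inr h)
end

section
/- Let q be any prime power and b ∈ F_q. The polynomial f(x) = x + b·x^q + x^(2q−1) ∈ F_q[x] is a permutation polynomial of F_{q²} if and only if the quadratic x² + b·x + 1 has two distinct roots in F_q. -/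
open Polynomial in
/-- In an extension of a finite field with `q` elements, the solutions of `y ^ q = y` are exactly
the elements of the base field. -/
theorem exists_algebraMap_eq_of_pow_card_eq_s2 {F K : Type*} [Field F] [Field K] [Algebra F K]
    [Fintype F] {y : K} (hy : y ^ Fintype.card F = y) : ∃ r : F, algebraMap F K r = y := by
  have hs : (X ^ Fintype.card F - X : F[X]).Splits := by
    rw [splits_iff_card_roots, FiniteField.roots_X_pow_card_sub_X,
      FiniteField.X_pow_card_sub_X_natDegree_eq F Fintype.one_lt_card]
    rfl
  have hmem : y ∈ ((X ^ Fintype.card F - X : F[X]).map (algebraMap F K)).roots := by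
    rw [mem_roots (Polynomial.map_ne_zero
      (FiniteField.X_pow_card_sub_X_ne_zero F Fintype.one_lt_card))]
    simp [hy]
  rw [hs.roots_map, Multiset.mem_map] at hmem
  exact hmem.imp fun _ h => h.2

open Polynomial in
/-- Every monic quadratic over a finite field has a root in the quadratic extension. -/
theorem exists_root_quadratic {F K : Type*} [Field F] [Field K] [Algebra F K] [Finite F]
    [Finite K] (hFK : Module.finrank F K = 2) (b c : F) :
    ∃ y : K, y ^ 2 + algebraMap F K b * y + algebraMap F K c = 0 := by
  by_cases h : ∃ r : F, r ^ 2 + b * r + c = 0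
  · obtain ⟨r, hr⟩ := h
    exact ⟨algebraMap F K r, by simpa using congrArg (algebraMap F K) hr⟩
  push Not at h
  set p : F[X] := X ^ 2 + C b * X + C c with hp
  have hdeg : p.natDegree = 2 := by rw [hp]; compute_degree!
  have hirr : Irreducible p := by
    refine (irreducible_iff_roots_eq_zero_of_degree_le_three hdeg.ge (by omega)).2 ?_
    refine Multiset.eq_zero_of_forall_notMem fun r hr => h r ?_
    simpa [hp] using isRoot_of_mem_roots hr
  have : Fact (Irreducible p) := ⟨hirr⟩
  obtain ⟨φ⟩ : Nonempty (AdjoinRoot p →ₐ[F] K) := by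
    refine FiniteField.nonempty_algHom_of_finrank_dvd ?_
    rw [hFK, ← hdeg]
    exact (finrank_quotient_span_eq_natDegree (f := p)).dvd
  refine ⟨φ (AdjoinRoot.root p), ?_⟩
  have h0 : aeval (φ (AdjoinRoot.root p)) p = 0 := by
    rw [aeval_algHom_apply, AdjoinRoot.aeval_eq, AdjoinRoot.mk_self, map_zero]
  simpa [hp] using h0

/-- Hilbert's theorem 90 for a nontrivial involution of a field. -/
theorem exists_ne_zero_apply_eq_mul_of_involutive {K : Type*} [Field K] (σ : K →+* K)
    (hσ : Function.Involutive σ) (hne : ∃ z, σ z ≠ z) {y : K} (hy : y * σ y = 1) :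
    ∃ x : K, x ≠ 0 ∧ σ x = y * x := by
  by_cases h : ∃ z : K, z + σ y * σ z ≠ 0
  · obtain ⟨z, hz⟩ := h
    refine ⟨_, hz, ?_⟩
    rw [map_add, map_mul, hσ, hσ]
    linear_combination (-σ z) * hy
  · push Not at h
    obtain ⟨z, hz⟩ := hne
    have h1 := h 1
    rw [map_one] at h1
    exact absurd (by linear_combination σ z * h1 - h z) hz

/-- Let `q` be any prime power, `F = F_q`, `K = F_{q²}` and `b ∈ F_q`. The polynomial
`f(x) = x + b·x^q + x^(2q−1)` is a permutation polynomial of `F_{q²}` iff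
`x² + b·x + 1` has two distinct roots in `F_q`. -/
theorem trinomial_pp_a_eq_one
    (q : ℕ)
    (F K : Type*) [Field F] [Field K] [Algebra F K]
    [Fintype F] [Fintype K]
    (hF : Fintype.card F = q) (hK : Fintype.card K = q ^ 2)
    (b : F) :
    Function.Bijective (fun x : K =>
        x + algebraMap F K b * x ^ q + x ^ (2 * q - 1)) ↔
      ∃ r s : F, r ≠ s ∧ r ^ 2 + b * r + 1 = 0 ∧ s ^ 2 + b * s + 1 = 0 := by
  have hq : 1 < q := hF ▸ Fintype.one_lt_card
  set σ : K →ₐ[F] K := FiniteField.frobeniusAlgHom F K with hσdef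
  have hσ (x : K) : x ^ q = σ x := by rw [hσdef, FiniteField.coe_frobeniusAlgHom, hF]
  have hinv : Function.Involutive σ := fun x => by
    rw [← hσ, ← hσ, ← pow_mul, ← sq, ← hK, FiniteField.pow_card]
  have hfix {y : K} (hy : σ y = y) : ∃ r : F, algebraMap F K r = y :=
    exists_algebraMap_eq_of_pow_card_eq_s2 (by rw [hF, hσ, hy])
  set f : K → K := fun x => x + algebraMap F K b * x ^ q + x ^ (2 * q - 1) with hf
  have hmul (x : K) : x * f x = x ^ 2 + algebraMap F K b * (x * σ x) + σ x ^ 2 := by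
    have h2 : x * x ^ (2 * q - 1) = σ x ^ 2 := by
      rw [← pow_succ', ← hσ, ← pow_mul]
      congr 1
      omega
    simp only [hf]
    rw [mul_add, h2, hσ]
    ring
  have hf0 : f 0 = 0 := by
    simp [hf, show q ≠ 0 by omega, show 2 * q - 1 ≠ 0 by omega]
  constructor
  · intro hbij
    by_contra hno
    push Not at hno
    have hrank : Module.finrank F K = 2 := by
      have h := Module.card_eq_pow_finrank (K := F) (V := K)
      rw [hK, hF] at h
      exact (Nat.pow_right_injective hq h).symm
    obtain ⟨y, hy⟩ := exists_root_quadratic (K := K) hrank b 1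
    rw [map_one] at hy
    have hy' : σ y ^ 2 + algebraMap F K b * σ y + 1 = 0 := by
      simpa using congrArg σ hy
    have hnorm : y * σ y = 1 := by
      by_cases hyσ : σ y = y
      · obtain ⟨r, rfl⟩ := hfix hyσ
        have hr : r ^ 2 + b * r + 1 = 0 :=
          (algebraMap F K).injective (by simpa using hy)
        have hs : r = -b - r := by
          by_contra hne
          exact hno r (-b - r) hne hr (by linear_combination hr)
        have hr1 : r * r = 1 := by linear_combination r * hs - hr
        rw [hyσ, ← map_mul, hr1, map_one]
      · have h1 : σ y - y ≠ 0 := sub_ne_zero.2 hyσ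
        refine mul_left_cancel₀ h1 ?_
        linear_combination y * hy' - σ y * hy
    have hne : ∃ z, σ z ≠ z := by
      by_contra! hall
      have hsurj : Function.Surjective (algebraMap F K) := fun y => hfix (hall y)
      have hle := Fintype.card_le_of_surjective _ hsurj
      rw [hF, hK] at hle
      nlinarith
    obtain ⟨x, hx0, hx⟩ :=
      exists_ne_zero_apply_eq_mul_of_involutive (σ : K →+* K) hinv hne hnorm
    replace hx : σ x = y * x := hx
    have hfx : x * f x = 0 := by
      rw [hmul, hx]
      linear_combination x ^ 2 * hy
    have hfx0 : f x = f 0 := by rw [hf0]; exact (mul_eq_zero.1 hfx).resolve_left hx0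
    exact hx0 (hbij.1 hfx0)
  · rintro ⟨r, s, hrs, hr, hs⟩
    have hsum : r + s = -b := by
      refine mul_left_cancel₀ (sub_ne_zero.2 hrs) ?_
      linear_combination hr - hs
    have hprod : r * s = 1 := by linear_combination r * hsum - hr
    have key {t u x : K} (htu : t * u = 1) (hne : t ≠ u) (ht : σ t = t) (h : x = t * σ x) :
        x = 0 := by
      have h2 : σ x = t * x := by
        conv_lhs => rw [h, map_mul, hinv, ht]
      by_contra hx
      have ht2 : t * t = 1 := mul_right_cancel₀ hx (by linear_combination (-t) * h2 - h)
      have ht0 : t ≠ 0 := left_ne_zero_of_mul_eq_one htu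
      exact hne (mul_left_cancel₀ ht0 (ht2.trans htu.symm))
    have hrs' : algebraMap F K r ≠ algebraMap F K s := (algebraMap F K).injective.ne hrs
    have hprod' : algebraMap F K r * algebraMap F K s = 1 := by rw [← map_mul, hprod, map_one]
    have hsum' : algebraMap F K r + algebraMap F K s = -algebraMap F K b := by
      rw [← map_add, hsum, map_neg]
    have hker {x : K} (h : f x = 0) : x = 0 := by
      have hfac : (x - algebraMap F K r * σ x) * (x - algebraMap F K s * σ x) = 0 := by
        have hm := hmul x
        rw [h, mul_zero] at hm
        linear_combination (-x * σ x) * hsum' + σ x ^ 2 * hprod' - hm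
      rcases mul_eq_zero.1 hfac with h1 | h1
      · exact key hprod' hrs' (σ.commutes r) (sub_eq_zero.1 h1)
      · exact key ((mul_comm _ _).trans hprod') hrs'.symm (σ.commutes s) (sub_eq_zero.1 h1)
    have hfixed (x : K) : σ (x * f x) = x * f x := by
      rw [hmul]
      simp only [map_add, map_mul, map_pow, hinv x, AlgHom.commutes]
      ring
    refine Finite.injective_iff_bijective.1 fun x y hxy => ?_
    by_cases hc : f y = 0
    · rw [hker hc, hker (hxy.trans hc)]
    have hy0 : y ≠ 0 := fun h => hc (h ▸ hf0)
    have hx0 : x ≠ 0 := fun h => hc (hxy ▸ h ▸ hf0)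
    have hx := hfixed x
    have hy := hfixed y
    rw [map_mul, hxy] at hx
    rw [map_mul] at hy
    have hσc : σ (f y) ≠ 0 := (map_ne_zero σ).2 hc
    have hcross : σ x * y = x * σ y := by
      refine mul_left_cancel₀ (mul_ne_zero hc hσc) ?_
      linear_combination (f y * y) * hx - (f y * x) * hy
    have hmx := hmul x
    have hmy := hmul y
    rw [hxy] at hmx
    have hxx : (x * y * f y) * x = (x * y * f y) * y := by
      linear_combination x ^ 2 * hmy - y ^ 2 * hmx +
        (-algebraMap F K b * x * y - (σ x * y + x * σ y)) * hcross
    exact mul_left_cancel₀ (mul_ne_zero (mul_ne_zero hx0 hy0) hc) hxx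
end

section
/- Let q be any prime power and b ∈ F_q with b ≠ 0. Then the polynomial f(x) = b·x^q + x^(2q−1) ∈ F_q[x] is not a permutation polynomial of F_{q²}. (Indeed, ∑_{x ∈ F_{q²}} f(x)^(q−1) = b^(−1) ≠ 0, contradicting Hermite's criterion.) -/
/-- Over a finite field, the sum of the `i`-th powers of all elements, for `i ≠ 0`. -/
theorem FiniteField.sum_pow_of_ne_zero {K : Type*} [Field K] [Fintype K] {i : ℕ} (hi : i ≠ 0) :
    ∑ x : K, x ^ i = if Fintype.card K - 1 ∣ i then -1 else 0 := by
  classical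
  rw [← FiniteField.sum_pow_units K i,
    ← Finset.add_sum_erase Finset.univ (fun x : K => x ^ i) (Finset.mem_univ 0)]
  simp only [zero_pow hi, zero_add]
  symm
  refine Finset.sum_bij (fun (u : Kˣ) _ => (u : K)) (fun u _ => ?_) (fun u _ v _ h => ?_)
    (fun x hx => ?_) (fun u _ => ?_)
  · simp
  · exact Units.ext h
  · exact ⟨Units.mk0 x (Finset.ne_of_mem_erase hx), Finset.mem_univ _, rfl⟩
  · simp

/-- For `k < q`, the exponent `(q - 1) * (q + k)` is a multiple of `q ^ 2 - 1` only if `k = 1`. -/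
theorem Nat.sq_sub_one_dvd_sub_one_mul_add_iff {q k : ℕ} (hq : 1 < q) (hk : k < q) :
    q ^ 2 - 1 ∣ (q - 1) * (q + k) ↔ k = 1 := by
  have h : q ^ 2 - 1 = (q - 1) * (q + 1) := by
    rw [mul_comm, ← Nat.sq_sub_sq q 1, one_pow]
  rw [h, Nat.mul_dvd_mul_iff_left (by omega)]
  constructor
  · rintro ⟨c, hc⟩
    have hc1 : c < 2 := by nlinarith
    have hc0 : c ≠ 0 := by rintro rfl; omega
    obtain rfl : c = 1 := by omega
    omega
  · rintro rfl
    rfl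


/-- Let `q` be any prime power, `F = F_q`, `K = F_{q²}` and `b ∈ F_q`, `b ≠ 0`. Then
`f(x) = b·x^q + x^(2q−1)` is not a permutation polynomial of `F_{q²}`; indeed
`∑_{x ∈ F_{q²}} f(x)^{q−1} = b⁻¹ ≠ 0`, contradicting Hermite's criterion. -/
theorem trinomial_a_eq_zero_not_pp
    (q : ℕ)
    (F K : Type*) [Field F] [Field K] [Algebra F K]
    [Fintype F] [Fintype K]
    (hF : Fintype.card F = q) (hK : Fintype.card K = q ^ 2)
    (b : F) (hb : b ≠ 0) :
    (∑ x : K, (algebraMap F K b * x ^ q + x ^ (2 * q - 1)) ^ (q - 1)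
        = algebraMap F K b⁻¹) ∧
    ¬ Function.Bijective (fun x : K =>
        algebraMap F K b * x ^ q + x ^ (2 * q - 1)) := by
  have hq1 : 1 < q := hF ▸ Fintype.one_lt_card
  have hb' : algebraMap F K b ≠ 0 := by simpa using hb
  have hbq : b ^ (q - 1) = 1 := hF ▸ FiniteField.pow_card_sub_one_eq_one b hb
  have hq0 : ((q : ℕ) : K) = 0 := by
    rw [← map_natCast (algebraMap F K), ← hF, FiniteField.cast_card_eq_zero, map_zero]
  have hsum : ∑ x : K, (algebraMap F K b * x ^ q + x ^ (2 * q - 1)) ^ (q - 1)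
      = algebraMap F K b⁻¹ := by
    have hexp : ∀ x : K, (algebraMap F K b * x ^ q + x ^ (2 * q - 1)) ^ (q - 1) =
        ∑ k ∈ Finset.range q, algebraMap F K b ^ (q - 1 - k) * ((q - 1).choose k : K) *
          x ^ ((q - 1) * (q + k)) := by
      intro x
      rw [add_comm, add_pow, Nat.sub_add_cancel hq1.le]
      refine Finset.sum_congr rfl fun k hk => ?_
      have hk' : k < q := Finset.mem_range.mp hk
      have he : (q - 1) * (q + k) = (2 * q - 1) * k + q * (q - 1 - k) := by
        clear * - hk'
        obtain ⟨m, rfl⟩ := Nat.exists_eq_add_of_lt hk'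
        have h1 : k + m + 1 - 1 - k = m := by omega
        have h2 : 2 * (k + m + 1) - 1 = 2 * (k + m) + 1 := by omega
        rw [h1, h2, Nat.add_sub_cancel]
        ring
      rw [he, pow_add, pow_mul, pow_mul, mul_pow]
      ring
    simp_rw [hexp]
    rw [Finset.sum_comm]
    simp_rw [← Finset.mul_sum]
    rw [Finset.sum_eq_single_of_mem 1 (Finset.mem_range.mpr hq1)]
    · rw [FiniteField.sum_pow_of_ne_zero (by apply mul_ne_zero <;> omega), hK,
        if_pos ((Nat.sq_sub_one_dvd_sub_one_mul_add_iff hq1 hq1).mpr rfl), Nat.choose_one_right,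
        Nat.cast_sub hq1.le, hq0, map_inv₀, Nat.cast_one, ← mul_eq_one_iff_eq_inv₀ hb']
      have : b ^ (q - 1 - 1) * b = 1 := by
        rw [← pow_succ, Nat.sub_add_cancel (by omega), hbq]
      have h := congrArg (algebraMap F K) this
      rw [map_mul, map_pow, map_one] at h
      linear_combination h
    · intro k hk hk1
      rw [FiniteField.sum_pow_of_ne_zero (by apply mul_ne_zero <;> omega), hK,
        if_neg (mt (Nat.sq_sub_one_dvd_sub_one_mul_add_iff hq1 (Finset.mem_range.mp hk)).mp hk1),
        mul_zero]
  refine ⟨hsum, fun hbij => ?_⟩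
  have h0 : ∑ x : K, x ^ (q - 1) = 0 := by
    refine FiniteField.sum_pow_lt_card_sub_one K (q - 1) ?_
    rw [hK]
    have : q < q ^ 2 := by nlinarith
    omega
  have h := hbij.sum_comp (fun x : K => x ^ (q - 1))
  rw [hsum, h0] at h
  simp [hb] at h
end

section
/- Let q be an odd prime power and a, b ∈ F_q with a(a−1)b ≠ 0, a(a−1) a nonzero square in F_q, and b² = a² + 3a. Then the map f(x) = a·x + b·x^q + x^(2q−1) sends F_{q²} \ F_q into F_{q²} \ F_q; that is, if x ∈ F_{q²} and x ∉ F_q, then f(x) ∉ F_q. -/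
/-- An element of an extension of a finite field `F` fixed by the Frobenius of `F` lies in `F`. -/
theorem mem_range_algebraMap_of_pow_card_eq {F K : Type*} [Field F] [Fintype F] [Field K]
    [Algebra F K] {x : K} (hx : x ^ Fintype.card F = x) : x ∈ Set.range (algebraMap F K) := by
  have hsplits : (Polynomial.X ^ Fintype.card F - Polynomial.X : Polynomial F).Splits := by
    rw [Polynomial.splits_iff_card_roots, FiniteField.roots_X_pow_card_sub_X,
      FiniteField.X_pow_card_sub_X_natDegree_eq F Fintype.one_lt_card, ← Finset.card_def,
      Finset.card_univ]
  exact hsplits.mem_range_of_isRoot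
    (FiniteField.X_pow_card_sub_X_ne_zero F Fintype.one_lt_card) (by simp [hx])

/-- Let `q` be an odd prime power and `a, b ∈ F_q` with `a(a−1)b ≠ 0`, `a(a−1)` a
nonzero square in `F_q`, and `b² = a² + 3a`. Then `f(x) = a·x + b·x^q + x^(2q−1)`
maps `F_{q²} \ F_q` into `F_{q²} \ F_q`. -/
theorem trinomial_maps_nonsubfield_to_nonsubfield
    (q : ℕ) (hq : Odd q)
    (F K : Type*) [Field F] [Field K] [Algebra F K]
    [Fintype F] [Fintype K]
    (hF : Fintype.card F = q) (hK : Fintype.card K = q ^ 2)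
    (a b : F) (hab : a * (a - 1) * b ≠ 0)
    (hsq : ∃ v : F, v ≠ 0 ∧ a * (a - 1) = v ^ 2)
    (hb : b ^ 2 = a ^ 2 + 3 * a)
    (x : K) (hx : x ∉ Set.range (algebraMap F K)) :
    algebraMap F K a * x + algebraMap F K b * x ^ q + x ^ (2 * q - 1) ∉
      Set.range (algebraMap F K) := by
  have two_ne_zero_F : (2 : F) ≠ 0 := Ring.two_ne_zero fun h => by
    have := FiniteField.even_card_iff_char_two.mp h
    rw [hF] at this
    rw [Nat.odd_iff] at hq
    omega
  rintro ⟨c, hc⟩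
  obtain ⟨v, -, hv⟩ := hsq
  have two_ne_zero_K : (2 : K) ≠ 0 := by
    rw [← map_ofNat (algebraMap F K) 2]
    exact (map_ne_zero _).mpr two_ne_zero_F
  have ha : a ≠ 0 := by rintro rfl; simp at hab
  have ha1 : a - 1 ≠ 0 := by intro h; simp [h] at hab
  have hx0 : x ≠ 0 := by rintro rfl; exact hx ⟨0, map_zero _⟩
  have hyx : x ^ q ≠ x := fun h => hx (mem_range_algebraMap_of_pow_card_eq (hF ▸ h))
  set φ : K →ₐ[F] K := FiniteField.frobeniusAlgHom F K
  have hφ (z : K) : φ z = z ^ q := by simp [φ, hF]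
  have hqx : x ^ (2 * q - 1) * x = (x ^ q) ^ 2 := by
    rw [← pow_succ, ← pow_mul, Nat.sub_add_cancel (by have := hq.pos; omega), mul_comm]
  have hφx : φ (x ^ q) = x := by
    rw [hφ, ← pow_mul, ← sq, ← hK, FiniteField.pow_card]
  have hφy : φ x = x ^ q := hφ x
  clear_value φ
  generalize x ^ q = y at *
  have h1 : algebraMap F K c * x =
      algebraMap F K a * x ^ 2 + algebraMap F K b * x * y + y ^ 2 := by
    rw [hc, ← hqx]; ring
  have h2 := congrArg φ h1
  simp only [map_add, map_mul, map_pow, AlgHom.commutes, hφx, hφy] at h2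
  have h3 : y ^ 2 + x ^ 2 = (algebraMap F K a - algebraMap F K b - 1) * x * y :=
    mul_left_cancel₀ (sub_ne_zero.mpr hyx) (by linear_combination x * h2 - y * h1)
  have hbK := congrArg (algebraMap F K) hb
  have hvK := congrArg (algebraMap F K) hv
  simp only [map_add, map_mul, map_pow, map_sub, map_one, map_ofNat] at hbK hvK
  obtain ⟨s, hs⟩ : ∃ s : F, y = algebraMap F K s * x := by
    have haK : algebraMap F K a ≠ 0 := (map_ne_zero _).mpr ha
    have hsquare : (algebraMap F K a *
        (2 * y + (1 - algebraMap F K a + algebraMap F K b) * x)) ^ 2 =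
        (algebraMap F K v * (algebraMap F K a - algebraMap F K b) * x) ^ 2 := by
      generalize algebraMap F K a = A at *
      generalize algebraMap F K b = B at *
      generalize algebraMap F K v = V at *
      linear_combination 4 * A ^ 2 * h3 + (A - B) ^ 2 * x ^ 2 * hvK + A * x ^ 2 * hbK
    rcases sq_eq_sq_iff_eq_or_eq_neg.mp hsquare with h | h
    · refine ⟨(v * (a - b) / a - (1 - a + b)) / 2, ?_⟩
      simp only [map_add, map_mul, map_sub, map_one, map_ofNat, map_div₀]
      field_simp
      linear_combination h
    · refine ⟨(-(v * (a - b) / a) - (1 - a + b)) / 2, ?_⟩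
      simp only [map_add, map_mul, map_sub, map_neg, map_one, map_ofNat, map_div₀]
      field_simp
      linear_combination h
  have h4 := congrArg φ hs
  simp only [map_mul, AlgHom.commutes, hφx, hφy] at h4
  have hsq_one : (y - x) * (y + x) = 0 := by
    linear_combination y * hs - x * h4
  have hneg : y = -x := eq_neg_of_add_eq_zero_left
    ((mul_eq_zero.mp hsq_one).resolve_left (sub_ne_zero.mpr hyx))
  subst hneg
  have h5 : algebraMap F K (b - a - 1) = 0 := by
    refine mul_right_cancel₀ (pow_ne_zero 2 hx0) ?_
    simp only [map_sub, map_one]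
    linear_combination -h3
  have h6 : b - a - 1 = 0 := (map_eq_zero _).mp h5
  exact ha1 (by linear_combination (b + a + 1) * h6 - hb)
end

section
/- Let q be any prime power, a, b ∈ F_q with a ≠ 0 and b ≠ 0, and f(x) = a·x + b·x^q + x^(2q−1). Let 0 ≤ s < q² − 1 and write s = α + β·q with 0 ≤ α, β ≤ q − 1. If α + β·q is not divisible by q − 1, then ∑_{x ∈ F_{q²}} f(x)^s = 0. If s ≠ 0 and α + β·q ≡ 0 (mod q−1), then α + β = q − 1 and ∑_{x ∈ F_{q²}} f(x)^s = − ∑ binom(α,i)·binom(i,k)·binom(β,j)·binom(j,l)·a^(q−1−i−j)·b^(i+j−k−l), where the sum is over all integers i, j, k, l with 0 ≤ k ≤ i ≤ α, 0 ≤ l ≤ j ≤ β, and q − α + i + k − j − l equal to 0 or to q + 1 (and negative powers of a, b are interpreted as powers of their inverses in F_q). -/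
theorem trinomial_pow_eq_sum {R : Type*} [CommSemiring R] {q : ℕ} (hq : 1 ≤ q)
    (a b x : R) (n : ℕ) :
    (a * x + b * x ^ q + x ^ (2 * q - 1)) ^ n =
      ∑ i ∈ Finset.range (n + 1), ∑ k ∈ Finset.range (i + 1),
        (n.choose i : R) * (i.choose k : R) * a ^ (n - i) * b ^ (i - k) *
          x ^ (n + (q - 1) * (i + k)) := by
  rw [show a * x + b * x ^ q + x ^ (2 * q - 1) = (x ^ (2 * q - 1) + b * x ^ q) + a * x by ring,
    add_pow]
  refine Finset.sum_congr rfl fun i hi => ?_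
  rw [add_pow, Finset.sum_mul, Finset.sum_mul]
  refine Finset.sum_congr rfl fun k hk => ?_
  obtain ⟨c, rfl⟩ := Nat.exists_eq_add_of_le (Finset.mem_range_succ_iff.1 hi)
  obtain ⟨d, rfl⟩ := Nat.exists_eq_add_of_le (Finset.mem_range_succ_iff.1 hk)
  obtain ⟨r, rfl⟩ := Nat.exists_eq_add_of_le hq
  rw [show 2 * (1 + r) - 1 = 2 * r + 1 by lia, Nat.add_sub_cancel_left, Nat.add_sub_cancel_left,
    Nat.add_sub_cancel_left]
  ring

theorem FiniteField.sum_pow_eq_ite {K : Type*} [Field K] [Fintype K] {n : ℕ} (hn : n ≠ 0) :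
    ∑ x : K, x ^ n = if Fintype.card K - 1 ∣ n then -1 else 0 := by
  classical
  rw [← FiniteField.sum_pow_units K n,
    ← Finset.sum_subset (Finset.subset_univ (Finset.univ.filter (fun x : K => x ≠ 0)))
      (by intro x _ hx; simp_all)]
  symm
  refine Finset.sum_bij (fun (u : Kˣ) _ => (u : K)) (by simp) (fun u _ v _ h => Units.ext h)
    (fun x hx => ⟨Units.mk0 x (by simpa using hx), by simp⟩) (fun _ _ => rfl)

theorem sum_trinomial_pow_eq {F K : Type*} [Field F] [Field K] [Algebra F K]
    [Fintype F] [Fintype K] {q : ℕ} (hF : Fintype.card F = q) (a b : F) {α β : ℕ}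
    (hs : α + β * q ≠ 0) :
    ∑ x : K, (algebraMap F K a * x + algebraMap F K b * x ^ q + x ^ (2 * q - 1)) ^ (α + β * q) =
      ∑ i ∈ Finset.range (α + 1), ∑ k ∈ Finset.range (i + 1),
        ∑ j ∈ Finset.range (β + 1), ∑ l ∈ Finset.range (j + 1),
          algebraMap F K ((α.choose i : F) * (i.choose k : F) * (β.choose j : F) *
            (j.choose l : F) * (a ^ (α - i) * a ^ (β - j)) * (b ^ (i - k) * b ^ (j - l))) *
          if Fintype.card K - 1 ∣ α + β * q + (q - 1) * (i + k + q * (j + l)) then -1 else 0 := by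
  have hq : 1 ≤ q := hF ▸ Fintype.card_pos
  have frob (x : K) :
      (algebraMap F K a * x + algebraMap F K b * x ^ q + x ^ (2 * q - 1)) ^ q =
        algebraMap F K a * x ^ q + algebraMap F K b * (x ^ q) ^ q + (x ^ q) ^ (2 * q - 1) := by
    have h := map_add (FiniteField.frobeniusAlgHom F K)
    simp only [FiniteField.coe_frobeniusAlgHom, hF] at h
    rw [h, h, mul_pow, mul_pow, ← map_pow, ← map_pow, ← hF, FiniteField.pow_card,
      FiniteField.pow_card, pow_right_comm x (2 * _ - 1)]
  have expand (x : K) :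
      (algebraMap F K a * x + algebraMap F K b * x ^ q + x ^ (2 * q - 1)) ^ (α + β * q) =
      ∑ i ∈ Finset.range (α + 1), ∑ k ∈ Finset.range (i + 1),
        ∑ j ∈ Finset.range (β + 1), ∑ l ∈ Finset.range (j + 1),
          algebraMap F K ((α.choose i : F) * (i.choose k : F) * (β.choose j : F) *
            (j.choose l : F) * (a ^ (α - i) * a ^ (β - j)) * (b ^ (i - k) * b ^ (j - l))) *
          x ^ (α + β * q + (q - 1) * (i + k + q * (j + l))) := by
    rw [pow_add, mul_comm β q, pow_mul, frob, trinomial_pow_eq_sum hq, trinomial_pow_eq_sum hq]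
    simp only [Finset.sum_mul]
    refine Finset.sum_congr rfl fun i _ => Finset.sum_congr rfl fun k _ => ?_
    simp only [Finset.mul_sum]
    refine Finset.sum_congr rfl fun j _ => Finset.sum_congr rfl fun l _ => ?_
    simp only [map_mul, map_pow, map_natCast]
    ring
  simp_rw [expand]
  rw [Finset.sum_comm]
  refine Finset.sum_congr rfl fun i _ => ?_
  rw [Finset.sum_comm]
  refine Finset.sum_congr rfl fun k _ => ?_
  rw [Finset.sum_comm]
  refine Finset.sum_congr rfl fun j _ => ?_
  rw [Finset.sum_comm]
  refine Finset.sum_congr rfl fun l _ => ?_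
  rw [← Finset.mul_sum, FiniteField.sum_pow_eq_ite (by lia)]

theorem sq_sub_one_dvd_iff {q α β i k j l : ℕ} (hq : 2 ≤ q) (hαβ : α + β = q - 1)
    (hi : i ≤ α) (hk : k ≤ i) (hj : j ≤ β) (hl : l ≤ j) :
    q ^ 2 - 1 ∣ α + β * q + (q - 1) * (i + k + q * (j + l)) ↔
      (q : ℤ) - α + i + k - j - l = 0 ∨ (q : ℤ) - α + i + k - j - l = q + 1 := by
  obtain ⟨r, rfl⟩ := Nat.exists_eq_add_of_le' (show 1 ≤ q by lia)
  obtain rfl : r = α + β := by lia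
  have h₁ : (α + β + 1) ^ 2 - 1 = (α + β) * (α + β + 2) := by
    rw [Nat.sub_eq_iff_eq_add (Nat.one_le_pow _ _ (by lia))]; ring
  have h₂ : α + β * (α + β + 1) + (α + β + 1 - 1) * (i + k + (α + β + 1) * (j + l)) =
      (α + β) * (β + 1 + (i + k + (α + β + 1) * (j + l))) := by
    rw [Nat.add_sub_cancel]; ring
  rw [h₁, h₂, Nat.mul_dvd_mul_iff_left (by lia), ← Int.natCast_dvd_natCast]
  have h₃ : ((β + 1 + (i + k + (α + β + 1) * (j + l)) : ℕ) : ℤ) =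
      ((β : ℤ) + 1 + i + k - j - l) + ((α + β + 2 : ℕ) : ℤ) * (j + l) := by
    push_cast; ring
  rw [h₃, dvd_add_left (dvd_mul_right _ _)]
  push_cast
  constructor
  · rintro ⟨c, hc⟩
    have hc₁ : -1 < c := by nlinarith
    have hc₂ : c < 2 := by nlinarith
    obtain rfl | rfl : c = 0 ∨ c = 1 := by lia
    · left; lia
    · right; lia
  · rintro (h | h)
    · exact ⟨0, by lia⟩
    · exact ⟨1, by lia⟩

/-- Power-sum computation for `f(x) = a·x + b·x^q + x^(2q−1)` over `F_{q²}`.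
Let `0 ≤ s < q² − 1`, `s = α + β·q` with `0 ≤ α, β ≤ q − 1`. If `q − 1 ∤ s` then
`∑_{x ∈ F_{q²}} f(x)^s = 0`; if `s ≠ 0` and `q − 1 ∣ s` then `α + β = q − 1` and
the power sum equals the stated fourfold binomial sum (negative powers of `a`, `b`
being interpreted via `zpow` in the field `F_q`). -/
theorem trinomial_power_sums
    (q : ℕ)
    (F K : Type*) [Field F] [Field K] [Algebra F K]
    [Fintype F] [Fintype K]
    (hF : Fintype.card F = q) (hK : Fintype.card K = q ^ 2)
    (a b : F) (ha : a ≠ 0) (hb : b ≠ 0)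
    (s α β : ℕ) (hs : s < q ^ 2 - 1) (hsαβ : s = α + β * q)
    (hα : α ≤ q - 1) (hβ : β ≤ q - 1) :
    (¬ (q - 1) ∣ s →
      ∑ x : K,
        (algebraMap F K a * x + algebraMap F K b * x ^ q + x ^ (2 * q - 1)) ^ s = 0) ∧
    (s ≠ 0 → (q - 1) ∣ s →
      α + β = q - 1 ∧
      ∑ x : K,
        (algebraMap F K a * x + algebraMap F K b * x ^ q + x ^ (2 * q - 1)) ^ s =
        - algebraMap F K
          (∑ i ∈ Finset.range (α + 1), ∑ k ∈ Finset.range (i + 1),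
           ∑ j ∈ Finset.range (β + 1), ∑ l ∈ Finset.range (j + 1),
            if (q : ℤ) - α + i + k - j - l = 0 ∨ (q : ℤ) - α + i + k - j - l = q + 1
            then (α.choose i : F) * (i.choose k : F) * (β.choose j : F) *
                 (j.choose l : F) * a ^ ((q : ℤ) - 1 - i - j) * b ^ ((i : ℤ) + j - k - l)
            else 0)) := by
  subst hsαβ
  have hq : 2 ≤ q := hF ▸ Fintype.one_lt_card
  have hs_eq : α + β * q = (α + β) + (q - 1) * β := by
    obtain ⟨r, rfl⟩ := Nat.exists_eq_add_of_le' (show 1 ≤ q by lia)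
    rw [Nat.add_sub_cancel]; ring
  have hdvd : q - 1 ∣ q ^ 2 - 1 := by simpa using Nat.sub_dvd_pow_sub_pow q 1 2
  constructor
  · intro hns
    rw [sum_trinomial_pow_eq hF a b (fun h => hns (h ▸ dvd_zero _))]
    refine Finset.sum_eq_zero fun i _ => Finset.sum_eq_zero fun k _ =>
      Finset.sum_eq_zero fun j _ => Finset.sum_eq_zero fun l _ => ?_
    rw [hK, if_neg, mul_zero]
    exact fun h => hns ((Nat.dvd_add_left (dvd_mul_right _ _)).1 (hdvd.trans h))
  · intro hs0 hds
    have hαβ : α + β = q - 1 := by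
      rw [hs_eq, Nat.dvd_add_left (dvd_mul_right _ _)] at hds
      obtain ⟨c, hc⟩ := hds
      have hc₀ : c ≠ 0 := by
        rintro rfl
        obtain ⟨rfl, rfl⟩ : α = 0 ∧ β = 0 := by lia
        simp at hs0
      have hc₂ : c < 2 := by
        by_contra! h
        have := Nat.mul_le_mul_left (q - 1) h
        obtain ⟨rfl, rfl⟩ : α = q - 1 ∧ β = q - 1 := by lia
        obtain ⟨r, rfl⟩ := Nat.exists_eq_add_of_le' (show 1 ≤ q by lia)
        rw [Nat.add_sub_cancel, Nat.lt_sub_iff_add_lt] at hs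
        nlinarith
      obtain rfl : c = 1 := by lia
      simpa using hc
    refine ⟨hαβ, ?_⟩
    rw [sum_trinomial_pow_eq hF a b hs0]
    simp only [map_sum, ← Finset.sum_neg_distrib]
    refine Finset.sum_congr rfl fun i hi => Finset.sum_congr rfl fun k hk =>
      Finset.sum_congr rfl fun j hj => Finset.sum_congr rfl fun l hl => ?_
    rw [Finset.mem_range_succ_iff] at hi hk hj hl
    have hea : (q : ℤ) - 1 - i - j = ((α - i + (β - j) : ℕ) : ℤ) := by lia
    have heb : (i : ℤ) + j - k - l = ((i - k + (j - l) : ℕ) : ℤ) := by lia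
    simp only [hK, sq_sub_one_dvd_iff hq hαβ hi hk hj hl]
    split_ifs
    · rw [hea, heb, zpow_natCast, zpow_natCast, pow_add, pow_add, mul_neg_one]
    · simp
end

section
/- Let q be any prime power, a, b ∈ F_q with a ≠ 0 and b ≠ 0, and suppose the quadratic x² + x − z, where z = −a/b², has two distinct roots in F_q (this forces b² − 4a ≠ 0). Then for f(x) = a·x + b·x^q + x^(2q−1), ∑_{x ∈ F_{q²}} f(x)^(1 + (q−2)·q) = 2(1 − a)(b² − a² − 3a) / (a²(b² − 4a)). -/
open Finset

/-- Summing a polynomial of degree at most `q` at `x ^ (q - 1)` over the units of a field with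
`q ^ 2` elements leaves minus its constant coefficient. -/
lemma sum_units_sum_range_mul_pow {K : Type*} [Field K] [Fintype K] [DecidableEq K]
    {q : ℕ} (hq : 2 ≤ q) (hK : Fintype.card K = q ^ 2) (c : ℕ → K) :
    ∑ x : Kˣ, ∑ k ∈ range (q + 1), c k * ((x : K) ^ (q - 1)) ^ k = -c 0 := by
  have hsum (k : ℕ) (hk : k ∈ range (q + 1)) :
      ∑ x : Kˣ, ((x : K) ^ (q - 1)) ^ k = if k = 0 then -1 else 0 := by
    have h := FiniteField.sum_pow_units K ((q - 1) * k)
    simp only [pow_mul] at h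
    rw [h]
    congr 1
    rw [hK, eq_iff_iff]
    have hfac : q ^ 2 - 1 = (q - 1) * (q + 1) := by
      rw [mul_comm]; simpa using Nat.sq_sub_sq q 1
    rw [hfac, Nat.mul_dvd_mul_iff_left (by omega)]
    exact ⟨fun h => Nat.eq_zero_of_dvd_of_lt h (mem_range.1 hk), fun h => h ▸ dvd_zero _⟩
  rw [sum_comm]
  simp_rw [← mul_sum]
  rw [sum_congr rfl fun k hk => by rw [hsum k hk]]
  simp

/-- The closed form of the derivative of a finite geometric series. -/
lemma one_sub_sq_mul_sum_range_succ_mul_pow {R : Type*} [CommRing R] (t : R) (n : ℕ) :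
    (1 - t) ^ 2 * ∑ k ∈ range n, ((k : R) + 1) * t ^ k
      = 1 - (n + 1) * t ^ n + n * t ^ (n + 1) := by
  induction n with
  | zero => simp
  | succ n ih => rw [sum_range_succ, mul_add, ih]; push_cast; ring

section

variable {K : Type*} [Field K] [Fintype K] {q : ℕ}

lemma cast_eq_zero_of_card_eq_sq (hK : Fintype.card K = q ^ 2) : (q : K) = 0 := by
  have h := Nat.cast_card_eq_zero K
  rw [hK] at h
  simpa using h

lemma pow_sub_one_pow_add_one (hK : Fintype.card K = q ^ 2) (x : Kˣ) :
    ((x : K) ^ (q - 1)) ^ (q + 1) = 1 := by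
  have hfac : (q - 1) * (q + 1) = q ^ 2 - 1 := by
    rw [mul_comm]; simpa using (Nat.sq_sub_sq q 1).symm
  rw [← pow_mul, hfac, ← hK]
  exact FiniteField.pow_card_sub_one_eq_one _ x.ne_zero

lemma mul_pow_sub_one_pow_add_one (hK : Fintype.card K = q ^ 2) {α : K}
    (hα : α ^ q = α) (x : Kˣ) : (α * (x : K) ^ (q - 1)) ^ (q + 1) = α ^ 2 := by
  rw [mul_pow, pow_sub_one_pow_add_one hK, pow_succ, hα]
  ring

lemma one_sub_mul_pow_sub_one_ne_zero (hK : Fintype.card K = q ^ 2) {α : K}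
    (hα : α ^ q = α) (h1 : α ^ 2 ≠ 1) (x : Kˣ) : 1 - α * (x : K) ^ (q - 1) ≠ 0 := by
  intro h
  apply h1
  rw [← mul_pow_sub_one_pow_add_one hK hα x, ← sub_eq_zero.1 h, one_pow]

lemma geom_sum_mul_pow_sub_one (hK : Fintype.card K = q ^ 2) {α : K}
    (hα : α ^ q = α) (h1 : α ^ 2 = 1) (x : Kˣ) :
    (1 - α * (x : K) ^ (q - 1)) * ∑ k ∈ range (q + 1), (α * (x : K) ^ (q - 1)) ^ k = 0 := by
  rw [mul_neg_geom_sum, mul_pow_sub_one_pow_add_one hK hα, h1, sub_self]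

variable [DecidableEq K]

lemma sum_units_const (hq : 2 ≤ q) (hK : Fintype.card K = q ^ 2) (c : K) :
    ∑ _x : Kˣ, c = -c := by
  simpa using sum_units_sum_range_mul_pow hq hK fun k => if k = 0 then c else 0

lemma sum_units_pow_sub_one (hq : 2 ≤ q) (hK : Fintype.card K = q ^ 2) :
    ∑ x : Kˣ, (x : K) ^ (q - 1) = 0 := by
  have h := sum_units_sum_range_mul_pow hq hK fun k => if k = 1 then (1 : K) else 0
  simpa [show 0 < q by omega, show q ≠ 0 by omega] using h

lemma sum_units_pow_sub_one_sq (hq : 2 ≤ q) (hK : Fintype.card K = q ^ 2) :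
    ∑ x : Kˣ, ((x : K) ^ (q - 1)) ^ 2 = 0 := by
  have h := sum_units_sum_range_mul_pow hq hK fun k => if k = 2 then (1 : K) else 0
  simpa [show 2 < q + 1 by omega, show ¬ q < 2 by omega] using h

lemma sum_units_geom (hq : 2 ≤ q) (hK : Fintype.card K = q ^ 2) (α : K) :
    ∑ x : Kˣ, ∑ k ∈ range (q + 1), (α * (x : K) ^ (q - 1)) ^ k = -1 := by
  simpa [mul_pow] using sum_units_sum_range_mul_pow hq hK fun k => α ^ k

lemma sum_units_inv_one_sub (hq : 2 ≤ q) (hK : Fintype.card K = q ^ 2) {α : K}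
    (hα : α ^ q = α) (h1 : α ^ 2 ≠ 1) :
    ∑ x : Kˣ, (1 - α * (x : K) ^ (q - 1))⁻¹ = -(1 - α ^ 2)⁻¹ := by
  have h1' : 1 - α ^ 2 ≠ 0 := sub_ne_zero.2 h1.symm
  have h (x : Kˣ) : (1 - α * (x : K) ^ (q - 1))⁻¹
      = (1 - α ^ 2)⁻¹ * ∑ k ∈ range (q + 1), (α * (x : K) ^ (q - 1)) ^ k := by
    have hx := one_sub_mul_pow_sub_one_ne_zero hK hα h1 x
    have hg := mul_neg_geom_sum (α * (x : K) ^ (q - 1)) (q + 1)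
    rw [mul_pow_sub_one_pow_add_one hK hα] at hg
    rw [inv_mul_eq_div, eq_div_iff h1', ← hg, inv_mul_cancel_left₀ hx]
  rw [sum_congr rfl fun x _ => h x, ← mul_sum, sum_units_geom hq hK, mul_neg_one]

lemma sum_units_inv_one_sub_sq (hq : 2 ≤ q) (hK : Fintype.card K = q ^ 2) {α : K}
    (hα : α ^ q = α) (h1 : α ^ 2 ≠ 1) :
    ∑ x : Kˣ, (1 - α * (x : K) ^ (q - 1))⁻¹ ^ 2 = -(1 - α ^ 2)⁻¹ ^ 2 := by
  have h1' : 1 - α ^ 2 ≠ 0 := sub_ne_zero.2 h1.symm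
  have hS := sum_units_sum_range_mul_pow hq hK fun k => ((k : K) + 1) * α ^ k
  have h (x : Kˣ) : (1 - α * (x : K) ^ (q - 1))⁻¹ ^ 2
      = (1 - α ^ 2)⁻¹ * ∑ k ∈ range (q + 1), ((k : K) + 1) * α ^ k * ((x : K) ^ (q - 1)) ^ k
        + (1 - α ^ 2)⁻¹ * α ^ 2 * (1 - α * (x : K) ^ (q - 1))⁻¹ := by
    have hx := one_sub_mul_pow_sub_one_ne_zero hK hα h1 x
    have hg := one_sub_sq_mul_sum_range_succ_mul_pow (α * (x : K) ^ (q - 1)) (q + 1)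
    rw [pow_succ _ (q + 1), mul_pow_sub_one_pow_add_one hK hα] at hg
    push_cast at hg
    rw [cast_eq_zero_of_card_eq_sq hK] at hg
    simp only [mul_pow, ← mul_assoc] at hg
    field_simp
    linear_combination -hg
  rw [sum_congr rfl fun x _ => h x, sum_add_distrib, ← mul_sum, ← mul_sum, hS,
    sum_units_inv_one_sub hq hK hα h1]
  field_simp
  push_cast
  ring

/-- The value of the power sum in terms of the roots `α`, `β`, when neither is a
`(q + 1)`-st root of unity. -/
lemma sum_units_blaschke_sq (hq : 2 ≤ q) (hK : Fintype.card K = q ^ 2) {α β : K}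
    (hα : α ^ q = α) (hβ : β ^ q = β) (hα0 : α ≠ 0) (hβ0 : β ≠ 0) (hαβ : α ≠ β)
    (hα1 : α ^ 2 ≠ 1) (hβ1 : β ^ 2 ≠ 1) :
    ∑ x : Kˣ, ((x : K) ^ (q - 1) * ((x : K) ^ (q - 1) - α) * ((x : K) ^ (q - 1) - β) /
      ((1 - α * (x : K) ^ (q - 1)) * (1 - β * (x : K) ^ (q - 1)))) ^ 2
      = 2 * (1 - α * β) * ((α + β) ^ 2 - (α * β) ^ 2 - 3 * (α * β)) /
        ((α * β) ^ 2 * (α - β) ^ 2) := by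
  have hsub : α - β ≠ 0 := sub_ne_zero.2 hαβ
  have hα1' : 1 - α ^ 2 ≠ 0 := sub_ne_zero.2 hα1.symm
  have hβ1' : 1 - β ^ 2 ≠ 0 := sub_ne_zero.2 hβ1.symm
  obtain ⟨c, hc⟩ : ∃ c, c = (α * β)⁻¹ := ⟨_, rfl⟩
  obtain ⟨P, hP⟩ : ∃ P, P = (1 - α ^ 2) * (1 - α * β) / (α ^ 2 * (α - β)) := ⟨_, rfl⟩
  obtain ⟨Q, hQ⟩ : ∃ Q, Q = -((1 - β ^ 2) * (1 - α * β) / (β ^ 2 * (α - β))) := ⟨_, rfl⟩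
  have hpt (x : Kˣ) :
      ((x : K) ^ (q - 1) * ((x : K) ^ (q - 1) - α) * ((x : K) ^ (q - 1) - β) /
        ((1 - α * (x : K) ^ (q - 1)) * (1 - β * (x : K) ^ (q - 1)))) ^ 2
      = c ^ 2 * ((x : K) ^ (q - 1)) ^ 2 + -(2 * c * (P + Q)) * (x : K) ^ (q - 1)
        + ((P + Q) ^ 2 - 2 * c * P / α - 2 * c * Q / β)
        + (2 * c * P / α - 2 * (P + Q) * P + 2 * P * Q * α / (α - β)) *
          (1 - α * (x : K) ^ (q - 1))⁻¹
        + P ^ 2 * (1 - α * (x : K) ^ (q - 1))⁻¹ ^ 2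
        + (2 * c * Q / β - 2 * (P + Q) * Q - 2 * P * Q * β / (α - β)) *
          (1 - β * (x : K) ^ (q - 1))⁻¹
        + Q ^ 2 * (1 - β * (x : K) ^ (q - 1))⁻¹ ^ 2 := by
    have hx := one_sub_mul_pow_sub_one_ne_zero hK hα hα1 x
    have hy := one_sub_mul_pow_sub_one_ne_zero hK hβ hβ1 x
    generalize (x : K) ^ (q - 1) = u at *
    have hx' : 1 - u * α ≠ 0 := mul_comm α u ▸ hx
    have hy' : 1 - u * β ≠ 0 := mul_comm β u ▸ hy
    have hφ : u * (u - α) * (u - β) / ((1 - α * u) * (1 - β * u))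
        = c * u - (P + Q) + P * (1 - α * u)⁻¹ + Q * (1 - β * u)⁻¹ := by
      subst hc hP hQ
      field_simp
      ring
    rw [hφ]
    field_simp
    ring
  rw [sum_congr rfl fun x _ => hpt x]
  simp only [sum_add_distrib, ← mul_sum, sum_units_const hq hK]
  rw [sum_units_pow_sub_one hq hK, sum_units_pow_sub_one_sq hq hK,
    sum_units_inv_one_sub hq hK hα hα1, sum_units_inv_one_sub hq hK hβ hβ1,
    sum_units_inv_one_sub_sq hq hK hα hα1, sum_units_inv_one_sub_sq hq hK hβ hβ1]
  subst hc hP hQ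
  field_simp
  ring

/-- The value of the power sum in terms of the roots `α`, `β`, when `α` is a square root of `1`. -/
lemma sum_units_blaschke_sq_of_sq_eq_one (hq : 2 ≤ q) (hK : Fintype.card K = q ^ 2) {α β : K}
    (hα : α ^ q = α) (hβ : β ^ q = β) (hβ0 : β ≠ 0) (hαβ : α ≠ β)
    (hα1 : α ^ 2 = 1) (hβ1 : β ^ 2 ≠ 1) :
    ∑ x : Kˣ, ((x : K) ^ (q - 1) * ((x : K) ^ (q - 1) - α) * ((x : K) ^ (q - 1) - β) /
      ((1 - α * (x : K) ^ (q - 1)) * (1 - β * (x : K) ^ (q - 1)))) ^ 2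
      = 2 * (1 - α * β) * ((α + β) ^ 2 - (α * β) ^ 2 - 3 * (α * β)) /
        ((α * β) ^ 2 * (α - β) ^ 2) := by
  have hsub : α - β ≠ 0 := sub_ne_zero.2 hαβ
  have hα0 : α ≠ 0 := by rintro rfl; simp at hα1
  have hβ1' : 1 - β ^ 2 ≠ 0 := sub_ne_zero.2 hβ1.symm
  obtain ⟨Q, hQ⟩ : ∃ Q, Q = (1 - β ^ 2) / β ^ 2 := ⟨_, rfl⟩
  have hpt (x : Kˣ) :
      ((x : K) ^ (q - 1) * ((x : K) ^ (q - 1) - α) * ((x : K) ^ (q - 1) - β) /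
        ((1 - α * (x : K) ^ (q - 1)) * (1 - β * (x : K) ^ (q - 1)))) ^ 2
      = β⁻¹ ^ 2 * ((x : K) ^ (q - 1)) ^ 2 + (2 * β⁻¹ * Q) * (x : K) ^ (q - 1)
        + (Q ^ 2 + 2 * Q / β ^ 2)
        + (-(2 * Q / β ^ 2) - 2 * Q ^ 2) * (1 - β * (x : K) ^ (q - 1))⁻¹
        + Q ^ 2 * (1 - β * (x : K) ^ (q - 1))⁻¹ ^ 2
        + -1 * ∑ k ∈ range (q + 1), (α * (x : K) ^ (q - 1)) ^ k := by
    have hy := one_sub_mul_pow_sub_one_ne_zero hK hβ hβ1 x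
    have hg := geom_sum_mul_pow_sub_one hK hα hα1 x
    have hone (h : α * (x : K) ^ (q - 1) = 1) :
        ∑ k ∈ range (q + 1), (α * (x : K) ^ (q - 1)) ^ k = 1 := by
      simp [h, cast_eq_zero_of_card_eq_sq hK]
    generalize ∑ k ∈ range (q + 1), (α * (x : K) ^ (q - 1)) ^ k = J at *
    generalize (x : K) ^ (q - 1) = u at *
    have hy' : 1 - u * β ≠ 0 := mul_comm β u ▸ hy
    have hψ : (u * (u - β) / (1 - β * u)) ^ 2 = β⁻¹ ^ 2 * u ^ 2 + (2 * β⁻¹ * Q) * u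
        + (Q ^ 2 + 2 * Q / β ^ 2)
        + (-(2 * Q / β ^ 2) - 2 * Q ^ 2) * (1 - β * u)⁻¹
        + Q ^ 2 * (1 - β * u)⁻¹ ^ 2 := by
      subst hQ
      field_simp
      ring
    rw [← hψ]
    by_cases hu : α * u = 1
    · have hua : u = α := by linear_combination α * hu - u * hα1
      subst hua
      have : u * (u - β) / (1 - β * u) = 1 := by
        rw [div_eq_one_iff_eq hy]
        linear_combination hα1
      rw [this, hone hu]
      simp
    · have hu' : 1 - α * u ≠ 0 := sub_ne_zero.2 (Ne.symm hu)
      have hu'' : 1 - u * α ≠ 0 := mul_comm α u ▸ hu'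
      have hJ : J = 0 := by simpa [hu'] using hg
      have : u * (u - α) * (u - β) / ((1 - α * u) * (1 - β * u))
          = -α * (u * (u - β) / (1 - β * u)) := by
        field_simp
        linear_combination -u ^ 2 * (u - β) * hα1
      rw [this, mul_pow, neg_sq, hα1, hJ]
      ring
  rw [sum_congr rfl fun x _ => hpt x]
  simp only [sum_add_distrib, ← mul_sum, sum_units_const hq hK]
  rw [sum_units_pow_sub_one hq hK, sum_units_pow_sub_one_sq hq hK,
    sum_units_inv_one_sub hq hK hβ hβ1, sum_units_inv_one_sub_sq hq hK hβ hβ1,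
    sum_units_geom hq hK]
  subst hQ
  rcases mul_self_eq_one_iff.1 (sq α ▸ hα1) with rfl | rfl
  · field_simp
    ring
  · field_simp
    ring

end


/-- For `f(x) = a·x + b·x^q + x^(2q−1)` with `a, b ∈ F_q^*` such that
`x² + x − z`, `z = −a/b²`, has two distinct roots in `F_q` (which forces
`b² − 4a ≠ 0`), one has
`∑_{x ∈ F_{q²}} f(x)^{1+(q−2)q} = 2(1−a)(b²−a²−3a)/(a²(b²−4a))`. -/
theorem trinomial_power_sum_one_q_sub_two_q
    (q : ℕ)
    (F K : Type*) [Field F] [Field K] [Algebra F K]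
    [Fintype F] [Fintype K]
    (hF : Fintype.card F = q) (hK : Fintype.card K = q ^ 2)
    (a b : F) (ha : a ≠ 0) (hb : b ≠ 0)
    (hroots : ∃ r s : F, r ≠ s ∧
      r ^ 2 + r - (-a / b ^ 2) = 0 ∧ s ^ 2 + s - (-a / b ^ 2) = 0) :
    ∑ x : K,
      (algebraMap F K a * x + algebraMap F K b * x ^ q + x ^ (2 * q - 1)) ^
        (1 + (q - 2) * q)
      = algebraMap F K
          (2 * (1 - a) * (b ^ 2 - a ^ 2 - 3 * a) / (a ^ 2 * (b ^ 2 - 4 * a))) := by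

  classical
  have hq : 2 ≤ q := hF ▸ Fintype.one_lt_card
  obtain ⟨r, s, hrs, hr, hs⟩ := hroots
  have hsum : r + s = -1 := by
    have h : (r - s) * (r + s + 1) = 0 := by linear_combination hr - hs
    linear_combination (mul_eq_zero.1 h).resolve_left (sub_ne_zero.2 hrs)
  have hprod : b ^ 2 * (r * s) = a := by
    field_simp at hr
    linear_combination -hr + b ^ 2 * r * hsum
  obtain ⟨α, hα⟩ : ∃ α, α = algebraMap F K (b * r) := ⟨_, rfl⟩
  obtain ⟨β, hβ⟩ : ∃ β, β = algebraMap F K (b * s) := ⟨_, rfl⟩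
  have hb' : algebraMap F K b = -(α + β) := by
    rw [hα, hβ, ← map_add, ← map_neg]
    congr 1
    linear_combination b * hsum
  have ha' : algebraMap F K a = α * β := by
    rw [hα, hβ, ← map_mul]
    congr 1
    linear_combination -hprod
  have hpow (y : F) : (algebraMap F K y) ^ q = algebraMap F K y := by
    rw [← map_pow, ← hF, FiniteField.pow_card]
  have hαq : α ^ q = α := hα ▸ hpow _
  have hβq : β ^ q = β := hβ ▸ hpow _
  have haK : α * β ≠ 0 := ha' ▸ (map_ne_zero _).2 ha
  have hbK : α + β ≠ 0 := by
    rw [← neg_ne_zero, ← hb']; exact (map_ne_zero _).2 hb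
  have hα0 := left_ne_zero_of_mul haK
  have hβ0 := right_ne_zero_of_mul haK
  have hαβ : α ≠ β := by
    rw [hα, hβ]
    exact fun h => hrs (mul_left_cancel₀ hb ((algebraMap F K).injective h))
  have hterm (x : Kˣ) :
      (algebraMap F K a * x + algebraMap F K b * (x : K) ^ q + (x : K) ^ (2 * q - 1)) ^
        (1 + (q - 2) * q)
      = ((x : K) ^ (q - 1) * ((x : K) ^ (q - 1) - α) * ((x : K) ^ (q - 1) - β) /
        ((1 - α * (x : K) ^ (q - 1)) * (1 - β * (x : K) ^ (q - 1)))) ^ 2 := by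
    have hu := pow_sub_one_pow_add_one hK x
    have hxq : (x : K) ^ q = x * (x : K) ^ (q - 1) := by
      rw [← pow_succ']; congr 1; omega
    have hx2 : (x : K) ^ (2 * q - 1) = x * ((x : K) ^ (q - 1)) ^ 2 := by
      rw [← pow_mul, ← pow_succ']; congr 1; omega
    have hfrob (y z : K) : (y - z) ^ q = y ^ q - z ^ q := by
      simpa [hF] using map_sub (FiniteField.frobeniusAlgHom F K) y z
    have hu0 : (x : K) ^ (q - 1) ≠ 0 := pow_ne_zero _ x.ne_zero
    rw [hx2, hxq, ha', hb']
    have hx0 := x.ne_zero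
    generalize (x : K) ^ (q - 1) = u at *
    generalize (x : K) = y at *
    have huq : u ^ q = u⁻¹ := by
      exact eq_inv_of_mul_eq_one_left (by rw [← pow_succ, hu])
    have hf : α * β * y + -(α + β) * (y * u) + y * u ^ 2 = y * (u - α) * (u - β) := by ring
    have hfq : (y * (u - α) * (u - β)) ^ q = y * u⁻¹ * ((1 - α * u) * (1 - β * u)) := by
      rw [mul_pow, mul_pow, hfrob, hfrob, hxq, huq, hαq, hβq]
      field_simp
    have hfqq : ((y * (u - α) * (u - β)) ^ q) ^ q = y * (u - α) * (u - β) := by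
      rw [← pow_mul, ← sq, ← hK, FiniteField.pow_card]
    rw [hf]
    have hexp : (y * (u - α) * (u - β)) ^ (1 + (q - 2) * q)
        = (y * (u - α) * (u - β) / (y * (u - α) * (u - β)) ^ q) ^ 2 := by
      generalize y * (u - α) * (u - β) = f at *
      rcases eq_or_ne f 0 with rfl | hf0
      · simp
      · have hfq0 : f ^ q ≠ 0 := pow_ne_zero _ hf0
        rw [div_pow, eq_div_iff (pow_ne_zero _ hfq0), pow_add, mul_comm (q - 2) q, pow_mul,
          mul_assoc, ← pow_add, Nat.sub_add_cancel hq, hfqq]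
        ring
    rw [hexp, hfq]
    congr 1
    rw [mul_assoc y, mul_assoc y, mul_div_mul_left _ _ hx0, mul_assoc u, mul_div_assoc u,
      mul_comm u⁻¹, ← div_div, div_inv_eq_mul, mul_comm]
  have hvalue : ∑ x : Kˣ,
      ((x : K) ^ (q - 1) * ((x : K) ^ (q - 1) - α) * ((x : K) ^ (q - 1) - β) /
        ((1 - α * (x : K) ^ (q - 1)) * (1 - β * (x : K) ^ (q - 1)))) ^ 2
      = 2 * (1 - α * β) * ((α + β) ^ 2 - (α * β) ^ 2 - 3 * (α * β)) /
        ((α * β) ^ 2 * (α - β) ^ 2) := by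
    have hne : ¬ (α ^ 2 = 1 ∧ β ^ 2 = 1) := by
      rintro ⟨h1, h2⟩
      have h : (α - β) * (α + β) = 0 := by linear_combination h1 - h2
      exact (mul_ne_zero (sub_ne_zero.2 hαβ) hbK) h
    by_cases hα1 : α ^ 2 = 1
    · exact sum_units_blaschke_sq_of_sq_eq_one hq hK hαq hβq hβ0 hαβ hα1 fun h => hne ⟨hα1, h⟩
    · by_cases hβ1 : β ^ 2 = 1
      · have h := sum_units_blaschke_sq_of_sq_eq_one hq hK hβq hαq hα0 hαβ.symm hβ1 hα1
        rw [mul_comm α β, add_comm α β, ← neg_sub β α, neg_sq, ← h]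
        refine sum_congr rfl fun x _ => ?_
        rw [mul_right_comm, mul_comm (1 - α * _)]
      · exact sum_units_blaschke_sq hq hK hαq hβq hα0 hβ0 hαβ hα1 hβ1
  rw [Fintype.sum_eq_add_sum_subtype_ne _ 0, ← unitsEquivNeZero.sum_comp]
  simp only [unitsEquivNeZero_apply_coe]
  rw [sum_congr rfl fun x _ => hterm x, hvalue]
  have hq0 : q ≠ 0 := by omega
  have hq1 : 2 * q - 1 ≠ 0 := by omega
  simp only [map_div₀, map_mul, map_sub, map_pow, map_one, map_ofNat, ha', hb', mul_zero,
    zero_pow hq0, zero_pow hq1, add_zero]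
  rw [zero_pow (by omega), zero_add]
  congr 1
  · ring
  · ring
end

section
/- Let q be any prime power and z ∈ F_q with z ≠ 0. Write x² + x − z = (x − r₁)(x − r₂) with r₁, r₂ ∈ F_{q²}. Then ∑_{0 ≤ l ≤ q/2} binom(−l, l)·z^l equals 1/2 if r₁ = r₂ ∈ F_q; equals 1 if r₁, r₂ ∈ F_q and r₁ ≠ r₂; and equals 0 if r₁, r₂ ∉ F_q. -/
theorem FiniteField.pow_card_eq_self_iff_mem_range (F : Type*) {K : Type*} [Field F] [Fintype F]
    [Field K] [Algebra F K] (a : K) :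
    a ^ Fintype.card F = a ↔ a ∈ Set.range (algebraMap F K) := by
  refine ⟨fun ha => ?_, ?_⟩
  · have hne : (Polynomial.X ^ Fintype.card F - Polynomial.X : Polynomial F) ≠ 0 :=
      FiniteField.X_pow_card_sub_X_ne_zero F Fintype.one_lt_card
    have hs : (Polynomial.X ^ Fintype.card F - Polynomial.X : Polynomial F).Splits := by
      rw [Polynomial.splits_iff_card_roots, FiniteField.roots_X_pow_card_sub_X,
        FiniteField.X_pow_card_sub_X_natDegree_eq F Fintype.one_lt_card]
      rfl
    exact hs.mem_range_of_isRoot hne (by simp [ha])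
  · rintro ⟨x, rfl⟩
    rw [← map_pow, FiniteField.pow_card]

/-- Modulo a prime `p`, shifting the upper entry of a binomial coefficient by `p ^ k` does
not change it when the lower entry is less than `p ^ k`. -/
theorem Ring.cast_choose_pow_add (R : Type*) [Ring R] {p : ℕ} [CharP R p] (hp : p.Prime)
    (k : ℕ) (m : ℤ) {l : ℕ} (hl : l < p ^ k) :
    ((Ring.choose (((p ^ k : ℕ) : ℤ) + m) l : ℤ) : R) = ((Ring.choose m l : ℤ) : R) := by
  rw [Ring.add_choose_eq l (Commute.all _ _), Int.cast_sum, Finset.sum_eq_single (0, l)]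
  · simp
  · rintro ⟨i, j⟩ hij hne
    rw [Finset.HasAntidiagonal.mem_antidiagonal] at hij
    have hi : i ≠ 0 := by
      rintro rfl
      exact hne (by simpa using hij)
    have hdvd : p ∣ (p ^ k).choose i := hp.dvd_choose_pow hi (by dsimp at hij; omega)
    rw [Ring.choose_natCast, Int.cast_mul, Int.cast_natCast, (CharP.cast_eq_zero_iff R p _).2 hdvd,
      zero_mul]
  · simp

/-- The Fibonacci polynomials `∑ binom(n - l, l) z ^ l`, written as a sum over an
antidiagonal. -/
def fibSum {R : Type*} [CommRing R] (z : R) (n : ℕ) : R :=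
  ∑ ij ∈ Finset.HasAntidiagonal.antidiagonal n, (ij.1.choose ij.2 : R) * z ^ ij.2

theorem fibSum_add_two {R : Type*} [CommRing R] (z : R) (n : ℕ) :
    fibSum z (n + 2) = fibSum z (n + 1) + z * fibSum z n := by
  simp only [fibSum]
  rw [Finset.Nat.antidiagonal_succ_succ', Finset.Nat.antidiagonal_succ']
  simp only [Finset.sum_cons, Finset.sum_map, Finset.mul_sum]
  simp only [Function.Embedding.prodMap, Function.Embedding.coeFn_mk, Prod.map_fst, Prod.map_snd,
    Function.Embedding.refl_apply, Nat.succ_eq_add_one, Nat.choose_succ_succ, Nat.cast_add,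
    add_mul, Finset.sum_add_distrib, add_assoc, pow_succ']
  simp [mul_left_comm, add_comm]

theorem map_fibSum {R S : Type*} [CommRing R] [CommRing S] (f : R →+* S) (z : R) (n : ℕ) :
    f (fibSum z n) = fibSum (f z) n := by
  simp [fibSum]

theorem fibSum_eq_sum_range {R : Type*} [CommRing R] (z : R) (n : ℕ) :
    fibSum z n = ∑ l ∈ Finset.range (n / 2 + 1), ((n - l).choose l : R) * z ^ l := by
  rw [fibSum, ← Finset.Nat.sum_antidiagonal_swap]
  rw [Finset.Nat.sum_antidiagonal_eq_sum_range_succ_mk]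
  symm
  apply Finset.sum_subset
  · intro l hl
    simp only [Finset.mem_range] at *
    omega
  · intro l _ hl
    simp only [Finset.mem_range] at hl
    rw [Nat.choose_eq_zero_of_lt (by omega)]
    simp

theorem fibSum_succ_of_roots {R : Type*} [CommRing R] {z s t : R} (hsum : s + t = 1)
    (hprod : s * t = -z) (n : ℕ) : fibSum z (n + 1) = s * fibSum z n + t ^ (n + 1) := by
  induction n with
  | zero => simp [fibSum, Finset.Nat.antidiagonal_succ, hsum]
  | succ n ih =>
    rw [fibSum_add_two, pow_succ t (n + 1)]
    linear_combination (-fibSum z (n + 1)) * hsum + t * ih + fibSum z n * hprod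

theorem sub_mul_fibSum {R : Type*} [CommRing R] {z s t : R} (hsum : s + t = 1)
    (hprod : s * t = -z) (n : ℕ) : (s - t) * fibSum z n = s ^ (n + 1) - t ^ (n + 1) := by
  have h₁ := fibSum_succ_of_roots hsum hprod n
  have h₂ := fibSum_succ_of_roots (z := z) ((add_comm t s).trans hsum)
    ((mul_comm t s).trans hprod) n
  linear_combination h₂ - h₁

theorem fibSum_of_double_root {R : Type*} [CommRing R] {z s : R} (hsum : s + s = 1)
    (hprod : s * s = -z) (n : ℕ) : fibSum z n = (n + 1) * s ^ n := by
  induction n with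
  | zero => simp [fibSum]
  | succ n ih =>
    rw [fibSum_succ_of_roots hsum hprod, ih]
    push_cast
    ring

theorem sum_choose_neg_eq_fibSum {F : Type*} [Field F] [Fintype F] (z : F) :
    ∑ l ∈ Finset.range (Fintype.card F / 2 + 1), ((Ring.choose (-(l : ℤ)) l : ℤ) : F) * z ^ l =
      fibSum z (Fintype.card F) := by
  obtain ⟨p, _, k, hp, hq⟩ := FiniteField.card' F
  rw [fibSum_eq_sum_range]
  refine Finset.sum_congr rfl fun l hl => ?_
  have hlt : l < Fintype.card F := by
    have := Fintype.one_lt_card (α := F)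
    rw [Finset.mem_range] at hl
    omega
  rw [← Ring.cast_choose_pow_add F hp k _ (hq ▸ hlt), ← hq, ← sub_eq_add_neg,
    ← Nat.cast_sub hlt.le, Ring.choose_natCast, Int.cast_natCast]


/-- **Lemma 3.1** (Hou). Let `z ∈ F_q^*` and write `x² + x − z = (x − r₁)(x − r₂)`
with `r₁, r₂ ∈ F_{q²}` (equivalently `r₁ + r₂ = −1` and `r₁r₂ = −z`). Then
`∑_{0 ≤ l ≤ ⌊q/2⌋} binom(−l, l)·z^l` equals `1/2` if `r₁ = r₂ ∈ F_q`, equals `1`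
if `r₁, r₂ ∈ F_q` are distinct, and equals `0` if `r₁, r₂ ∉ F_q`. -/
theorem binom_sum_neg_l_l
    (q : ℕ)
    (F K : Type*) [Field F] [Field K] [Algebra F K]
    [Fintype F] [Fintype K]
    (hF : Fintype.card F = q) (hK : Fintype.card K = q ^ 2)
    (z : F) (hz : z ≠ 0)
    (r₁ r₂ : K) (hsum : r₁ + r₂ = -1) (hprod : r₁ * r₂ = -(algebraMap F K z)) :
    ((r₁ = r₂ ∧ r₁ ∈ Set.range (algebraMap F K)) →
      ∑ l ∈ Finset.range (q / 2 + 1),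
        ((Ring.choose (-(l : ℤ)) l : ℤ) : F) * z ^ l = 1 / 2) ∧
    ((r₁ ≠ r₂ ∧ r₁ ∈ Set.range (algebraMap F K) ∧ r₂ ∈ Set.range (algebraMap F K)) →
      ∑ l ∈ Finset.range (q / 2 + 1),
        ((Ring.choose (-(l : ℤ)) l : ℤ) : F) * z ^ l = 1) ∧
    ((r₁ ∉ Set.range (algebraMap F K) ∧ r₂ ∉ Set.range (algebraMap F K)) →
      ∑ l ∈ Finset.range (q / 2 + 1),
        ((Ring.choose (-(l : ℤ)) l : ℤ) : F) * z ^ l = 0) := by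
  subst hF
  rw [sum_choose_neg_eq_fibSum]
  have hsum' : -r₁ + -r₂ = 1 := by linear_combination -hsum
  have hprod' : -r₁ * -r₂ = -(algebraMap F K z) := by linear_combination hprod
  have hmap := map_fibSum (algebraMap F K) z (Fintype.card F)
  have hbinet := sub_mul_fibSum hsum' hprod' (Fintype.card F)
  have hfrob (r : K) : (-r) ^ Fintype.card F = -r ^ Fintype.card F := by
    simpa using map_neg (FiniteField.frobeniusAlgHom F K) r
  rw [pow_succ, pow_succ, hfrob, hfrob] at hbinet
  refine ⟨?_, ?_, ?_⟩
  · rintro ⟨rfl, hr⟩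
    have hr' := (FiniteField.pow_card_eq_self_iff_mem_range F r₁).2 hr
    have hcard : (Fintype.card F : K) = 0 := by
      rw [← map_natCast (algebraMap F K), FiniteField.cast_card_eq_zero, map_zero]
    have h2 : (2 : K) ≠ 0 := by
      intro h
      exact one_ne_zero (α := K) (by linear_combination -hsum' - r₁ * h)
    apply (algebraMap F K).injective
    rw [hmap, fibSum_of_double_root hsum' hprod', hcard, hfrob, hr', map_div₀, map_one,
      map_ofNat, eq_div_iff h2]
    linear_combination hsum'
  · rintro ⟨hne, h₁, h₂⟩
    rw [(FiniteField.pow_card_eq_self_iff_mem_range F r₁).2 h₁,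
      (FiniteField.pow_card_eq_self_iff_mem_range F r₂).2 h₂] at hbinet
    apply (algebraMap F K).injective
    rw [hmap, map_one]
    apply mul_left_cancel₀ (sub_ne_zero.2 hne)
    linear_combination -hbinet + (r₁ - r₂) * hsum'
  · rintro ⟨h₁, h₂⟩
    rw [← FiniteField.pow_card_eq_self_iff_mem_range F] at h₁ h₂
    have hroot (r : K) (hr : (r - r₁) * (r - r₂) = 0) :
        (r ^ Fintype.card F - r₁) * (r ^ Fintype.card F - r₂) = 0 := by
      have hr' : r ^ 2 + r - algebraMap F K z = 0 := by
        linear_combination hr + r * hsum - hprod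
      have h := congrArg (FiniteField.frobeniusAlgHom F K) hr'
      simp only [map_sub, map_add, map_pow, AlgHom.commutes, map_zero,
        FiniteField.coe_frobeniusAlgHom] at h
      linear_combination h - r ^ Fintype.card F * hsum + hprod
    have e₁ : r₁ ^ Fintype.card F = r₂ :=
      sub_eq_zero.1 ((mul_eq_zero.1 (hroot r₁ (by simp))).resolve_left (sub_ne_zero.2 h₁))
    have e₂ : r₂ ^ Fintype.card F = r₁ :=
      sub_eq_zero.1 ((mul_eq_zero.1 (hroot r₂ (by simp))).resolve_right (sub_ne_zero.2 h₂))
    have hne : r₁ ≠ r₂ := fun h => h₁ (e₁.trans h.symm)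
    rw [e₁, e₂] at hbinet
    apply (algebraMap F K).injective
    rw [hmap, map_zero]
    apply mul_left_cancel₀ (sub_ne_zero.2 hne)
    linear_combination -hbinet
end
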